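/- Let d ≥ 2 and p₀ > p_c(d). For every ε ∈ (0, 1 − p₀), every p₀ ≤ p ≤ q ≤ 1 and every x ∈ ℤ^d, the time constants satisfy 0 ≤ μ_p(x) − μ_q(x) ≤ η'_d(p₀) ‖x‖₁ (C₁ |log ε| (q − p) + ε), where η'_d(p₀) is a constant depending only on d and p₀ and C₁ = C₁(p₀, d, β) is the constant from the bad-cluster control proposition. -/

import Mathlib

open MeasureTheory Filter Topology
open scoped ENNReal

namespace Perco

/-- Vertices of the hypercubic lattice `ℤ^d`. -/
abbrev V (d : ℕ) := Fin d → ℤ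

/-- The `ℓ¹` distance on `ℤ^d`. -/
def dist1 {d : ℕ} (x y : V d) : ℕ := ∑ i, (x i - y i).natAbs

/-- The `ℓ¹` norm, as a real number. -/
def norm1 {d : ℕ} (x : V d) : ℝ := (dist1 x 0 : ℝ)

/-- The `ℓ¹` distance, descended to unordered pairs. -/
def sym2dist1 {d : ℕ} : Sym2 (V d) → ℕ :=
  Sym2.lift ⟨fun x y => dist1 x y, fun x y => by
    unfold dist1
    exact Finset.sum_congr rfl fun i _ => by rw [← Int.natAbs_neg, neg_sub]⟩

/-- Edges of the lattice `(ℤ^d, 𝔼^d)`: unordered pairs of nearest neighbours. -/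
def Edge (d : ℕ) : Type := {e : Sym2 (V d) // sym2dist1 e = 1}

/-- A bond percolation configuration: every edge is open (`true`) or closed (`false`). -/
abbrev Config (d : ℕ) := Edge d → Bool

/-- The unordered pair `e` is an open edge of the configuration `ω`. -/
def openE {d : ℕ} (ω : Config d) (e : Sym2 (V d)) : Prop :=
  ∃ h : sym2dist1 e = 1, ω ⟨e, h⟩ = true

/-- `⟨x, y⟩` is an open edge of the configuration `ω`. -/
def edgeOpen {d : ℕ} (ω : Config d) (x y : V d) : Prop := openE ω s(x, y)

/-- `f 0, f 1, …, f n` is an `ω`-open path (with `n` edges). -/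
def IsOpenPath {d : ℕ} (ω : Config d) (n : ℕ) (f : ℕ → V d) : Prop :=
  ∀ i < n, edgeOpen ω (f i) (f (i + 1))

/-- `f 0, …, f n` is a (not necessarily open) lattice path of `ℤ^d`. -/
def IsLatticePath {d : ℕ} (n : ℕ) (f : ℕ → V d) : Prop :=
  ∀ i < n, dist1 (f i) (f (i + 1)) = 1

/-- The chemical distance between `x` and `y` in the configuration `ω`:
the minimal number of edges of an `ω`-open path from `x` to `y` (`⊤` if there is none). -/
noncomputable def chemDist {d : ℕ} (ω : Config d) (x y : V d) : ℝ≥0∞ :=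
  sInf {r : ℝ≥0∞ | ∃ (n : ℕ) (f : ℕ → V d),
    IsOpenPath ω n f ∧ f 0 = x ∧ f n = y ∧ r = (n : ℝ≥0∞)}

/-- `x` and `y` are connected by an `ω`-open path. -/
def Connected {d : ℕ} (ω : Config d) (x y : V d) : Prop := chemDist ω x y ≠ ⊤

/-- The open cluster of the vertex `x`. -/
def cluster {d : ℕ} (ω : Config d) (x : V d) : Set (V d) := {y | Connected ω x y}

/-- `x` lies in an infinite open cluster. -/
def InInfiniteCluster {d : ℕ} (ω : Config d) (x : V d) : Prop := (cluster ω x).Infinite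

open Classical in
/-- The regularized point `x̃`: a point of the infinite cluster minimizing the `ℓ¹`
distance to `x` (with a deterministic rule to break ties); `x` itself if there is none. -/
noncomputable def regPoint {d : ℕ} (ω : Config d) (x : V d) : V d :=
  if h : ∃ y : V d, InInfiniteCluster ω y ∧
      ∀ z : V d, InInfiniteCluster ω z → dist1 x y ≤ dist1 x z
  then h.choose else x

/-- Real-valued chemical distance (in the configuration `ωdist`) between the
regularizations (w.r.t. the configuration `ωreg`) of `x` and `y`. -/
noncomputable def DReg {d : ℕ} (ωdist ωreg : Config d) (x y : V d) : ℝ :=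
  (chemDist ωdist (regPoint ωreg x) (regPoint ωreg y)).toReal

open Classical in
/-- The number of elements of a set, as an element of `ℝ≥0∞` (`⊤` for infinite sets). -/
noncomputable def eSize {α : Type*} (A : Set α) : ℝ≥0∞ :=
  if h : A.Finite then (h.toFinset.card : ℝ≥0∞) else ⊤

/-!  ### Boxes and renormalization  -/

/-- The box of "radius" `R` centered at `c`: `∏ₖ [c k - R, c k + R)`. -/
def boxC {d : ℕ} (c : V d) (R : ℕ) : Set (V d) :=
  {x | ∀ k, c k - (R : ℤ) ≤ x k ∧ x k < c k + (R : ℤ)}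

/-- The center `i(2N+1)` of the `N`-box of macroscopic index `i`. -/
def center {d : ℕ} (N : ℕ) (i : V d) : V d := fun k => i k * (2 * (N : ℤ) + 1)

/-- The `N`-box `B_N(i) = i(2N+1) + [-N, N)^d`. -/
def macroBox {d : ℕ} (N : ℕ) (i : V d) : Set (V d) := boxC (center N i) N

/-- The enlarged box `B'_N(i) = i(2N+1) + [-3N, 3N)^d`. -/
def macroBox' {d : ℕ} (N : ℕ) (i : V d) : Set (V d) := boxC (center N i) (3 * N)

/-- An open path all of whose vertices stay in the set `S`. -/
def IsOpenPathIn {d : ℕ} (ω : Config d) (S : Set (V d)) (n : ℕ) (f : ℕ → V d) : Prop :=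
  IsOpenPath ω n f ∧ ∀ i ≤ n, f i ∈ S

/-- `x` and `y` are connected by an open path inside `S`. -/
def ConnectedIn {d : ℕ} (ω : Config d) (S : Set (V d)) (x y : V d) : Prop :=
  ∃ (n : ℕ) (f : ℕ → V d), IsOpenPathIn ω S n f ∧ f 0 = x ∧ f n = y

/-- The open cluster of `x` inside the set `S`. -/
def clusterIn {d : ℕ} (ω : Config d) (S : Set (V d)) (x : V d) : Set (V d) :=
  {y | ConnectedIn ω S x y}

/-- `C` is an open cluster of the region `S`. -/
def IsClusterIn {d : ℕ} (ω : Config d) (S : Set (V d)) (C : Set (V d)) : Prop :=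
  ∃ x ∈ S, C = clusterIn ω S x

/-- The cluster `C` has diameter at least `m`. -/
def diamGE {d : ℕ} (C : Set (V d)) (m : ℕ) : Prop :=
  ∃ x ∈ C, ∃ y ∈ C, ∃ k, (m : ℤ) ≤ |x k - y k|

/-- The cluster `C` is crossing for the box `boxC c R`: for each of the `d` directions,
`C ∩ boxC c R` contains an open path connecting the two opposite faces of the box. -/
def CrossingFor {d : ℕ} (ω : Config d) (C : Set (V d)) (c : V d) (R : ℕ) : Prop :=
  ∀ k : Fin d, ∃ (n : ℕ) (f : ℕ → V d), IsOpenPath ω n f ∧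
    (∀ m ≤ n, f m ∈ C ∩ boxC c R) ∧ f 0 k = c k - (R : ℤ) ∧ f n k = c k + (R : ℤ) - 1

/-- The `N`-box `B_N(i)` is good (for the configuration `ω`, with parameter `β`):
(i) there is a unique open cluster `C` of `B'_N(i)` of diameter at least `N`;
(ii) `C` is crossing for each of the `3^d` `N`-boxes included in `B'_N(i)`;
(iii) any two points of `C ∩ B'_N(i)` are at chemical distance at most `12βN`. -/
def IsGoodBox {d : ℕ} (ω : Config d) (N : ℕ) (β : ℝ) (i : V d) : Prop :=
  ∃ C : Set (V d),
    IsClusterIn ω (macroBox' N i) C ∧ diamGE C N ∧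
    (∀ C', IsClusterIn ω (macroBox' N i) C' → diamGE C' N → C' = C) ∧
    (∀ j : V d, (∀ k, |j k - i k| ≤ 1) → CrossingFor ω C (center N j) N) ∧
    (∀ x ∈ macroBox' N i, ∀ y ∈ macroBox' N i, x ∈ C → y ∈ C →
      chemDist ω x y ≤ ENNReal.ofReal (12 * β * N))

/-- `x` belongs to the crossing cluster of the good box `B_N(j)`, i.e. to a cluster of
`B'_N(j)` of diameter at least `N`. -/
def InCrossingCluster {d : ℕ} (ω : Config d) (N : ℕ) (j : V d) (x : V d) : Prop :=
  ∃ C : Set (V d), IsClusterIn ω (macroBox' N j) C ∧ diamGE C N ∧ x ∈ C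

/-!  ### Macroscopic site percolation -/

/-- A nearest-neighbour path of macroscopic sites staying in `S`. -/
def IsSitePathIn {d : ℕ} (S : Set (V d)) (n : ℕ) (f : ℕ → V d) : Prop :=
  (∀ m ≤ n, f m ∈ S) ∧ ∀ m < n, dist1 (f m) (f (m + 1)) = 1

/-- The sites `i` and `j` are connected by a nearest-neighbour path inside `S`. -/
def SiteConnectedIn {d : ℕ} (S : Set (V d)) (i j : V d) : Prop :=
  ∃ (n : ℕ) (f : ℕ → V d), IsSitePathIn S n f ∧ f 0 = i ∧ f n = j

/-- A `*`-path of macroscopic sites staying in `S` (consecutive sites are `*`-neighbours: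
their `ℓ^∞` distance is `1`). -/
def IsStarPathIn {d : ℕ} (S : Set (V d)) (n : ℕ) (f : ℕ → V d) : Prop :=
  (∀ m ≤ n, f m ∈ S) ∧ ∀ m < n, f m ≠ f (m + 1) ∧ ∀ k, |f (m + 1) k - f m k| ≤ 1

/-- The set of good macroscopic sites. -/
def goodSites {d : ℕ} (ω : Config d) (N : ℕ) (β : ℝ) : Set (V d) :=
  {i | IsGoodBox ω N β i}

/-- The macroscopic site `i` belongs to an infinite cluster of good boxes. -/
def InInfiniteGoodCluster {d : ℕ} (ω : Config d) (N : ℕ) (β : ℝ) (i : V d) : Prop :=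
  IsGoodBox ω N β i ∧ {j | SiteConnectedIn (goodSites ω N β) i j}.Infinite

/-- The union of the bad connected components (of the macroscopic site percolation)
meeting the set `Γ`; its size is `Σ_{C ∈ Bad, C ∩ Γ ≠ ∅} |C|`. -/
def badTouching {d : ℕ} (ω : Config d) (N : ℕ) (β : ℝ) (Γ : Set (V d)) : Set (V d) :=
  {j | ∃ i ∈ Γ, i ∉ goodSites ω N β ∧ SiteConnectedIn {k | k ∉ goodSites ω N β} i j}

/-!  ### Edges and sites of a path -/

/-- The set of edges of the path `f 0, …, f n`. -/
def pathEdges {d : ℕ} (n : ℕ) (f : ℕ → V d) : Set (Sym2 (V d)) :=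
  {e | ∃ i < n, e = s(f i, f (i + 1))}

/-- The set of vertices of the path `f 0, …, f n`. -/
def pathVerts {d : ℕ} (n : ℕ) (f : ℕ → V d) : Set (V d) :=
  {v | ∃ i ≤ n, f i = v}

/-- The set of `ω`-closed edges of the path `f 0, …, f n`. -/
def closedEdges {d : ℕ} (ω : Config d) (n : ℕ) (f : ℕ → V d) : Set (Sym2 (V d)) :=
  {e | e ∈ pathEdges n f ∧ ¬ openE ω e}

/-- The set `Γ` of macroscopic sites whose `N`-box is visited by the path `f 0, …, f n`. -/
def visitedSites {d : ℕ} (N : ℕ) (n : ℕ) (f : ℕ → V d) : Set (V d) :=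
  {i | ∃ m ≤ n, f m ∈ macroBox N i}

/-!  ### Probability: i.i.d. Bernoulli bond percolation -/

/-- A family of i.i.d. Bernoulli bond percolation measures on the configurations:
`P p` is a probability measure under which the states of the edges are independent
Bernoulli variables of parameter `p`. -/
structure BernoulliFamily (d : ℕ) where
  P : ℝ → Measure (Config d)
  prob : ∀ p, IsProbabilityMeasure (P p)
  iid : ∀ p, 0 ≤ p → p ≤ 1 → ∀ (s : Finset (Edge d)) (f : Edge d → Bool),
    P p {ω : Config d | ∀ e ∈ s, ω e = f e}
      = ∏ e ∈ s, ENNReal.ofReal (if f e then p else 1 - p)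

/-- The critical parameter `p_c(d)` of the family. -/
noncomputable def pc {d : ℕ} (F : BernoulliFamily d) : ℝ :=
  sInf {p : ℝ | 0 ≤ p ∧ p ≤ 1 ∧ 0 < F.P p {ω : Config d | InInfiniteCluster ω 0}}

/-- `t` is the time constant of the percolation measure `P`: for every `x ∈ ℤ^d`,
`D^{𝒞}(0̃, ñx)/n → t x` almost surely. -/
def ASTimeConstant {d : ℕ} (P : Measure (Config d)) (t : V d → ℝ) : Prop :=
  ∀ x : V d, ∀ᵐ ω ∂P, Tendsto (fun n : ℕ => DReg ω ω 0 (n • x) / n) atTop (𝓝 (t x))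

/-!  ### Couplings -/

/-- Two-stage coupling configurations: each edge carries a pair `(V, Z)` of Booleans. -/
abbrev CConfig (d : ℕ) := Edge d → Bool × Bool

/-- The `q`-configuration of a coupled configuration: `e` is `q`-open iff `V e = 1`. -/
def cfgQ {d : ℕ} (u : CConfig d) : Config d := fun e => (u e).1

/-- The `p`-configuration of a coupled configuration: `e` is `p`-open iff `V e Z e = 1`. -/
def cfgP {d : ℕ} (u : CConfig d) : Config d := fun e => (u e).1 && (u e).2

/-- Two-stage coupling of the `p`- and `q`-percolations: on each edge, independently,
`V` is Bernoulli of parameter `q` and `Z` is an independent Bernoulli of parameter `p/q`. -/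
structure CouplingMeasure (d : ℕ) (p q : ℝ) where
  Q : Measure (CConfig d)
  prob : IsProbabilityMeasure Q
  iid : ∀ (s : Finset (Edge d)) (f : Edge d → Bool × Bool),
    Q {u : CConfig d | ∀ e ∈ s, u e = f e}
      = ∏ e ∈ s,
          (ENNReal.ofReal (if (f e).1 then q else 1 - q) *
            ENNReal.ofReal (if (f e).2 then p / q else 1 - p / q))

/-- Standard coupling: i.i.d. uniform variables on `[0,1]`, one for each edge. -/
structure UniformCoupling (d : ℕ) where
  Q : Measure (Edge d → ℝ)
  prob : IsProbabilityMeasure Q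
  iid : ∀ (s : Finset (Edge d)) (a : Edge d → ℝ), (∀ e ∈ s, 0 ≤ a e ∧ a e ≤ 1) →
    Q {u | ∀ e ∈ s, u e ≤ a e} = ∏ e ∈ s, ENNReal.ofReal (a e)

open Classical in
/-- The `p`-configuration of the standard coupling: `e` is `p`-open iff `U e ≤ p`. -/
noncomputable def cfgAt {d : ℕ} (u : Edge d → ℝ) (p : ℝ) : Config d :=
  fun e => if u e ≤ p then true else false

/-- The critical parameter `p_c(d)` read on the standard coupling. -/
noncomputable def pcU {d : ℕ} (U : UniformCoupling d) : ℝ :=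
  sInf {p : ℝ | 0 ≤ p ∧ p ≤ 1 ∧ 0 < U.Q {u | InInfiniteCluster (cfgAt u p) 0}}

open Classical in
/-- A deterministically chosen geodesic (open path of minimal length) from `x` to `y`
in the configuration `ω` (a trivial constant path if there is none). -/
noncomputable def geod {d : ℕ} (ω : Config d) (x y : V d) : ℕ × (ℕ → V d) :=
  if h : ∃ nf : ℕ × (ℕ → V d), IsOpenPath ω nf.1 nf.2 ∧ nf.2 0 = x ∧ nf.2 nf.1 = y ∧
      (nf.1 : ℝ≥0∞) = chemDist ω x y
  then h.choose else (0, fun _ => x)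

/-!  ### Norms on `ℝ^d` -/

/-- `f` is a norm on the Euclidean space `ℝ^d`. -/
def IsNorm {d : ℕ} (f : EuclideanSpace ℝ (Fin d) → ℝ) : Prop :=
  (∀ x, 0 ≤ f x) ∧ (∀ x, f x = 0 ↔ x = 0) ∧
  (∀ (c : ℝ) (x), f (c • x) = |c| * f x) ∧ ∀ x y, f (x + y) ≤ f x + f y

/-- The canonical embedding of `ℤ^d` into the Euclidean space `ℝ^d`. -/
noncomputable def toEuc {d : ℕ} (x : V d) : EuclideanSpace ℝ (Fin d) :=
  (WithLp.equiv 2 (Fin d → ℝ)).symm fun i => (x i : ℝ)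

/-- Property (1) of the path-modification lemma: the edges of `γ' \ γ` decompose as a
disjoint union of self-avoiding `p`-open paths intersecting `γ' ∩ γ` at their endpoints. -/
def DisjointPathDecomposition {d : ℕ} (ωp : Config d) (n : ℕ) (f : ℕ → V d)
    (n' : ℕ) (g : ℕ → V d) : Prop :=
  ∃ (K : ℕ) (m : ℕ → ℕ) (h : ℕ → ℕ → V d),
    (⋃ j ∈ Finset.range K, pathEdges (m j) (h j)) = pathEdges n' g \ pathEdges n f ∧
    (∀ j < K, IsOpenPath ωp (m j) (h j)) ∧
    (∀ j < K, ∀ a ≤ m j, ∀ b ≤ m j, h j a = h j b → a = b) ∧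
    (∀ j < K, ∀ l < K, j ≠ l → Disjoint (pathEdges (m j) (h j)) (pathEdges (m l) (h l))) ∧
    (∀ j < K, h j 0 ∈ pathVerts n f ∧ h j (m j) ∈ pathVerts n f) ∧
    (∀ j < K, ∀ a, 0 < a → a < m j → h j a ∉ pathVerts n f)

/-- The conclusion of the path-modification lemma, for the constant `ρ`:
any `q`-open path between well-connected points of `𝒞_p` can be turned into a `p`-open
path, the total length of the bypasses being controlled by the bad clusters met and the
number of `p`-closed edges. -/
def BypassProperty (d : ℕ) (ρ : ℕ) : Prop :=
  ∀ (N : ℕ), 1 ≤ N → ∀ (β : ℝ), 1 ≤ β → ∀ (ωp ωq : Config d),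
    (∀ e, ωp e = true → ωq e = true) →
    ∀ y z : V d, InInfiniteCluster ωp y → InInfiniteCluster ωp z →
    (∃ i, y ∈ macroBox N i ∧ InInfiniteGoodCluster ωp N β i) →
    (∃ i, z ∈ macroBox N i ∧ InInfiniteGoodCluster ωp N β i) →
    ∀ (n : ℕ) (f : ℕ → V d), IsOpenPath ωq n f → f 0 = y → f n = z →
    ∃ (n' : ℕ) (g : ℕ → V d), IsOpenPath ωp n' g ∧ g 0 = y ∧ g n' = z ∧
      DisjointPathDecomposition ωp n f n' g ∧
      eSize (pathEdges n' g \ pathEdges n f) ≤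
        ((ρ * N : ℕ) : ℝ≥0∞) *
          (eSize (badTouching ωp N β (visitedSites N n f)) + eSize (closedEdges ωp n f))



end Perco

namespace Perco
variable {d : ℕ}

/-! ### Distances -/
theorem dist1_comm (x y : V d) : dist1 x y = dist1 y x := by
  unfold dist1
  exact Finset.sum_congr rfl fun i _ => by rw [← Int.natAbs_neg, neg_sub]

theorem dist1_self (x : V d) : dist1 x x = 0 := by simp [dist1]

theorem dist1_triangle (x y z : V d) : dist1 x z ≤ dist1 x y + dist1 y z := by
  unfold dist1
  rw [← Finset.sum_add_distrib]
  exact Finset.sum_le_sum fun i _ => by omega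

theorem coord_le_dist1 (x y : V d) (i : Fin d) : |x i - y i| ≤ (dist1 x y : ℤ) := by
  have : (x i - y i).natAbs ≤ dist1 x y :=
    Finset.single_le_sum (f := fun i => (x i - y i).natAbs) (fun _ _ => Nat.zero_le _) (Finset.mem_univ i)
  rw [Int.abs_eq_natAbs]; omega

theorem dist1_eq_zero {x y : V d} (h : dist1 x y = 0) : x = y := by
  funext i
  have := coord_le_dist1 x y i
  rw [h] at this
  have := abs_nonneg (x i - y i)
  have h2 : |x i - y i| = 0 := by push_cast at *; omega
  have := abs_eq_zero.1 h2
  omega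

theorem dist1_le_of_coord {x y : V d} {r : ℕ} (h : ∀ i, |x i - y i| ≤ r) : dist1 x y ≤ d * r := by
  unfold dist1
  calc _ ≤ ∑ _i : Fin d, r := Finset.sum_le_sum fun i _ => by have := h i; rw [Int.abs_eq_natAbs] at this; omega
    _ = d * r := by simp

theorem dist1_add_right (x y z : V d) : dist1 (x + z) (y + z) = dist1 x y := by
  simp [dist1]

theorem dist1_nsmul (n : ℕ) (x y : V d) : dist1 (n • x) (n • y) = n * dist1 x y := by
  unfold dist1
  rw [Finset.mul_sum]
  refine Finset.sum_congr rfl fun i _ => ?_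
  simp only [Pi.smul_apply, nsmul_eq_mul]
  rw [← mul_sub, Int.natAbs_mul]; simp

/-! ### The open graph -/
/-- The graph of open edges. -/
def gr (ω : Config d) : SimpleGraph (V d) where
  Adj x y := edgeOpen ω x y
  symm := ⟨fun x y h => by
    unfold edgeOpen at *
    rwa [Sym2.eq_swap]⟩
  loopless := ⟨fun x h => by
    obtain ⟨h, _⟩ := h
    simp [sym2dist1, dist1_self] at h⟩

theorem gr_adj {ω : Config d} {x y : V d} : (gr ω).Adj x y ↔ edgeOpen ω x y := Iff.rfl

theorem dist1_of_adj {ω : Config d} {x y : V d} (h : (gr ω).Adj x y) : dist1 x y = 1 := h.1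

/-- the lattice edge between two neighbours -/
def mkE (x y : V d) (h : dist1 x y = 1) : Edge d := ⟨s(x, y), h⟩

/-- the ends of an edge -/
def ends (e : Edge d) : Sym2 (V d) := Subtype.val (p := fun e : Sym2 (V d) => sym2dist1 e = 1) e

theorem ends_mkE (x y : V d) (h : dist1 x y = 1) : ends (mkE x y h) = s(x, y) := rfl

theorem ends_injective : Function.Injective (ends : Edge d → Sym2 (V d)) := Subtype.val_injective

theorem adj_iff {ω : Config d} {x y : V d} : (gr ω).Adj x y ↔ ∃ h : dist1 x y = 1, ω (mkE x y h) = true :=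
  Iff.rfl

instance : Countable (Edge d) := by unfold Edge; infer_instance

instance : DecidableEq (Edge d) := by unfold Edge; infer_instance

theorem Edge.exists_rep (e : Edge d) : ∃ x y, ∃ h : dist1 x y = 1, e = mkE x y h := by
  obtain ⟨e, he⟩ := e
  induction e using Sym2.ind with
  | _ x y => exact ⟨x, y, he, rfl⟩

theorem gr_mono {ω ω' : Config d} (h : ω ≤ ω') : gr ω ≤ gr ω' := by
  intro x y hxy
  rw [adj_iff] at *
  obtain ⟨h1, h2⟩ := hxy
  exact ⟨h1, by have := h (mkE x y h1); rw [h2] at this; exact top_le_iff.1 this⟩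

/-- reachability -/
abbrev Reach (ω : Config d) (x y : V d) : Prop := (gr ω).Reachable x y

theorem Reach.mono {ω ω' : Config d} (h : ω ≤ ω') {x y : V d} (hr : Reach ω x y) : Reach ω' x y :=
  SimpleGraph.Reachable.mono (gr_mono h) hr

theorem path_to_walk {ω : Config d} (n : ℕ) : ∀ f : ℕ → V d, IsOpenPath ω n f →
    ∃ w : (gr ω).Walk (f 0) (f n), w.length = n := by
  induction n with
  | zero => intro f _; exact ⟨SimpleGraph.Walk.nil, rfl⟩
  | succ n ih =>
    intro f hf
    obtain ⟨w, hw⟩ := ih (fun i => f (i+1)) (fun i hi => hf (i+1) (by omega))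
    have h0 : (gr ω).Adj (f 0) (f (0+1)) := hf 0 (by omega)
    exact ⟨SimpleGraph.Walk.cons h0 w, by rw [SimpleGraph.Walk.length_cons, hw]⟩

theorem walk_to_path {ω : Config d} {x y : V d} (w : (gr ω).Walk x y) :
    ∃ f : ℕ → V d, IsOpenPath ω w.length f ∧ f 0 = x ∧ f w.length = y :=
  ⟨w.getVert, fun _ hi => w.adj_getVert_succ hi, by simp, by simp⟩

theorem chemDist_le {ω : Config d} {x y : V d} (w : (gr ω).Walk x y) : chemDist ω x y ≤ w.length := by
  obtain ⟨f, hf⟩ := walk_to_path w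
  exact sInf_le ⟨w.length, f, hf.1, hf.2.1, hf.2.2, rfl⟩

theorem exists_walk_of_chemDist_lt {ω : Config d} {x y : V d} {r : ℝ≥0∞} (h : chemDist ω x y < r) :
    ∃ w : (gr ω).Walk x y, (w.length : ℝ≥0∞) < r := by
  obtain ⟨a, ⟨n, f, h1, h2, h3, rfl⟩, hlt⟩ := sInf_lt_iff.1 h
  obtain ⟨w, hw⟩ := path_to_walk n f h1
  subst h2; subst h3
  exact ⟨w, by rwa [hw]⟩

theorem connected_iff {ω : Config d} {x y : V d} : Connected ω x y ↔ Reach ω x y := by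
  constructor
  · intro h
    obtain ⟨w, _⟩ := exists_walk_of_chemDist_lt (lt_top_iff_ne_top.2 h)
    exact ⟨w⟩
  · rintro ⟨w⟩
    exact ne_top_of_le_ne_top (by simp) (chemDist_le w)

/-- existence of an optimal walk -/
theorem exists_walk_chemDist {ω : Config d} {x y : V d} (h : Reach ω x y) :
    ∃ w : (gr ω).Walk x y, (w.length : ℝ≥0∞) = chemDist ω x y := by
  obtain ⟨w, hw⟩ := h.exists_walk_length_eq_dist
  refine ⟨w, le_antisymm ?_ (chemDist_le w)⟩
  refine le_sInf ?_
  rintro a ⟨n, f, h1, rfl, rfl, rfl⟩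
  obtain ⟨w', hw'⟩ := path_to_walk n f h1
  rw [hw]
  have := SimpleGraph.dist_le w'
  rw [hw'] at this
  exact_mod_cast this

theorem dist1_le_length {ω : Config d} {x y : V d} (w : (gr ω).Walk x y) : dist1 x y ≤ w.length := by
  induction w with
  | nil => simp [dist1_self]
  | cons h p ih =>
    rename_i u v w
    have := dist1_triangle u v w
    have := dist1_of_adj h
    simp; omega

theorem dist1_le_of_mem_support {ω : Config d} {x y z : V d} (w : (gr ω).Walk x y) (h : z ∈ w.support) :
    dist1 x z ≤ w.length := by
  classical
  exact (dist1_le_length (w.takeUntil z h)).trans (w.length_takeUntil_le_length h)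

theorem dist1_le_chemDist (ω : Config d) (x y : V d) : (dist1 x y : ℝ≥0∞) ≤ chemDist ω x y := by
  refine le_sInf ?_
  rintro a ⟨n, f, h1, rfl, rfl, rfl⟩
  obtain ⟨w', hw'⟩ := path_to_walk n f h1
  exact_mod_cast hw' ▸ dist1_le_length w'

theorem chemDist_triangle (ω : Config d) (x y z : V d) :
    chemDist ω x z ≤ chemDist ω x y + chemDist ω y z := by
  by_cases h1 : Reach ω x y
  · by_cases h2 : Reach ω y z
    · obtain ⟨w1, e1⟩ := exists_walk_chemDist h1
      obtain ⟨w2, e2⟩ := exists_walk_chemDist h2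
      rw [← e1, ← e2]
      refine (chemDist_le (w1.append w2)).trans ?_
      simp
    · rw [← connected_iff, Connected, not_not] at h2; simp [h2]
  · rw [← connected_iff, Connected, not_not] at h1; simp [h1]

theorem chemDist_comm (ω : Config d) (x y : V d) : chemDist ω x y = chemDist ω y x := by
  have key : ∀ x y : V d, chemDist ω x y ≤ chemDist ω y x := by
    intro x y
    by_cases h1 : Reach ω y x
    · obtain ⟨w1, e1⟩ := exists_walk_chemDist h1
      rw [← e1, ← w1.length_reverse]
      exact chemDist_le _
    · rw [← connected_iff, Connected, not_not] at h1; simp [h1]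
  exact le_antisymm (key _ _) (key _ _)

theorem chemDist_anti {ω ω' : Config d} (h : ω ≤ ω') (x y : V d) : chemDist ω' x y ≤ chemDist ω x y := by
  by_cases h1 : Reach ω x y
  · obtain ⟨w1, e1⟩ := exists_walk_chemDist h1
    rw [← e1]
    refine (chemDist_le (w1.mapLe (gr_mono h))).trans ?_
    simp
  · rw [← connected_iff, Connected, not_not] at h1; simp [h1]

theorem chemDist_self (ω : Config d) (x : V d) : chemDist ω x x = 0 := by
  have := chemDist_le (SimpleGraph.Walk.nil : (gr ω).Walk x x)
  simpa using this

/-! ### Boxes -/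
/-- sup-norm ball -/
noncomputable def box (x : V d) (r : ℕ) : Finset (V d) := Finset.Icc (fun k => x k - r) (fun k => x k + r)

theorem mem_box {x y : V d} {r : ℕ} : y ∈ box x r ↔ ∀ k, |y k - x k| ≤ r := by
  simp only [box, Finset.mem_Icc, Pi.le_def, abs_le]
  constructor
  · rintro ⟨h1, h2⟩ k
    have := h1 k; have := h2 k; constructor <;> omega
  · intro h
    refine ⟨fun k => ?_, fun k => ?_⟩ <;> have := h k <;> omega

theorem self_mem_box (x : V d) (r : ℕ) : x ∈ box x r := by
  rw [mem_box]; intro k; simp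

theorem mem_box_of_dist1 {x y : V d} {r : ℕ} (h : dist1 x y ≤ r) : y ∈ box x r := by
  rw [mem_box]; intro k
  have := coord_le_dist1 y x k
  rw [dist1_comm] at this
  omega

theorem dist1_of_mem_box {x y : V d} {r : ℕ} (h : y ∈ box x r) : dist1 x y ≤ d * r := by
  rw [dist1_comm]
  exact dist1_le_of_coord (mem_box.1 h)

theorem mem_box_comm {x y : V d} {r : ℕ} : y ∈ box x r ↔ x ∈ box y r := by
  simp only [mem_box, abs_sub_comm]

theorem mem_box_trans {x y z : V d} {r s : ℕ} (h1 : y ∈ box x r) (h2 : z ∈ box y s) : z ∈ box x (r+s) := by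
  rw [mem_box] at *
  intro k
  have := abs_le.1 (h1 k); have := abs_le.1 (h2 k); rw [abs_le]; push_cast; constructor <;> omega

theorem box_mono {x : V d} {r s : ℕ} (h : r ≤ s) : box x r ⊆ box x s := by
  intro y; rw [mem_box, mem_box]; intro h1 k; have := h1 k; omega

theorem box_subset {x y : V d} {r s t : ℕ} (h : y ∈ box x r) (hs : r + s ≤ t) : box y s ⊆ box x t :=
  fun _ hz => box_mono hs (mem_box_trans h hz)

theorem card_box (x : V d) (r : ℕ) : (box x r).card = (2*r+1)^d := by
  simp only [box, Pi.card_Icc, Int.card_Icc]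
  rw [Finset.prod_congr rfl (g := fun _ => 2*r+1)]
  · simp
  · intro k _; omega

theorem mem_box_add {x y z : V d} {r : ℕ} : y + z ∈ box (x + z) r ↔ y ∈ box x r := by
  simp [mem_box]

/-! ### Restriction -/
open Classical in
/-- close all edges that are not inside `S` -/
noncomputable def restr (S : Set (V d)) (ω : Config d) : Config d :=
  fun e => if (∀ v ∈ ends e, v ∈ S) then ω e else false

theorem restr_le (S : Set (V d)) (ω : Config d) : restr S ω ≤ ω := by
  intro e; unfold restr; split_ifs <;> simp

theorem restr_mono_set {S T : Set (V d)} (h : S ⊆ T) (ω : Config d) : restr S ω ≤ restr T ω := by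
  intro e; unfold restr
  by_cases h1 : ∀ v ∈ ends e, v ∈ S
  · rw [if_pos h1, if_pos (fun v hv => h (h1 v hv))]
  · rw [if_neg h1]; exact bot_le

theorem restr_mono {S : Set (V d)} {ω ω' : Config d} (h : ω ≤ ω') : restr S ω ≤ restr S ω' := by
  intro e; unfold restr; split_ifs
  · exact h e
  · exact le_rfl

theorem restr_eq_true {S : Set (V d)} {ω : Config d} {e : Edge d} :
    restr S ω e = true ↔ ω e = true ∧ ∀ v ∈ ends e, v ∈ S := by
  unfold restr
  by_cases h : ∀ v ∈ ends e, v ∈ S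
  · rw [if_pos h]; exact ⟨fun h2 => ⟨h2, h⟩, fun h2 => h2.1⟩
  · rw [if_neg h]; exact ⟨fun h2 => by simp at h2, fun h2 => absurd h2.2 h⟩

theorem restr_adj {S : Set (V d)} {ω : Config d} {x y : V d} :
    (gr (restr S ω)).Adj x y ↔ (gr ω).Adj x y ∧ x ∈ S ∧ y ∈ S := by
  simp only [adj_iff, restr_eq_true, ends_mkE, Sym2.mem_iff, forall_eq_or_imp, forall_eq]
  constructor
  · rintro ⟨h, h2, h3⟩; exact ⟨⟨h, h2⟩, h3⟩
  · rintro ⟨⟨h, h2⟩, h3⟩; exact ⟨h, h2, h3⟩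

theorem restr_walk {S : Set (V d)} {ω : Config d} {x y : V d} (w : (gr ω).Walk x y)
    (h : ∀ z ∈ w.support, z ∈ S) : ∃ w' : (gr (restr S ω)).Walk x y, w'.length = w.length ∧ w'.support = w.support := by
  induction w with
  | nil => exact ⟨SimpleGraph.Walk.nil, rfl, rfl⟩
  | cons hadj p ih =>
    obtain ⟨w', hw', hs⟩ := ih (fun z hz => h z (by simp [hz]))
    refine ⟨SimpleGraph.Walk.cons (restr_adj.2 ⟨hadj, h _ (by simp), h _ (by simp)⟩) w', ?_, ?_⟩ 
    · simp [hw']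
    · simp [hs]

theorem restr_support {S : Set (V d)} {ω : Config d} {x y : V d} (w : (gr (restr S ω)).Walk x y) (hx : x ∈ S) :
    ∀ z ∈ w.support, z ∈ S := by
  induction w with
  | nil => intro z hz; simp at hz; subst hz; exact hx
  | cons h p ih =>
    intro z hz
    simp at hz
    rcases hz with rfl | hz
    · exact hx
    · exact ih (restr_adj.1 h).2.2 z hz

theorem restr_reach_mem {S : Set (V d)} {ω : Config d} {x y : V d} (h : Reach (restr S ω) x y) (hx : x ∈ S) : y ∈ S := by
  obtain ⟨w⟩ := h
  exact restr_support w hx y (by simp)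

theorem restr_restr {S T : Set (V d)} (ω : Config d) : restr S (restr T ω) = restr (S ∩ T) ω := by
  funext e
  simp only [restr, Set.mem_inter_iff]
  by_cases h1 : ∀ v ∈ ends e, v ∈ S <;> by_cases h2 : ∀ v ∈ ends e, v ∈ T
  · rw [if_pos h1, if_pos h2, if_pos (fun v hv => ⟨h1 v hv, h2 v hv⟩)]
  · rw [if_pos h1, if_neg h2, if_neg (fun h => h2 fun v hv => (h v hv).2)]
  · rw [if_neg h1, if_neg (fun h => h1 fun v hv => (h v hv).1)]
  · rw [if_neg h1, if_neg (fun h => h2 fun v hv => (h v hv).2)]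

/-- Exit lemma -/
theorem exit_lemma {ω : Config d} {x y : V d} (S : Set (V d)) (h : Reach ω x y) (hx : x ∈ S) (hy : y ∉ S) :
    ∃ z ∈ S, ∃ z' ∉ S, Reach (restr S ω) x z ∧ (gr ω).Adj z z' := by
  obtain ⟨w⟩ := h
  induction w with
  | nil => exact absurd hx hy
  | cons hadj p ih =>
    rename_i u v w
    by_cases hv : v ∈ S
    · obtain ⟨z, hz, z', hz', h1, h2⟩ := ih hv hy
      exact ⟨z, hz, z', hz', (SimpleGraph.Adj.reachable (restr_adj.2 ⟨hadj, hx, hv⟩)).trans h1, h2⟩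
    · exact ⟨u, hx, v, hv, SimpleGraph.Reachable.refl _, hadj⟩

theorem reach_restr_or {ω : Config d} {x y : V d} (S : Set (V d)) (h : Reach ω x y) (hx : x ∈ S) :
    Reach (restr S ω) x y ∨ ∃ z ∈ S, ∃ z' ∉ S, Reach (restr S ω) x z ∧ (gr ω).Adj z z' := by
  by_contra hc
  push Not at hc
  obtain ⟨h1, h2⟩ := hc
  obtain ⟨w⟩ := h
  apply h1
  have : ∀ u v (w : (gr ω).Walk u v), Reach (restr S ω) x u → u ∈ S → Reach (restr S ω) x v := by
    intro u v w
    induction w with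
    | nil => intro h _; exact h
    | cons hadj p ih =>
      rename_i a b c
      intro h ha
      have hb : b ∈ S := by
        by_contra hb
        exact h2 a ha b hb h hadj
      exact ih (h.trans (SimpleGraph.Adj.reachable (restr_adj.2 ⟨hadj, ha, hb⟩))) hb
  exact this x y w (SimpleGraph.Reachable.refl _) hx

theorem short_walk {S : Finset (V d)} {ω : Config d} {x y : V d} (h : Reach (restr S ω) x y) (hx : x ∈ S) :
    ∃ w : (gr (restr S ω)).Walk x y, w.length ≤ S.card := by
  classical
  obtain ⟨w, hw⟩ := h.exists_isPath
  refine ⟨w, ?_⟩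
  have h1 := restr_support w (by simpa using hx)
  have h2 : w.support.toFinset ⊆ S := by
    intro z hz; simpa using h1 z (by simpa using hz)
  have h3 := Finset.card_le_card h2
  rw [List.toFinset_card_of_nodup hw.support_nodup] at h3
  simp at h3
  omega

theorem chemDist_le_card {S : Finset (V d)} {ω : Config d} {x y : V d} (h : Reach (restr S ω) x y) (hx : x ∈ S) :
    chemDist ω x y ≤ S.card := by
  obtain ⟨w, hw⟩ := short_walk h hx
  exact (chemDist_anti (restr_le _ _) x y).trans ((chemDist_le w).trans (by exact_mod_cast hw))

/-! ### Far and infinite clusters -/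
/-- the cluster of `x` exits `box x K` -/
def Far (ω : Config d) (x : V d) (K : ℕ) : Prop := ∃ y, Reach ω x y ∧ y ∉ box x K

theorem Far.mono {ω ω' : Config d} (h : ω ≤ ω') {x : V d} {K : ℕ} (hf : Far ω x K) : Far ω' x K := by
  obtain ⟨y, h1, h2⟩ := hf
  exact ⟨y, h1.mono h, h2⟩

theorem Far.anti {ω : Config d} {x : V d} {K K' : ℕ} (hK : K' ≤ K) (hf : Far ω x K) : Far ω x K' := by
  obtain ⟨y, h1, h2⟩ := hf
  exact ⟨y, h1, fun h => h2 (box_mono hK h)⟩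

theorem Far.of_reach {ω : Config d} {x x' : V d} {K r : ℕ} (hx : Reach ω x x') (hb : x' ∈ box x r)
    (hf : Far ω x (K + r)) : Far ω x' K := by
  obtain ⟨y, h1, h2⟩ := hf
  refine ⟨y, hx.symm.trans h1, fun h => h2 ?_⟩
  rw [add_comm]
  exact mem_box_trans hb h

/-- infinite cluster predicate -/
abbrev Inf (ω : Config d) (x : V d) : Prop := InInfiniteCluster ω x

theorem mem_cluster {ω : Config d} {x y : V d} : y ∈ cluster ω x ↔ Reach ω x y := connected_iff

theorem inf_iff {ω : Config d} {x : V d} : InInfiniteCluster ω x ↔ ∀ K, Far ω x K := by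
  constructor
  · intro h K
    by_contra hc
    apply h
    refine (box x K).finite_toSet.subset ?_
    intro y hy
    by_contra hyb
    exact hc ⟨y, mem_cluster.1 hy, hyb⟩
  · intro h hfin
    obtain ⟨K, hK⟩ : ∃ K : ℕ, ∀ y ∈ cluster ω x, dist1 x y ≤ K := by
      obtain ⟨K, hK⟩ := (hfin.image (dist1 x)).bddAbove
      exact ⟨K, fun y hy => hK ⟨y, hy, rfl⟩⟩
    obtain ⟨y, h1, h2⟩ := h K
    exact h2 (mem_box_of_dist1 (hK y (mem_cluster.2 h1)))

theorem Inf.of_reach {ω : Config d} {x x' : V d} (hx : Reach ω x x') (h : Inf ω x) : Inf ω x' := by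
  have : cluster ω x' = cluster ω x := by
    ext y; rw [mem_cluster, mem_cluster]
    exact ⟨fun h => hx.trans h, fun h => hx.symm.trans h⟩
  unfold Inf InInfiniteCluster at *
  rwa [this]

theorem Inf.mono {ω ω' : Config d} (h : ω ≤ ω') {x : V d} (hf : Inf ω x) : Inf ω' x := by
  rw [Inf, inf_iff] at *
  exact fun K => (hf K).mono h

/-! ### Finite edge sets and locality -/
/-- edges inside a finite vertex set -/
noncomputable def edgesIn (S : Finset (V d)) : Finset (Edge d) :=
  Set.Finite.toFinset (s := {e : Edge d | ∀ v ∈ ends e, v ∈ S}) (by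
    refine Set.Finite.of_finite_image (f := fun e : Edge d => ends e) ?_ ?_
    · refine (S.sym2.finite_toSet).subset ?_
      rintro _ ⟨e, he, rfl⟩
      exact Finset.mem_coe.2 (Finset.mem_sym2_iff.2 he)
    · intro a _ b _ h; exact ends_injective h)

theorem mem_edgesIn {S : Finset (V d)} {e : Edge d} : e ∈ edgesIn S ↔ ∀ v ∈ ends e, v ∈ S := by
  simp [edgesIn]

theorem mkE_mem_edgesIn {S : Finset (V d)} {x y : V d} {h : dist1 x y = 1} : mkE x y h ∈ edgesIn S ↔ x ∈ S ∧ y ∈ S := by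
  rw [mem_edgesIn, ends_mkE]; simp

theorem edgesIn_mono {S T : Finset (V d)} (h : S ⊆ T) : edgesIn S ⊆ edgesIn T := by
  intro e; rw [mem_edgesIn, mem_edgesIn]; exact fun h1 v hv => h (h1 v hv)

theorem restr_congr {S : Finset (V d)} {ω ω' : Config d} (h : ∀ e ∈ edgesIn S, ω e = ω' e) :
    restr (S : Set (V d)) ω = restr S ω' := by
  funext e
  unfold restr
  by_cases h1 : ∀ v ∈ ends e, v ∈ (S : Set (V d))
  · rw [if_pos h1, if_pos h1]
    exact h e (mem_edgesIn.2 (by simpa using h1))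
  · rw [if_neg h1, if_neg h1]

theorem dependsOn_restr {α : Type*} {S : Finset (V d)} (f : Config d → α) :
    DependsOn (fun ω => f (restr (S : Set (V d)) ω)) (edgesIn S : Set (Edge d)) := by
  intro ω ω' h
  simp only
  rw [restr_congr (fun e he => h e he)]

theorem far_iff_restr {ω : Config d} {x : V d} {K : ℕ} :
    Far ω x K ↔ ∃ y, Reach (restr (box x (K+1)) ω) x y ∧ y ∉ box x K := by
  constructor
  · rintro ⟨y, h1, h2⟩
    obtain ⟨z, hz, z', hz', h3, h4⟩ := exit_lemma (S := (box x K : Set (V d))) h1 (by simpa using self_mem_box x K) (by simpa using h2)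
    have hz1 : z ∈ box x K := by simpa using hz
    have hzz : z' ∈ box x (K+1) := mem_box_trans hz1 (mem_box_of_dist1 (dist1_of_adj h4).le)
    refine ⟨z', ?_, by simpa using hz'⟩
    refine (h3.mono (restr_mono_set ?_ ω)).trans (SimpleGraph.Adj.reachable (restr_adj.2 ⟨h4, ?_, ?_⟩))
    · exact_mod_cast box_mono (Nat.le_succ K)
    · exact_mod_cast box_mono (Nat.le_succ K) hz1
    · exact_mod_cast hzz
  · rintro ⟨y, h1, h2⟩
    exact ⟨y, h1.mono (restr_le _ _), h2⟩

theorem dependsOn_far (x : V d) (K : ℕ) : DependsOn (fun ω => Far ω x K) (edgesIn (box x (K+1)) : Set (Edge d)) := by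
  have : (fun ω : Config d => Far ω x K) = fun ω => (fun ω => ∃ y, Reach ω x y ∧ y ∉ box x K) (restr (box x (K+1)) ω) := by
    funext ω; exact propext far_iff_restr
  rw [this]
  exact dependsOn_restr (fun ω => ∃ y, Reach ω x y ∧ y ∉ box x K)

theorem reach_iff_restr {ω : Config d} {x y : V d} : Reach ω x y ↔ ∃ n, Reach (restr (box (0 : V d) n) ω) x y := by
  constructor
  · rintro ⟨w⟩
    obtain ⟨K, hK⟩ : ∃ K : ℕ, ∀ z ∈ w.support, dist1 0 z ≤ K := by
      obtain ⟨K, hK⟩ := ((w.support.toFinset.finite_toSet).image (dist1 0)).bddAbove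
      exact ⟨K, fun y hy => hK ⟨y, by simpa using hy, rfl⟩⟩
    obtain ⟨w', _⟩ := restr_walk (S := (box (0 : V d) K : Set (V d))) w (fun z hz => by
      simpa using mem_box_of_dist1 (hK z hz))
    exact ⟨K, ⟨w'⟩⟩
  · rintro ⟨n, h⟩
    exact h.mono (restr_le _ _)

theorem measurable_of_local {α : Type*} [MeasurableSpace α] (S : Finset (Edge d)) (f : Config d → α)
    (hf : DependsOn f (S : Set (Edge d))) : Measurable f := by
  classical
  have : f = (fun g : S → Bool => f (fun e => if h : e ∈ S then g ⟨e, h⟩ else false)) ∘ (fun ω (e : S) => ω e) := by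
    funext ω
    simp only [Function.comp]
    apply hf
    intro e he
    have : e ∈ S := by simpa using he
    simp [this]
  rw [this]
  refine Measurable.comp (measurable_of_finite _) ?_
  exact measurable_pi_lambda _ fun e => measurable_pi_apply _

theorem measurableSet_of_local (S : Finset (Edge d)) (p : Config d → Prop)
    (hf : DependsOn p (S : Set (Edge d))) : MeasurableSet {ω | p ω} :=
  measurableSet_setOfPred.2 (measurable_of_local S p hf)

theorem measurableSet_reach_restr (S : Finset (V d)) (x y : V d) :
    MeasurableSet {ω : Config d | Reach (restr S ω) x y} :=
  measurableSet_of_local (edgesIn S) _ (dependsOn_restr (fun ω => Reach ω x y))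

theorem measurableSet_reach (x y : V d) : MeasurableSet {ω : Config d | Reach ω x y} := by
  have : {ω : Config d | Reach ω x y} = ⋃ n, {ω | Reach (restr (box (0 : V d) n) ω) x y} := by
    ext ω; simp only [Set.mem_ofPred_eq, Set.mem_iUnion]; exact reach_iff_restr
  rw [this]
  exact MeasurableSet.iUnion fun n => measurableSet_reach_restr _ _ _

theorem measurableSet_far (x : V d) (K : ℕ) : MeasurableSet {ω : Config d | Far ω x K} :=
  measurableSet_of_local _ _ (dependsOn_far x K)

theorem measurableSet_inf (x : V d) : MeasurableSet {ω : Config d | Inf ω x} := by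
  have : {ω : Config d | Inf ω x} = ⋂ K, {ω | Far ω x K} := by
    ext ω; simp only [Set.mem_ofPred_eq, Set.mem_iInter]; exact inf_iff
  rw [this]
  exact MeasurableSet.iInter fun n => measurableSet_far _ _

theorem chemDist_le_iff {ω : Config d} {x y : V d} {n : ℕ} :
    chemDist ω x y ≤ n ↔ ∃ w : (gr ω).Walk x y, w.length ≤ n := by
  constructor
  · intro h
    have hr : Reach ω x y := connected_iff.1 (ne_top_of_le_ne_top (by simp) h)
    obtain ⟨w, hw⟩ := exists_walk_chemDist hr
    exact ⟨w, by rw [← hw] at h; exact_mod_cast h⟩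
  · rintro ⟨w, hw⟩
    exact (chemDist_le w).trans (by exact_mod_cast hw)

theorem chemDist_le_iff_restr {ω : Config d} {x y : V d} {n m : ℕ} (hnm : n ≤ m) :
    chemDist ω x y ≤ n ↔ chemDist (restr (box x m) ω) x y ≤ n := by
  constructor
  · intro h
    obtain ⟨w, hw⟩ := chemDist_le_iff.1 h
    obtain ⟨w', hw', _⟩ := restr_walk (S := (box x m : Set (V d))) w (fun z hz => by
      simpa using mem_box_of_dist1 ((dist1_le_of_mem_support w hz).trans (hw.trans hnm)))
    exact chemDist_le_iff.2 ⟨w', by omega⟩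
  · exact fun h => (chemDist_anti (restr_le _ _) x y).trans h

end Perco

namespace Perco
variable {d : ℕ}

/-! ### Measures -/
instance instProbP (F : BernoulliFamily d) (p : ℝ) : IsProbabilityMeasure (F.P p) := F.prob p

/-- all edges of `S` are closed -/
def closedAll (S : Finset (Edge d)) : Set (Config d) := {ω | ∀ e ∈ S, ω e = false}

theorem measurableSet_closedAll (S : Finset (Edge d)) : MeasurableSet (closedAll S) :=
  measurableSet_of_local S (fun ω => ∀ e ∈ S, ω e = false) (fun ω ω' h => by
    simp only [eq_iff_iff]
    exact forall₂_congr fun e he => by rw [h e (by simpa using he)])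

theorem closedAll_prob (F : BernoulliFamily d) {t : ℝ} (h0 : 0 ≤ t) (h1 : t ≤ 1) (S : Finset (Edge d)) :
    F.P t (closedAll S) = ENNReal.ofReal (1 - t) ^ S.card := by
  have := F.iid t h0 h1 S (fun _ => false)
  simpa [closedAll] using this

theorem P_unique (F : BernoulliFamily d) {t : ℝ} (h0 : 0 ≤ t) (h1 : t ≤ 1) (m : Measure (Config d))
    [IsProbabilityMeasure m] (h : ∀ S, m (closedAll S) = ENNReal.ofReal (1 - t) ^ S.card) :
    m = F.P t := by
  classical
  refine ext_of_generate_finite (Set.range closedAll) ?_ ?_ ?_ (by simp)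
  · apply le_antisymm
    · refine iSup_le fun e => ?_
      rw [← measurable_iff_comap_le]
      have h1 : @MeasurableSet _ (MeasurableSpace.generateFrom (Set.range closedAll)) {ω : Config d | ω e = false} := by
        refine MeasurableSpace.measurableSet_generateFrom ⟨{e}, ?_⟩
        simp [closedAll]
      refine @measurable_to_bool _ (MeasurableSpace.generateFrom (Set.range closedAll)) _ ?_
      have : (fun b : Config d => b e) ⁻¹' {true} = {ω : Config d | ω e = false}ᶜ := by
        ext ω; simp
      rw [this]
      exact MeasurableSet.compl h1
    · refine MeasurableSpace.generateFrom_le ?_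
      rintro _ ⟨S, rfl⟩
      exact measurableSet_closedAll S
  · rintro _ ⟨S, rfl⟩ _ ⟨T, rfl⟩ _
    refine ⟨S ∪ T, ?_⟩
    ext ω
    simp only [closedAll, Finset.mem_union, Set.mem_ofPred_eq, Set.mem_inter_iff]
    constructor
    · exact fun h => ⟨fun e he => h e (Or.inl he), fun e he => h e (Or.inr he)⟩
    · rintro ⟨h1, h2⟩ e (he | he)
      · exact h1 e he
      · exact h2 e he
  · rintro _ ⟨S, rfl⟩
    rw [h, closedAll_prob F h0 h1]

/-! #### independence -/
/-- Bernoulli law -/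
noncomputable def bern (t : ℝ) : Measure Bool :=
  ENNReal.ofReal t • Measure.dirac true + ENNReal.ofReal (1 - t) • Measure.dirac false

theorem bern_prob {t : ℝ} (h0 : 0 ≤ t) (h1 : t ≤ 1) : IsProbabilityMeasure (bern t) := by
  constructor
  simp [bern]
  rw [← ENNReal.ofReal_add h0 (by linarith)]; simp

theorem P_eq_infinitePi (F : BernoulliFamily d) {t : ℝ} (h0 : 0 ≤ t) (h1 : t ≤ 1) :
    F.P t = haveI := bern_prob h0 h1; Measure.infinitePi (fun _ : Edge d => bern t) := by
  have := bern_prob h0 h1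
  symm
  refine P_unique F h0 h1 _ fun S => ?_
  have : (closedAll S : Set (Config d)) = Set.pi S (fun _ => {false}) := by
    ext ω; simp [closedAll, Set.mem_pi]
  rw [this, Measure.infinitePi_pi]
  · simp [bern]
  · intros; trivial

theorem indep_local (F : BernoulliFamily d) {t : ℝ} (h0 : 0 ≤ t) (h1 : t ≤ 1) {S T : Finset (Edge d)}
    (hST : Disjoint S T) {A B : Config d → Prop} (hA : DependsOn A (S : Set (Edge d)))
    (hB : DependsOn B (T : Set (Edge d))) :
    (F.P t).real {ω | A ω ∧ B ω} = (F.P t).real {ω | A ω} * (F.P t).real {ω | B ω} := by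
  classical
  have := bern_prob h0 h1
  have hi : ProbabilityTheory.iIndepFun (fun (e : Edge d) (ω : Config d) => ω e) (F.P t) := by
    rw [P_eq_infinitePi F h0 h1]
    exact ProbabilityTheory.iIndepFun_infinitePi (X := fun _ b => b) (fun _ => measurable_id)
  have h2 := hi.indepFun_finset S T hST (fun e => measurable_pi_apply e)
  have key : ∀ (U : Finset (Edge d)) (A : Config d → Prop), DependsOn A (U : Set (Edge d)) →
      {ω | A ω} = (fun (a : Config d) (i : U) => a i) ⁻¹' {g : U → Bool | A (fun e => if h : e ∈ U then g ⟨e, h⟩ else false)} := by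
    intro U A hA
    ext ω
    simp only [Set.mem_ofPred_eq, Set.mem_preimage]
    rw [hA]
    intro e he
    have : e ∈ U := by simpa using he
    simp [this]
  have h3 := h2.measure_inter_preimage_eq_mul
    (s := {g : S → Bool | A (fun e => if h : e ∈ S then g ⟨e, h⟩ else false)})
    (t := {g : T → Bool | B (fun e => if h : e ∈ T then g ⟨e, h⟩ else false)})
    (Set.toFinite _).measurableSet (Set.toFinite _).measurableSet
  rw [← key S A hA, ← key T B hB] at h3
  have h4 : {ω : Config d | A ω ∧ B ω} = {ω | A ω} ∩ {ω | B ω} := rfl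
  rw [h4, measureReal_def, h3, ENNReal.toReal_mul]; rfl

/-! #### opening and closing edges -/
/-- open an edge -/
def opn (e : Edge d) (ω : Config d) : Config d := Function.update ω e true
/-- close an edge -/
def cls (e : Edge d) (ω : Config d) : Config d := Function.update ω e false

@[simp] theorem opn_same (e : Edge d) (ω : Config d) : opn e ω e = true := by simp [opn]
@[simp] theorem cls_same (e : Edge d) (ω : Config d) : cls e ω e = false := by simp [cls]
theorem opn_ne {e e' : Edge d} (h : e' ≠ e) (ω : Config d) : opn e ω e' = ω e' := by simp [opn, h]
theorem cls_ne {e e' : Edge d} (h : e' ≠ e) (ω : Config d) : cls e ω e' = ω e' := by simp [cls, h]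
theorem le_opn (e : Edge d) (ω : Config d) : ω ≤ opn e ω := by
  intro e'; by_cases h : e' = e
  · subst h; rw [opn_same]; exact le_top
  · rw [opn_ne h]
theorem cls_le (e : Edge d) (ω : Config d) : cls e ω ≤ ω := by
  intro e'; by_cases h : e' = e
  · subst h; rw [cls_same]; exact bot_le
  · rw [cls_ne h]
theorem opn_mono (e : Edge d) {ω ω' : Config d} (h : ω ≤ ω') : opn e ω ≤ opn e ω' := by
  intro e'; by_cases h' : e' = e
  · subst h'; simp
  · rw [opn_ne h', opn_ne h']; exact h _
theorem cls_mono (e : Edge d) {ω ω' : Config d} (h : ω ≤ ω') : cls e ω ≤ cls e ω' := by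
  intro e'; by_cases h' : e' = e
  · subst h'; simp
  · rw [cls_ne h', cls_ne h']; exact h _
theorem opn_of_true {e : Edge d} {ω : Config d} (h : ω e = true) : opn e ω = ω := by
  simp [opn, ← h]
theorem cls_of_false {e : Edge d} {ω : Config d} (h : ω e = false) : cls e ω = ω := by
  simp [cls, ← h]
@[simp] theorem cls_opn (e : Edge d) (ω : Config d) : cls e (opn e ω) = cls e ω := by simp [cls, opn]
@[simp] theorem opn_cls (e : Edge d) (ω : Config d) : opn e (cls e ω) = opn e ω := by simp [cls, opn]
@[simp] theorem opn_opn (e : Edge d) (ω : Config d) : opn e (opn e ω) = opn e ω := by simp [opn]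
@[simp] theorem cls_cls (e : Edge d) (ω : Config d) : cls e (cls e ω) = cls e ω := by simp [cls]
theorem measurable_opn (e : Edge d) : Measurable (opn e : Config d → Config d) := by
  classical
  refine measurable_pi_lambda _ fun e' => ?_
  by_cases h : e' = e
  · subst h; simp
  · simp only [opn_ne h]; exact measurable_pi_apply _
theorem measurable_cls (e : Edge d) : Measurable (cls e : Config d → Config d) := by
  classical
  refine measurable_pi_lambda _ fun e' => ?_
  by_cases h : e' = e
  · subst h; simp
  · simp only [cls_ne h]; exact measurable_pi_apply _

theorem opn_comm {e e' : Edge d} (h : e ≠ e') (ω : Config d) : opn e (opn e' ω) = opn e' (opn e ω) := by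
  simp only [opn]; rw [Function.update_comm h]
theorem opn_cls_comm {e e' : Edge d} (h : e ≠ e') (ω : Config d) : opn e (cls e' ω) = cls e' (opn e ω) := by
  simp only [opn, cls]; rw [Function.update_comm h]
theorem cls_comm {e e' : Edge d} (h : e ≠ e') (ω : Config d) : cls e (cls e' ω) = cls e' (cls e ω) := by
  simp only [cls]; rw [Function.update_comm h]

theorem mix_eq (F : BernoulliFamily d) {t : ℝ} (h0 : 0 ≤ t) (h1 : t ≤ 1) (e : Edge d) :
    F.P t = ENNReal.ofReal t • (F.P t).map (opn e) + ENNReal.ofReal (1 - t) • (F.P t).map (cls e) := by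
  classical
  symm
  have : IsProbabilityMeasure ((F.P t).map (opn e)) := Measure.isProbabilityMeasure_map (measurable_opn e).aemeasurable
  have : IsProbabilityMeasure ((F.P t).map (cls e)) := Measure.isProbabilityMeasure_map (measurable_cls e).aemeasurable
  have : IsProbabilityMeasure (ENNReal.ofReal t • (F.P t).map (opn e) + ENNReal.ofReal (1 - t) • (F.P t).map (cls e)) := by
    constructor
    simp only [Measure.add_apply, Measure.smul_apply, measure_univ, smul_eq_mul, mul_one]
    rw [← ENNReal.ofReal_add h0 (by linarith)]; simp
  refine P_unique F h0 h1 _ fun S => ?_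
  simp only [Measure.add_apply, Measure.smul_apply, smul_eq_mul]
  rw [Measure.map_apply (measurable_opn e) (measurableSet_closedAll S),
    Measure.map_apply (measurable_cls e) (measurableSet_closedAll S)]
  by_cases he : e ∈ S
  · have e1 : opn e ⁻¹' closedAll S = ∅ := by
      ext ω; simp only [Set.mem_preimage, closedAll, Set.mem_ofPred_eq, Set.mem_empty_iff_false, iff_false]
      intro h; have := h e he; simp at this
    have e2 : cls e ⁻¹' closedAll S = closedAll (S.erase e) := by
      ext ω; simp only [Set.mem_preimage, closedAll, Set.mem_ofPred_eq, Finset.mem_erase]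
      constructor
      · rintro h e' ⟨h1, h2⟩; rw [← h e' h2, cls_ne h1]
      · intro h e' h2
        by_cases h1 : e' = e
        · subst h1; simp
        · rw [cls_ne h1]; exact h e' ⟨h1, h2⟩
    rw [e1, e2, closedAll_prob F h0 h1, ← Finset.card_erase_add_one he, pow_succ]
    simp [mul_comm]
  · have e1 : opn e ⁻¹' closedAll S = closedAll S := by
      ext ω; simp only [Set.mem_preimage, closedAll, Set.mem_ofPred_eq]
      refine forall₂_congr fun e' h => ?_
      rw [opn_ne (show e' ≠ e by rintro rfl; exact he h)]
    have e2 : cls e ⁻¹' closedAll S = closedAll S := by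
      ext ω; simp only [Set.mem_preimage, closedAll, Set.mem_ofPred_eq]
      refine forall₂_congr fun e' h => ?_
      rw [cls_ne (show e' ≠ e by rintro rfl; exact he h)]
    rw [e1, e2, closedAll_prob F h0 h1, ← add_mul, ← ENNReal.ofReal_add h0 (by linarith)]
    simp

theorem mix_real (F : BernoulliFamily d) {t : ℝ} (h0 : 0 ≤ t) (h1 : t ≤ 1) (e : Edge d) {B : Set (Config d)}
    (hB : MeasurableSet B) :
    (F.P t).real B = t * (F.P t).real (opn e ⁻¹' B) + (1 - t) * (F.P t).real (cls e ⁻¹' B) := by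
  conv_lhs => rw [measureReal_def, mix_eq F h0 h1 e]
  simp only [Measure.add_apply, Measure.smul_apply, smul_eq_mul]
  rw [Measure.map_apply (measurable_opn e) hB, Measure.map_apply (measurable_cls e) hB]
  rw [ENNReal.toReal_add (by finiteness) (by finiteness)]
  simp [ENNReal.toReal_mul, h0, h1, measureReal_def]

theorem opn_real_le (F : BernoulliFamily d) {t : ℝ} (h0 : 0 < t) (h1 : t ≤ 1) (e : Edge d) {B : Set (Config d)}
    (hB : MeasurableSet B) : (F.P t).real (opn e ⁻¹' B) ≤ (F.P t).real B / t := by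
  rw [le_div_iff₀ h0, mix_real F h0.le h1 e hB]
  have : 0 ≤ (1 - t) * (F.P t).real (cls e ⁻¹' B) := mul_nonneg (by linarith) measureReal_nonneg
  linarith

theorem cls_real_le (F : BernoulliFamily d) {t : ℝ} (h0 : 0 ≤ t) (h1 : t < 1) (e : Edge d) {B : Set (Config d)}
    (hB : MeasurableSet B) : (F.P t).real (cls e ⁻¹' B) ≤ (F.P t).real B / (1 - t) := by
  rw [le_div_iff₀ (by linarith), mix_real F h0 h1.le e hB]
  have : 0 ≤ t * (F.P t).real (opn e ⁻¹' B) := mul_nonneg h0 measureReal_nonneg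
  linarith

/-! #### Local functions: expectations and Russo -/
theorem local_bounded (S : Finset (Edge d)) (f : Config d → ℝ) (hf : DependsOn f (S : Set (Edge d))) :
    ∃ C, ∀ ω, |f ω| ≤ C := by
  classical
  obtain ⟨C, hC⟩ := (Set.finite_range (fun g : S → Bool => |f (fun e => if h : e ∈ S then g ⟨e, h⟩ else false)|)).bddAbove
  refine ⟨C, fun ω => ?_⟩
  have := hC ⟨fun e : S => ω e, rfl⟩
  simp only at this
  rwa [hf (x := fun e => if h : e ∈ S then ω e else false) (y := ω)] at this
  intro e he
  have : e ∈ S := by simpa using he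
  simp [this]

theorem integrable_of_local (F : BernoulliFamily d) (t : ℝ) (S : Finset (Edge d)) (f : Config d → ℝ)
    (hf : DependsOn f (S : Set (Edge d))) : Integrable f (F.P t) := by
  obtain ⟨C, hC⟩ := local_bounded S f hf
  exact Integrable.of_bound (measurable_of_local S f hf).aestronglyMeasurable C
    (Eventually.of_forall fun ω => by simpa using hC ω)

theorem mix_integral (F : BernoulliFamily d) {t : ℝ} (h0 : 0 ≤ t) (h1 : t ≤ 1) (e : Edge d) {f : Config d → ℝ}
    (hf : Measurable f) (C : ℝ) (hC : ∀ ω, |f ω| ≤ C) :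
    ∫ ω, f ω ∂(F.P t) = t * ∫ ω, f (opn e ω) ∂(F.P t) + (1 - t) * ∫ ω, f (cls e ω) ∂(F.P t) := by
  conv_lhs => rw [mix_eq F h0 h1 e]
  have i1 : Integrable f ((F.P t).map (opn e)) := Integrable.of_bound hf.aestronglyMeasurable C
    (Eventually.of_forall fun ω => by simpa using hC ω)
  have i2 : Integrable f ((F.P t).map (cls e)) := Integrable.of_bound hf.aestronglyMeasurable C
    (Eventually.of_forall fun ω => by simpa using hC ω)
  rw [integral_add_measure (i1.smul_measure (by simp)) (i2.smul_measure (by simp)), integral_smul_measure, integral_smul_measure,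
    integral_map (measurable_opn e).aemeasurable hf.aestronglyMeasurable,
    integral_map (measurable_cls e).aemeasurable hf.aestronglyMeasurable]
  simp [h0, h1]

theorem dependsOn_opn {α : Type*} {e : Edge d} {S : Finset (Edge d)} {f : Config d → α}
    (hf : DependsOn f ((insert e S : Finset (Edge d)) : Set (Edge d))) : DependsOn (fun ω => f (opn e ω)) (S : Set (Edge d)) := by
  intro ω ω' h
  refine hf fun e' he' => ?_
  by_cases h1 : e' = e
  · subst h1; simp
  · rw [opn_ne h1, opn_ne h1]
    exact h e' (by simpa [h1] using he')

theorem dependsOn_cls {α : Type*} {e : Edge d} {S : Finset (Edge d)} {f : Config d → α}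
    (hf : DependsOn f ((insert e S : Finset (Edge d)) : Set (Edge d))) : DependsOn (fun ω => f (cls e ω)) (S : Set (Edge d)) := by
  intro ω ω' h
  refine hf fun e' he' => ?_
  by_cases h1 : e' = e
  · subst h1; simp
  · rw [cls_ne h1, cls_ne h1]
    exact h e' (by simpa [h1] using he')

theorem DependsOn.mono' {α : Type*} {S T : Finset (Edge d)} (h : S ⊆ T) {f : Config d → α}
    (hf : DependsOn f (S : Set (Edge d))) : DependsOn f (T : Set (Edge d)) :=
  fun _ _ h' => hf fun e he => h' e (by exact_mod_cast h he)

theorem russo (F : BernoulliFamily d) (S : Finset (Edge d)) : ∀ (f : Config d → ℝ), DependsOn f (S : Set (Edge d)) →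
    ∀ t ∈ Set.Icc (0:ℝ) 1, HasDerivWithinAt (fun t => ∫ ω, f ω ∂(F.P t))
      (∑ e ∈ S, ∫ ω, (f (opn e ω) - f (cls e ω)) ∂(F.P t)) (Set.Icc 0 1) t := by
  classical
  induction S using Finset.induction_on with
  | empty =>
    intro f hf t ht
    have : ∀ ω, f ω = f (fun _ => false) := fun ω => hf (by simp)
    have h2 : (fun t => ∫ ω, f ω ∂(F.P t)) = fun _ => f (fun _ => false) := by
      funext t; simp_rw [this]; simp
    rw [h2]
    simpa using hasDerivWithinAt_const t _ _
  | insert e S he ih =>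
    intro f hf t ht
    have h1 := ih _ (dependsOn_opn hf) t ht
    have h2 := ih _ (dependsOn_cls hf) t ht
    obtain ⟨C, hC⟩ := local_bounded _ f hf
    have hm := measurable_of_local _ f hf
    have h3 := ((hasDerivWithinAt_id t (Set.Icc 0 1)).mul h1).add (((hasDerivWithinAt_id t (Set.Icc 0 1)).const_sub 1).mul h2)
    have h5 := h3.congr (f₁ := fun t => ∫ ω, f ω ∂(F.P t)) (fun s hs => mix_integral F hs.1 hs.2 e hm C hC)
      (mix_integral F ht.1 ht.2 e hm C hC)
    refine h5.congr_deriv ?_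
    rw [Finset.sum_insert he]
    have i1 : Integrable (fun ω => f (opn e ω)) (F.P t) := integrable_of_local F t S _ (dependsOn_opn hf)
    have i2 : Integrable (fun ω => f (cls e ω)) (F.P t) := integrable_of_local F t S _ (dependsOn_cls hf)
    rw [integral_sub i1 i2]
    have h4 : ∀ e' ∈ S, ∫ ω, (f (opn e' ω) - f (cls e' ω)) ∂(F.P t) =
        t * ∫ ω, (f (opn e (opn e' ω)) - f (opn e (cls e' ω))) ∂(F.P t)
        + (1 - t) * ∫ ω, (f (cls e (opn e' ω)) - f (cls e (cls e' ω))) ∂(F.P t) := by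
      intro e' he'
      have hne : e' ≠ e := fun h => he (h ▸ he')
      rw [mix_integral F ht.1 ht.2 e (f := fun ω => f (opn e' ω) - f (cls e' ω))
        ((hm.comp (measurable_opn e')).sub (hm.comp (measurable_cls e'))) (C + C)]
      · congr 2
        · refine integral_congr_ae (Eventually.of_forall fun ω => ?_)
          simp only [opn_comm hne, ← opn_cls_comm hne.symm]
        · refine integral_congr_ae (Eventually.of_forall fun ω => ?_)
          simp only [opn_cls_comm hne, cls_comm hne]
      · intro ω
        have := abs_sub (f (opn e' ω)) (f (cls e' ω))
        exact this.trans (add_le_add (hC _) (hC _))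
    rw [Finset.sum_congr rfl h4, Finset.sum_add_distrib, ← Finset.mul_sum, ← Finset.mul_sum]
    simp only [id, one_mul]
    ring

theorem continuousOn_integral (F : BernoulliFamily d) (S : Finset (Edge d)) (f : Config d → ℝ)
    (hf : DependsOn f (S : Set (Edge d))) : ContinuousOn (fun t => ∫ ω, f ω ∂(F.P t)) (Set.Icc 0 1) :=
  fun t ht => (russo F S f hf t ht).continuousWithinAt

/-! #### monotone coupling -/
theorem measurable_sup_config : Measurable (fun x : Config d × Config d => x.1 ⊔ x.2) := by
  refine measurable_pi_lambda _ fun e => ?_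
  have h1 : Measurable (fun x : Config d × Config d => x.1 e) := (measurable_pi_apply e).comp measurable_fst
  have h2 : Measurable (fun x : Config d × Config d => x.2 e) := (measurable_pi_apply e).comp measurable_snd
  have h3 : Measurable (fun b : Bool × Bool => b.1 ⊔ b.2) := measurable_of_countable _
  exact h3.comp (h1.prodMk h2)

theorem sup_law (F : BernoulliFamily d) {p s t : ℝ} (hp0 : 0 ≤ p) (hp1 : p ≤ 1) (hs0 : 0 ≤ s) (hs1 : s ≤ 1)
    (h : 1 - t = (1 - p) * (1 - s)) :
    ((F.P p).prod (F.P s)).map (fun x : Config d × Config d => x.1 ⊔ x.2) = F.P t := by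
  have : IsProbabilityMeasure (((F.P p).prod (F.P s)).map (fun x : Config d × Config d => x.1 ⊔ x.2)) :=
    Measure.isProbabilityMeasure_map measurable_sup_config.aemeasurable
  have ht0 : 0 ≤ t := by nlinarith
  have ht1 : t ≤ 1 := by nlinarith
  refine P_unique F ht0 ht1 _ fun S => ?_
  rw [Measure.map_apply measurable_sup_config (measurableSet_closedAll S)]
  have : (fun x : Config d × Config d => x.1 ⊔ x.2) ⁻¹' closedAll S = closedAll S ×ˢ closedAll S := by
    ext ⟨a, b⟩
    simp only [Set.mem_preimage, closedAll, Set.mem_ofPred_eq, Set.mem_prod, Pi.sup_apply]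
    rw [← forall₂_and]
    refine forall₂_congr fun e he => ?_
    cases a e <;> cases b e <;> simp
  rw [this, Measure.prod_prod, closedAll_prob F hp0 hp1, closedAll_prob F hs0 hs1, h, ENNReal.ofReal_mul (by linarith), mul_pow]

theorem exists_s {p t : ℝ} (hpt : p ≤ t) (ht1 : t ≤ 1) (hp1 : p < 1) :
    0 ≤ (t - p) / (1 - p) ∧ (t - p) / (1 - p) ≤ 1 ∧ 1 - t = (1 - p) * (1 - (t - p) / (1 - p)) := by
  have : 0 < 1 - p := by linarith
  refine ⟨div_nonneg (by linarith) this.le, (div_le_one this).2 (by linarith), ?_⟩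
  field_simp
  ring

/-- monotonicity in `p` of increasing events -/
theorem prob_mono (F : BernoulliFamily d) {p t : ℝ} (hp0 : 0 ≤ p) (hpt : p ≤ t) (ht1 : t ≤ 1) {B : Set (Config d)}
    (hB : MeasurableSet B) (hmono : ∀ ω ω', ω ≤ ω' → ω ∈ B → ω' ∈ B) : (F.P p) B ≤ (F.P t) B := by
  rcases eq_or_lt_of_le (hpt.trans ht1) with hp | hp1
  · have : p = t := by linarith
    rw [this]
  obtain ⟨h1, h2, h3⟩ := exists_s hpt ht1 hp1
  rw [← sup_law F hp0 hp1.le h1 h2 h3, Measure.map_apply measurable_sup_config hB]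
  calc (F.P p) B = ((F.P p).prod (F.P ((t-p)/(1-p)))) (B ×ˢ Set.univ) := by
        rw [Measure.prod_prod]; simp
    _ ≤ _ := measure_mono (by
        rintro ⟨a, b⟩ ⟨ha, _⟩
        exact hmono a _ le_sup_left ha)

/-! #### translations -/
theorem sym2dist1_map_add (v : V d) (e : Sym2 (V d)) : sym2dist1 (e.map (· + v)) = sym2dist1 e := by
  induction e using Sym2.ind with
  | _ x y => exact dist1_add_right x y v

/-- translation of an edge -/
def shE (v : V d) (e : Edge d) : Edge d := ⟨(ends e).map (· + v), (sym2dist1_map_add v _).trans e.2⟩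

/-- translation of a configuration: edge `e` of `sh v ω` is the edge `e + v` of `ω` -/
def sh (v : V d) (ω : Config d) : Config d := fun e => ω (shE v e)

theorem shE_mkE (v x y : V d) (h : dist1 x y = 1) : shE v (mkE x y h) = mkE (x+v) (y+v) (by rw [dist1_add_right]; exact h) := rfl

theorem shE_injective (v : V d) : Function.Injective (shE v : Edge d → Edge d) := by
  intro e e' h
  have h1 : (ends e).map (· + v) = (ends e').map (· + v) := congrArg ends h
  exact ends_injective (Sym2.map.injective (add_left_injective v) h1)

theorem sh_adj {v : V d} {ω : Config d} {x y : V d} : (gr (sh v ω)).Adj x y ↔ (gr ω).Adj (x + v) (y + v) := by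
  simp only [adj_iff, sh, shE_mkE, dist1_add_right]

theorem measurable_sh (v : V d) : Measurable (sh v : Config d → Config d) :=
  measurable_pi_lambda _ fun _ => measurable_pi_apply _

theorem sh_law (F : BernoulliFamily d) {t : ℝ} (h0 : 0 ≤ t) (h1 : t ≤ 1) (v : V d) : (F.P t).map (sh v) = F.P t := by
  have : IsProbabilityMeasure ((F.P t).map (sh v)) := Measure.isProbabilityMeasure_map (measurable_sh v).aemeasurable
  refine P_unique F h0 h1 _ fun S => ?_
  rw [Measure.map_apply (measurable_sh v) (measurableSet_closedAll S)]
  have : sh v ⁻¹' closedAll S = closedAll (S.map ⟨shE v, shE_injective v⟩) := by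
    ext ω; simp [closedAll, sh]
  rw [this, closedAll_prob F h0 h1, Finset.card_map]

theorem sh_prob (F : BernoulliFamily d) {t : ℝ} (h0 : 0 ≤ t) (h1 : t ≤ 1) (v : V d) {B : Set (Config d)}
    (hB : MeasurableSet B) : F.P t {ω | sh v ω ∈ B} = F.P t B := by
  conv_rhs => rw [← sh_law F h0 h1 v, Measure.map_apply (measurable_sh v) hB]
  rfl

/-- graph isomorphism induced by a translation -/
def shIso (v : V d) (ω : Config d) : gr (sh v ω) ≃g gr ω where
  toEquiv := Equiv.addRight v
  map_rel_iff' := by intro x y; simp [sh_adj]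

theorem sh_reach {v : V d} {ω : Config d} {x y : V d} : Reach (sh v ω) x y ↔ Reach ω (x + v) (y + v) :=
  (shIso v ω).reachable_iff.symm

theorem sh_walk {v : V d} {ω : Config d} {x y : V d} (n : ℕ) :
    (∃ w : (gr (sh v ω)).Walk x y, w.length ≤ n) ↔ ∃ w : (gr ω).Walk (x + v) (y + v), w.length ≤ n := by
  constructor
  · rintro ⟨w, hw⟩
    have e1 : (shIso v ω).toHom x = x + v := rfl
    have e2 : (shIso v ω).toHom y = y + v := rfl
    exact ⟨(w.map (shIso v ω).toHom).copy e1 e2, by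
      rw [SimpleGraph.Walk.length_copy, SimpleGraph.Walk.length_map]; exact hw⟩
  · rintro ⟨w, hw⟩
    have e1 : (shIso v ω).symm (x + v) = x := (shIso v ω).symm_apply_apply x
    have e2 : (shIso v ω).symm (y + v) = y := (shIso v ω).symm_apply_apply y
    exact ⟨(w.map (shIso v ω).symm.toHom).copy e1 e2, by rw [SimpleGraph.Walk.length_copy, SimpleGraph.Walk.length_map]; exact hw⟩

theorem sh_far {v : V d} {ω : Config d} {x : V d} {K : ℕ} : Far (sh v ω) x K ↔ Far ω (x + v) K := by
  constructor
  · rintro ⟨y, h1, h2⟩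
    exact ⟨y + v, sh_reach.1 h1, by rwa [mem_box_add]⟩
  · rintro ⟨y, h1, h2⟩
    refine ⟨y - v, sh_reach.2 (by simpa using h1), ?_⟩
    rw [← mem_box_add (z := v)]; simpa using h2

theorem sh_inf {v : V d} {ω : Config d} {x : V d} : Inf (sh v ω) x ↔ Inf ω (x + v) := by
  rw [Inf, Inf, inf_iff, inf_iff]; exact forall_congr' fun K => sh_far

theorem sh_restr {v : V d} {ω : Config d} {x : V d} {r : ℕ} :
    restr (box x r) (sh v ω) = sh v (restr (box (x + v) r) ω) := by
  funext e
  rw [Bool.eq_iff_iff]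
  have : sh v (restr (box (x + v) r : Set (V d)) ω) e = restr (box (x + v) r) ω (shE v e) := rfl
  rw [this, restr_eq_true, restr_eq_true]
  obtain ⟨a, b, h, rfl⟩ := e.exists_rep
  simp only [shE_mkE, ends_mkE, Sym2.mem_iff, forall_eq_or_imp, forall_eq, sh, Finset.mem_coe, mem_box_add]

theorem sh_chemDist {v : V d} {ω : Config d} {x y : V d} : chemDist (sh v ω) x y = chemDist ω (x + v) (y + v) := by
  refine le_antisymm ?_ ?_
  · refine le_sInf ?_
    rintro a ⟨n, f, h1, h2, h3, rfl⟩
    obtain ⟨w, hw⟩ := path_to_walk n f h1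
    refine chemDist_le_iff.2 ((sh_walk n).2 ⟨w.copy h2 h3, by simp [hw]⟩)
  · refine le_sInf ?_
    rintro a ⟨n, f, h1, h2, h3, rfl⟩
    obtain ⟨w, hw⟩ := path_to_walk n f h1
    refine chemDist_le_iff.2 ((sh_walk n).1 ⟨w.copy h2 h3, by simp [hw]⟩)

end Perco

namespace Perco
variable {d : ℕ}

/-! ### Lattice connectivity -/
theorem dist1_single (x : V d) (k : Fin d) : dist1 x (x + Pi.single k 1) = 1 := by
  classical
  unfold dist1
  rw [Finset.sum_eq_single k]
  · simp
  · intro i _ hi; simp [hi]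
  · simp

theorem dist1_update (x y : V d) (k : Fin d) (a : ℤ) :
    dist1 (Function.update x k a) y + (x k - y k).natAbs = dist1 x y + (a - y k).natAbs := by
  classical
  unfold dist1
  rw [← Finset.add_sum_erase _ _ (Finset.mem_univ k), ← Finset.add_sum_erase Finset.univ (fun i => (x i - y i).natAbs) (Finset.mem_univ k)]
  rw [Finset.sum_congr rfl (g := fun i => (x i - y i).natAbs) (fun i hi => by
    rw [Function.update_of_ne (Finset.ne_of_mem_erase hi)])]
  simp only [Function.update_self]
  omega

theorem exists_step {x y : V d} (h : x ≠ y) : ∃ x', dist1 x x' = 1 ∧ dist1 x' y + 1 = dist1 x y ∧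
    ∀ k, (min (x k) (y k) ≤ x' k ∧ x' k ≤ max (x k) (y k)) := by
  classical
  obtain ⟨k, hk⟩ := Function.ne_iff.1 h
  rcases lt_or_gt_of_ne hk with hlt | hlt
  · refine ⟨Function.update x k (x k + 1), ?_, ?_, ?_⟩
    · have := dist1_update x x k (x k + 1); rw [dist1_comm]; simp [dist1_self] at this; exact this
    · have := dist1_update x y k (x k + 1); omega
    · intro i
      by_cases hi : i = k
      · subst hi; simp only [Function.update_self]; constructor
        · exact (min_le_left _ _).trans (by omega)
        · exact le_trans (by omega) (le_max_right _ _)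
      · rw [Function.update_of_ne hi]; exact ⟨min_le_left _ _, le_max_left _ _⟩
  · refine ⟨Function.update x k (x k - 1), ?_, ?_, ?_⟩
    · have := dist1_update x x k (x k - 1); rw [dist1_comm]; simp [dist1_self] at this; exact this
    · have := dist1_update x y k (x k - 1); omega
    · intro i
      by_cases hi : i = k
      · subst hi; simp only [Function.update_self]; constructor
        · exact (min_le_right _ _).trans (by omega)
        · exact le_trans (by omega) (le_max_left _ _)
      · rw [Function.update_of_ne hi]; exact ⟨min_le_left _ _, le_max_left _ _⟩

theorem box_convex {c x y z : V d} {r : ℕ} (hx : x ∈ box c r) (hy : y ∈ box c r)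
    (hz : ∀ k, (min (x k) (y k) ≤ z k ∧ z k ≤ max (x k) (y k))) : z ∈ box c r := by
  rw [mem_box] at *
  intro k
  have h1 := abs_le.1 (hx k); have h2 := abs_le.1 (hy k); have h3 := hz k
  rw [abs_le]
  rcases min_le_iff.1 h3.1 with h | h <;> rcases le_max_iff.1 h3.2 with h' | h' <;> constructor <;> omega

/-- in a fully open box, monotone walks -/
theorem box_walk {ω : Config d} {c : V d} {r : ℕ} (hω : ∀ e ∈ edgesIn (box c r), ω e = true) (n : ℕ) :
    ∀ x y : V d, dist1 x y = n → x ∈ box c r → y ∈ box c r →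
    ∃ w : (gr (restr (box c r) ω)).Walk x y, w.length = n := by
  induction n with
  | zero => intro x y h _ _; obtain rfl := dist1_eq_zero h; exact ⟨SimpleGraph.Walk.nil, rfl⟩
  | succ n ih =>
    intro x y h hx hy
    have hne : x ≠ y := by rintro rfl; rw [dist1_self] at h; omega
    obtain ⟨x', h1, h2, h3⟩ := exists_step hne
    have hx' := box_convex hx hy h3
    obtain ⟨w, hw⟩ := ih x' y (by omega) hx' hy
    have hadj : (gr (restr (box c r) ω)).Adj x x' := restr_adj.2 ⟨adj_iff.2 ⟨h1, hω _ (mkE_mem_edgesIn.2 ⟨hx, hx'⟩)⟩, by simpa using hx, by simpa using hx'⟩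
    exact ⟨SimpleGraph.Walk.cons hadj w, by simp [hw]⟩

theorem reach_top (x y : V d) : Reach (⊤ : Config d) x y := by
  obtain ⟨w, _⟩ := box_walk (ω := ⊤) (c := x) (r := dist1 x y) (fun _ _ => rfl) _ x y rfl (self_mem_box _ _) (mem_box_of_dist1 le_rfl)
  exact Reach.mono (restr_le _ _) ⟨w⟩

theorem dist1_one_iff {x y : V d} (h : dist1 x y = 1) : ∃ k : Fin d, y = x + Pi.single k 1 ∨ x = y + Pi.single k 1 := by
  classical
  have hne : x ≠ y := by rintro rfl; rw [dist1_self] at h; omega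
  obtain ⟨k, hk⟩ := Function.ne_iff.1 hne
  have h2 : ∀ i, i ≠ k → x i = y i := by
    intro i hi
    have := dist1_update x y k (y k)
    have h3 : dist1 (Function.update x k (y k)) y = 0 := by
      have : (x k - y k).natAbs ≠ 0 := by omega
      omega
    have := congrFun (dist1_eq_zero h3) i
    rwa [Function.update_of_ne hi] at this
  have h4 := coord_le_dist1 x y k
  rw [h, Int.abs_eq_natAbs] at h4
  refine ⟨k, ?_⟩
  rcases lt_or_gt_of_ne hk with hlt | hlt
  · left; funext i
    by_cases hi : i = k
    · subst hi; simp; omega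
    · simp [hi, h2 i hi]
  · right; funext i
    by_cases hi : i = k
    · subst hi; simp; omega
    · simp [hi, h2 i hi]

/-! ### Opening one edge -/
theorem reach_opn {ω : Config d} {u v : V d} {h : dist1 u v = 1} {a b : V d} (hr : Reach (opn (mkE u v h) ω) a b) :
    Reach ω a b ∨ (Reach ω a u ∧ Reach ω v b) ∨ (Reach ω a v ∧ Reach ω u b) := by
  obtain ⟨w⟩ := hr
  induction w with
  | nil => left; exact SimpleGraph.Reachable.refl _
  | cons hadj p ih =>
    rename_i a b c
    obtain ⟨h1, h2⟩ := adj_iff.1 hadj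
    by_cases he : mkE a b h1 = mkE u v h
    · have := congrArg ends he
      rw [ends_mkE, ends_mkE, Sym2.eq_iff] at this
      rcases this with ⟨rfl, rfl⟩ | ⟨rfl, rfl⟩
      · rcases ih with ih | ⟨ih1, ih2⟩ | ⟨ih1, ih2⟩
        · right; left; exact ⟨SimpleGraph.Reachable.refl _, ih⟩
        · right; left; exact ⟨SimpleGraph.Reachable.refl _, ih2⟩
        · left; exact ih2
      · rcases ih with ih | ⟨ih1, ih2⟩ | ⟨ih1, ih2⟩
        · right; right; exact ⟨SimpleGraph.Reachable.refl _, ih⟩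
        · left; exact ih2
        · right; right; exact ⟨SimpleGraph.Reachable.refl _, ih2⟩
    · rw [opn_ne he] at h2
      have hab : Reach ω a b := SimpleGraph.Adj.reachable (adj_iff.2 ⟨h1, h2⟩)
      rcases ih with ih | ⟨ih1, ih2⟩ | ⟨ih1, ih2⟩
      · left; exact hab.trans ih
      · right; left; exact ⟨hab.trans ih1, ih2⟩
      · right; right; exact ⟨hab.trans ih1, ih2⟩

/-! ### Counting boundary clusters -/
/-- inner boundary of the box of radius `n+1` -/
noncomputable def bd (n : ℕ) : Finset (V d) := box 0 (n+1) \ box 0 n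

open Classical in
/-- number of clusters of the box touching the boundary -/
noncomputable def psi (n : ℕ) (ω : Config d) : ℝ :=
  (((bd n).image (fun x => (gr (restr (box (0 : V d) (n+1)) ω)).connectedComponentMk x)).card : ℝ)

theorem psi_nonneg (n : ℕ) (ω : Config d) : 0 ≤ psi n ω := by unfold psi; positivity

theorem psi_le (n : ℕ) (ω : Config d) : psi n ω ≤ ((bd n : Finset (V d)).card : ℝ) := by
  classical
  unfold psi; exact_mod_cast Finset.card_image_le

theorem dependsOn_psi (n : ℕ) : DependsOn (psi n : Config d → ℝ) (edgesIn (box (0 : V d) (n+1)) : Set (Edge d)) := by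
  classical
  exact dependsOn_restr (fun ω : Config d => (((bd n).image (fun x => (gr ω).connectedComponentMk x)).card : ℝ))

theorem psi_anti_strict {n : ℕ} {ω ω' : Config d} (h : ω ≤ ω') :
    psi n ω' ≤ psi n ω ∧ ∀ a ∈ bd n, ∀ b ∈ bd n, ¬ Reach (restr (box (0 : V d) (n+1)) ω) a b →
      Reach (restr (box (0 : V d) (n+1)) ω') a b → psi n ω' + 1 ≤ psi n ω := by
  classical
  set G := gr (restr (box (0 : V d) (n+1)) ω)
  set G' := gr (restr (box (0 : V d) (n+1)) ω')
  have hG : G ≤ G' := gr_mono (restr_mono h)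
  let φ : G.ConnectedComponent → G'.ConnectedComponent := SimpleGraph.ConnectedComponent.map (SimpleGraph.Hom.ofLE hG)
  have him : (bd n).image (fun x => G'.connectedComponentMk x) = ((bd n).image (fun x => G.connectedComponentMk x)).image φ := by
    rw [Finset.image_image]; rfl
  unfold psi
  constructor
  · rw [him]; exact_mod_cast Finset.card_image_le
  · intro a ha b hb h1 h2
    rw [him]
    have hlt : (((bd n).image (fun x => G.connectedComponentMk x)).image φ).card < ((bd n).image (fun x => G.connectedComponentMk x)).card := by
      refine lt_of_le_of_ne Finset.card_image_le fun heq => ?_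
      have hinj := Finset.card_image_iff.1 heq
      have := hinj (x₁ := G.connectedComponentMk a) (x₂ := G.connectedComponentMk b)
        (by exact_mod_cast Finset.mem_image_of_mem _ ha) (by exact_mod_cast Finset.mem_image_of_mem _ hb) (SimpleGraph.ConnectedComponent.sound h2)
      exact h1 (SimpleGraph.ConnectedComponent.exact this)
    exact_mod_cast hlt

/-- the trifurcation-free local event: ends of the edge far and not connected -/
def Tev (x y : V d) (m : ℕ) (η : Config d) : Prop :=
  Far η x m ∧ Far η y m ∧ ¬ Reach (restr (box x m) η) x y

theorem touch_bd {η : Config d} {x : V d} {n m : ℕ} (hx : x ∈ box (0 : V d) n) (hm : 2*n+2 ≤ m) (hf : Far η x m) :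
    ∃ a ∈ bd n, Reach (restr (box (0 : V d) (n+1)) η) x a := by
  obtain ⟨y, h1, h2⟩ := hf
  have hx1 : x ∈ box (0 : V d) (n+1) := box_mono (Nat.le_succ _) hx
  have hy : y ∉ (box (0 : V d) (n+1)) := fun hy => h2 (box_subset (mem_box_comm.1 hx) (by omega) hy)
  obtain ⟨z, hz, z', hz', h3, h4⟩ := exit_lemma (S := (box (0 : V d) (n+1) : Set (V d))) h1 (by simpa using hx1) (by simpa using hy)
  refine ⟨z, ?_, h3⟩
  simp only [bd, Finset.mem_sdiff]
  refine ⟨by simpa using hz, fun hzn => hz' ?_⟩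
  simpa using mem_box_trans hzn (mem_box_of_dist1 (dist1_of_adj h4).le)

theorem psi_drop {ω : Config d} {x y : V d} (h : dist1 x y = 1) {n m : ℕ} (hx : x ∈ box (0 : V d) n)
    (hm : 2*n+4 ≤ m) (hT : Tev x y m (cls (mkE x y h) ω)) :
    psi n (opn (mkE x y h) ω) + 1 ≤ psi n (cls (mkE x y h) ω) := by
  obtain ⟨h1, h2, h3⟩ := hT
  obtain ⟨a, ha, hxa⟩ := touch_bd hx (by omega) h1
  have hy : y ∈ box (0 : V d) (n+1) := mem_box_trans hx (mem_box_of_dist1 h.le)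
  have hx1 : x ∈ box (0 : V d) (n+1) := box_mono (Nat.le_succ _) hx
  -- y touches the boundary
  have hyb : ∃ b ∈ bd n, Reach (restr (box (0 : V d) (n+1)) (cls (mkE x y h) ω)) y b := by
    by_cases hyn : y ∈ box (0 : V d) n
    · exact touch_bd hyn (by omega) h2
    · exact ⟨y, by simp [bd, hy, hyn], SimpleGraph.Reachable.refl _⟩
  obtain ⟨b, hb, hyb⟩ := hyb
  have hle : cls (mkE x y h) ω ≤ opn (mkE x y h) ω := (cls_le _ _).trans (le_opn _ _)
  refine (psi_anti_strict hle).2 a ha b hb ?_ ?_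
  · intro hab
    apply h3
    refine Reach.mono (restr_mono_set ?_ _) ((hxa.trans hab).trans hyb.symm)
    exact_mod_cast box_subset (mem_box_comm.1 hx) (show n + (n+1) ≤ m by omega)
  · have hadj : (gr (restr (box (0 : V d) (n+1)) (opn (mkE x y h) ω))).Adj x y :=
      restr_adj.2 ⟨adj_iff.2 ⟨h, by simp⟩, by simpa using hx1, by simpa using hy⟩
    exact ((hxa.mono (restr_mono hle)).symm.trans (SimpleGraph.Adj.reachable hadj)).trans (hyb.mono (restr_mono hle))

theorem dependsOn_Tev (x y : V d) (m : ℕ) : ∃ S : Finset (Edge d), DependsOn (Tev x y m) (S : Set (Edge d)) := by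
  classical
  refine ⟨edgesIn (box x (m+1)) ∪ edgesIn (box y (m+1)) ∪ edgesIn (box x m), ?_⟩
  intro ω ω' h
  have h1 : Far ω x m = Far ω' x m := dependsOn_far x m (fun e he => h e (by
    rw [Finset.coe_union, Finset.coe_union]; exact Or.inl (Or.inl he)))
  have h2 : Far ω y m = Far ω' y m := dependsOn_far y m (fun e he => h e (by
    rw [Finset.coe_union, Finset.coe_union]; exact Or.inl (Or.inr he)))
  have h3 : Reach (restr (box x m) ω) x y = Reach (restr (box x m) ω') x y :=
    (dependsOn_restr (S := box x m) (fun ω => Reach ω x y)) (fun e he => h e (by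
    rw [Finset.coe_union, Finset.coe_union]; exact Or.inr he))
  unfold Tev
  rw [h1, h2, h3]

theorem dependsOn_comp_cls {α : Type*} {e : Edge d} {S : Finset (Edge d)} {f : Config d → α} (hf : DependsOn f (S : Set (Edge d))) :
    DependsOn (fun ω => f (cls e ω)) (S : Set (Edge d)) := by
  classical
  exact dependsOn_cls (DependsOn.mono' (Finset.subset_insert e S) hf)

theorem dependsOn_comp_opn {α : Type*} {e : Edge d} {S : Finset (Edge d)} {f : Config d → α} (hf : DependsOn f (S : Set (Edge d))) :
    DependsOn (fun ω => f (opn e ω)) (S : Set (Edge d)) := by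
  classical
  exact dependsOn_opn (DependsOn.mono' (Finset.subset_insert e S) hf)

/-- the standard edge event -/
def Tset (m : ℕ) (x : V d) (k : Fin d) : Set (Config d) :=
  {ω | Tev x (x + Pi.single k 1) m (cls (mkE x (x + Pi.single k 1) (dist1_single x k)) ω)}

theorem Tset_local (m : ℕ) (x : V d) (k : Fin d) : ∃ S : Finset (Edge d), DependsOn (fun ω => ω ∈ Tset m x k) (S : Set (Edge d)) := by
  obtain ⟨S, hS⟩ := dependsOn_Tev x (x + Pi.single k 1) m
  exact ⟨S, dependsOn_comp_cls hS⟩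

theorem Tset_meas (m : ℕ) (x : V d) (k : Fin d) : MeasurableSet (Tset m x k) := by
  obtain ⟨S, hS⟩ := Tset_local m x k
  exact measurableSet_of_local S _ hS

theorem sh_cls (v : V d) (e : Edge d) (ω : Config d) : cls e (sh v ω) = sh v (cls (shE v e) ω) := by
  funext e'
  by_cases h : e' = e
  · subst h; simp [sh]
  · rw [cls_ne h]; simp only [sh]; rw [cls_ne]; exact fun h' => h (shE_injective v h')

theorem Tset_shift (F : BernoulliFamily d) {t : ℝ} (h0 : 0 ≤ t) (h1 : t ≤ 1) (m : ℕ) (x : V d) (k : Fin d) :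
    F.P t (Tset m x k) = F.P t (Tset m 0 k) := by
  rw [← sh_prob F h0 h1 x (Tset_meas m 0 k)]
  congr 1
  ext ω
  simp only [Tset, Set.mem_ofPred_eq, Tev, sh_cls, sh_far, sh_restr, sh_reach, shE_mkE, zero_add, add_comm (Pi.single k 1) x]

theorem continuousOn_prob (F : BernoulliFamily d) (B : Set (Config d)) (hB : ∃ S : Finset (Edge d), DependsOn (fun ω => ω ∈ B) (S : Set (Edge d))) :
    ContinuousOn (fun t => (F.P t).real B) (Set.Icc 0 1) := by
  classical
  obtain ⟨S, hS⟩ := hB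
  have hm : MeasurableSet B := measurableSet_of_local S _ hS
  have := continuousOn_integral F S (fun ω => if ω ∈ B then (1:ℝ) else 0) (fun ω ω' h => by
    have := hS h
    simp only [eq_iff_iff] at this
    simp only [this])
  refine this.congr fun t _ => ?_
  have h2 : (fun ω => if ω ∈ B then (1:ℝ) else 0) = B.indicator 1 := by
    funext ω; simp [Set.indicator]
  simp only [h2]
  rw [integral_indicator_one hm]

theorem russo_psi (F : BernoulliFamily d) {a b : ℝ} (ha : 0 ≤ a) (hab : a ≤ b) (hb : b ≤ 1) (n m : ℕ) (hm : 2*n+4 ≤ m) (k : Fin d) :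
    ((box (0 : V d) n).card : ℝ) * ∫ t in a..b, (F.P t).real (Tset m 0 k) ≤ ((bd n : Finset (V d)).card : ℝ) := by
  classical
  set Λ : Finset (V d) := box 0 (n+1)
  set D : ℝ → ℝ := fun t => ∑ e ∈ edgesIn Λ, ∫ ω, (psi n (opn e ω) - psi n (cls e ω)) ∂(F.P t)
  have hsub : Set.uIcc a b ⊆ Set.Icc 0 1 := by
    rw [Set.uIcc_of_le hab]; exact Set.Icc_subset_Icc ha hb
  have hDc : ContinuousOn D (Set.Icc 0 1) := by
    refine continuousOn_finsetSum _ fun e he => ?_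
    refine continuousOn_integral F (edgesIn Λ) (fun ω => psi n (opn e ω) - psi n (cls e ω)) ?_
    intro ω ω' h
    have h1 := dependsOn_comp_opn (e := e) (dependsOn_psi n) h
    have h2 := dependsOn_comp_cls (e := e) (dependsOn_psi n) h
    simp only at h1 h2 ⊢
    rw [h1, h2]
  have hint : ∫ t in a..b, D t = ∫ ω, psi n ω ∂(F.P b) - ∫ ω, psi n ω ∂(F.P a) := by
    refine intervalIntegral.integral_eq_sub_of_hasDerivAt_of_le (f := fun t => ∫ ω, psi n ω ∂(F.P t)) hab ?_ ?_ ?_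
    · exact (continuousOn_integral F _ _ (dependsOn_psi n)).mono (Set.Icc_subset_Icc ha hb)
    · intro t ht
      have ht' : t ∈ Set.Icc (0:ℝ) 1 := ⟨by linarith [ht.1], by linarith [ht.2]⟩
      exact (russo F _ _ (dependsOn_psi n) t ht').hasDerivAt (Icc_mem_nhds (by linarith [ht.1]) (by linarith [ht.2]))
    · exact (hDc.mono hsub).intervalIntegrable
  have hcc : ContinuousOn (fun t => (F.P t).real (Tset m 0 k)) (Set.uIcc a b) := (continuousOn_prob F _ (Tset_local m 0 k)).mono hsub
  have hle : ∫ t in a..b, ((box (0 : V d) n).card : ℝ) * (F.P t).real (Tset m 0 k) ≤ ∫ t in a..b, - D t := by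
    refine intervalIntegral.integral_mono_on hab (hcc.intervalIntegrable.const_mul _) (hDc.mono hsub).intervalIntegrable.neg ?_
    intro t ht
    have ht0 : 0 ≤ t := by linarith [ht.1]
    have ht1 : t ≤ 1 := by linarith [ht.2]
    simp only [D]
    rw [← Finset.sum_neg_distrib]
    let g : V d → Edge d := fun x => mkE x (x + Pi.single k 1) (dist1_single x k)
    have hg : Set.InjOn g (box (0 : V d) n : Set (V d)) := by
      intro x _ y _ hxy
      have := congrArg ends hxy
      simp only [g, ends_mkE, Sym2.eq_iff] at this
      rcases this with ⟨h, _⟩ | ⟨h, h'⟩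
      · exact h
      · exfalso
        have e1 := congrFun h k; have e2 := congrFun h' k
        simp at e1 e2; omega
    have hterm : ∀ e, 0 ≤ - ∫ ω, (psi n (opn e ω) - psi n (cls e ω)) ∂(F.P t) := by
      intro e
      rw [← integral_neg]
      refine integral_nonneg fun ω => ?_
      have := (psi_anti_strict (n := n) ((cls_le e ω).trans (le_opn e ω))).1
      simp only [Pi.zero_apply]; linarith
    have himg : (box (0 : V d) n).image g ⊆ edgesIn Λ := by
      intro e he
      obtain ⟨x, hx, rfl⟩ := Finset.mem_image.1 he
      exact mkE_mem_edgesIn.2 ⟨box_mono (Nat.le_succ _) hx, mem_box_trans hx (mem_box_of_dist1 (dist1_single x k).le)⟩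
    refine le_trans ?_ (Finset.sum_le_sum_of_subset_of_nonneg himg fun e _ _ => hterm e)
    rw [Finset.sum_image hg, ← nsmul_eq_mul, ← Finset.sum_const]
    refine Finset.sum_le_sum fun x hx => ?_
    rw [measureReal_def, ← Tset_shift F ht0 ht1 m x k, ← measureReal_def, ← integral_neg, ← integral_indicator_one (Tset_meas m x k)]
    refine integral_mono ?_ ?_ ?_
    · exact (integrable_const (1:ℝ)).indicator (Tset_meas m x k)
    · exact ((integrable_of_local F t _ _ (dependsOn_comp_opn (dependsOn_psi n))).sub (integrable_of_local F t _ _ (dependsOn_comp_cls (dependsOn_psi n)))).neg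
    · intro ω
      by_cases hω : ω ∈ Tset m x k
      · simp only [Set.indicator_of_mem hω, Pi.one_apply]
        have := psi_drop (dist1_single x k) hx hm hω
        simp only [g]; linarith
      · simp only [Set.indicator_of_notMem hω]
        have := (psi_anti_strict (n := n) ((cls_le (g x) ω).trans (le_opn (g x) ω))).1
        linarith
  rw [intervalIntegral.integral_const_mul, intervalIntegral.integral_neg, hint] at hle
  have h1 : 0 ≤ ∫ ω, psi n ω ∂(F.P b) := integral_nonneg (psi_nonneg n)
  have h2 : ∫ ω, psi n ω ∂(F.P a) ≤ ((bd n : Finset (V d)).card : ℝ) := by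
    have := integral_mono (μ := F.P a) (integrable_of_local F a _ _ (dependsOn_psi n)) (integrable_const ((bd n : Finset (V d)).card : ℝ)) (psi_le n)
    simpa using this
  linarith

end Perco

namespace Perco
variable {d : ℕ}

theorem Tset_anti {m m' : ℕ} (h : m ≤ m') (x : V d) (k : Fin d) : Tset m' x k ⊆ Tset m x k := by
  rintro ω ⟨h1, h2, h3⟩
  exact ⟨h1.anti h, h2.anti h, fun h' => h3 (Reach.mono (restr_mono_set (by exact_mod_cast box_mono h) _) h')⟩

theorem bd_ratio (d : ℕ) {ε : ℝ} (hε : 0 < ε) : ∃ n : ℕ, ((bd n : Finset (V d)).card : ℝ) ≤ ε * ((box (0 : V d) n).card : ℝ) := by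
  have h1 : Tendsto (fun n : ℕ => (1 + 2 * (1 / ((n : ℝ) + 1))) ^ d) atTop (𝓝 ((1 + 2 * 0) ^ d)) :=
    ((tendsto_one_div_add_atTop_nhds_zero_nat.const_mul 2).const_add 1).pow d
  simp only [mul_zero, add_zero, one_pow] at h1
  obtain ⟨n, hn⟩ := (h1.eventually (gt_mem_nhds (show (1:ℝ) < 1 + ε by linarith))).exists
  refine ⟨n, ?_⟩
  have hsub : box (0 : V d) n ⊆ box (0 : V d) (n+1) := box_mono (Nat.le_succ _)
  rw [bd, Finset.cast_card_sdiff hsub, card_box, card_box]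
  push_cast
  have hpos : (0:ℝ) < (2*n+1)^d := by positivity
  have h2 : ((2 * ((n:ℝ)+1) + 1))^d ≤ (1 + 2 * (1 / ((n : ℝ) + 1))) ^ d * (2*n+1)^d := by
    rw [← mul_pow]
    refine pow_le_pow_left₀ (by positivity) ?_ d
    have : (0:ℝ) < (n:ℝ)+1 := by positivity
    have h3 : (2:ℝ) ≤ 2 * (1 / ((n : ℝ) + 1)) * (2*n+1) := by
      rw [show 2 * (1 / ((n : ℝ) + 1)) * (2*n+1) = 2 * ((2*n+1) / (n+1)) by ring]
      have : (1:ℝ) ≤ (2*n+1)/(n+1) := by rw [le_div_iff₀ this]; linarith [(Nat.cast_nonneg n : (0:ℝ) ≤ n)]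
      linarith
    linarith
  nlinarith

theorem exists_t_null (F : BernoulliFamily d) {a b : ℝ} (ha : 0 ≤ a) (hab : a < b) (hb : b ≤ 1) :
    ∃ t, a ≤ t ∧ t ≤ b ∧ ∀ k : Fin d, F.P t (⋂ m, Tset m 0 k) = 0 := by
  have hsub : Set.uIcc a b ⊆ Set.Icc 0 1 := by
    rw [Set.uIcc_of_le hab.le]; exact Set.Icc_subset_Icc ha hb
  have hsub' : Set.Icc a b ⊆ Set.Icc 0 1 := Set.Icc_subset_Icc ha hb
  have key : ∀ k : Fin d, ∀ᵐ t ∂(volume.restrict (Set.Icc a b)), F.P t (⋂ m, Tset m 0 k) = 0 := by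
    intro k
    have hc : ∀ m, ContinuousOn (fun t => (F.P t).real (Tset m 0 k)) (Set.Icc a b) := fun m =>
      (continuousOn_prob F _ (Tset_local m 0 k)).mono hsub'
    have hmeas : ∀ m, AEMeasurable (fun t => ENNReal.ofReal ((F.P t).real (Tset m 0 k))) (volume.restrict (Set.Icc a b)) := fun m =>
      ((hc m).aemeasurable measurableSet_Icc).ennreal_ofReal
    have hz : ∫⁻ t in Set.Icc a b, ⨅ m, ENNReal.ofReal ((F.P t).real (Tset m 0 k)) = 0 := by
      refine le_antisymm (ENNReal.le_of_forall_pos_le_add fun ε hε _ => ?_) zero_le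
      obtain ⟨n, hn⟩ := bd_ratio d (ε := ε) (by exact_mod_cast hε)
      have h1 := russo_psi F ha hab.le hb n (2*n+4) le_rfl k
      have hpos : (0:ℝ) < ((box (0 : V d) n).card : ℝ) := by
        rw [card_box]; push_cast; positivity
      have h2 : ∫ t in a..b, (F.P t).real (Tset (2*n+4) 0 k) ≤ ε := by
        by_contra hlt
        push Not at hlt
        nlinarith
      calc ∫⁻ t in Set.Icc a b, ⨅ m, ENNReal.ofReal ((F.P t).real (Tset m 0 k))
          ≤ ∫⁻ t in Set.Icc a b, ENNReal.ofReal ((F.P t).real (Tset (2*n+4) 0 k)) := lintegral_mono fun t => iInf_le _ _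
        _ = ENNReal.ofReal (∫ t in Set.Icc a b, (F.P t).real (Tset (2*n+4) 0 k)) := by
            rw [ofReal_integral_eq_lintegral_ofReal]
            · exact (hc _).integrableOn_Icc
            · exact Eventually.of_forall fun t => measureReal_nonneg
        _ ≤ 0 + ε := by
            rw [zero_add, integral_Icc_eq_integral_Ioc, ← intervalIntegral.integral_of_le hab.le]
            exact ENNReal.ofReal_le_of_le_toReal (by simpa using h2)
    have hz' := (lintegral_eq_zero_iff' (AEMeasurable.iInf hmeas)).1 hz
    filter_upwards [hz'] with t ht
    refine le_antisymm ?_ zero_le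
    simp only [Pi.zero_apply] at ht
    rw [← ht]
    refine le_iInf fun m => ?_
    have := F.prob t
    rw [ofReal_measureReal]
    exact measure_mono (Set.iInter_subset _ m)
  have hall : ∀ᵐ t ∂(volume.restrict (Set.Icc a b)), ∀ k : Fin d, F.P t (⋂ m, Tset m 0 k) = 0 := ae_all_iff.2 key
  have hne : NeBot (ae (volume.restrict (Set.Icc a b))) := by
    rw [ae_neBot]
    intro h
    have := congrArg (fun m => m (Set.Icc a b)) h
    simp at this
    linarith
  obtain ⟨t, ht, ht2⟩ := (hall.and (ae_restrict_mem measurableSet_Icc)).exists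
  exact ⟨t, ht2.1, ht2.2, ht⟩

/-- almost sure uniqueness of the infinite cluster -/
def UniqAS (m : Measure (Config d)) : Prop := ∀ᵐ ω ∂m, ∀ x y, Inf ω x → Inf ω y → Reach ω x y

def Nset (x : V d) (k : Fin d) : Set (Config d) :=
  {ω | let η := cls (mkE x (x + Pi.single k 1) (dist1_single x k)) ω
       Inf η x ∧ Inf η (x + Pi.single k 1) ∧ ¬ Reach η x (x + Pi.single k 1)}

theorem Nset_subset (x : V d) (k : Fin d) : Nset x k ⊆ ⋂ m, Tset m x k := by
  rintro ω ⟨h1, h2, h3⟩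
  refine Set.mem_iInter.2 fun m => ⟨inf_iff.1 h1 m, inf_iff.1 h2 m, fun h => h3 (Reach.mono (restr_le _ _) h)⟩

theorem iInter_Tset_shift (F : BernoulliFamily d) {t : ℝ} (h0 : 0 ≤ t) (h1 : t ≤ 1) (x : V d) (k : Fin d) :
    F.P t (⋂ m, Tset m x k) = F.P t (⋂ m, Tset m 0 k) := by
  rw [← sh_prob F h0 h1 x (MeasurableSet.iInter fun m => Tset_meas m 0 k)]
  congr 1
  ext ω
  simp only [Tset, Set.mem_iInter, Set.mem_ofPred_eq, Tev, sh_cls, sh_far, sh_restr, sh_reach, shE_mkE, zero_add, add_comm (Pi.single k 1) x]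

theorem foldl_null (F : BernoulliFamily d) {t : ℝ} (h0 : 0 < t) (h1 : t ≤ 1) {B : Set (Config d)} (hB : MeasurableSet B)
    (hz : F.P t B = 0) (l : List (Edge d)) : F.P t {ω | l.foldl (fun η e => opn e η) ω ∈ B} = 0 := by
  induction l using List.reverseRecOn generalizing B with
  | nil => simpa using hz
  | append_singleton l e ih =>
    have hm : MeasurableSet {ω : Config d | opn e ω ∈ B} := measurable_opn e hB
    have h2 : F.P t {ω : Config d | opn e ω ∈ B} = 0 := by
      have h3 := opn_real_le F h0 h1 e hB
      have := F.prob t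
      have hz' : (F.P t).real B = 0 := by rw [measureReal_def, hz]; simp
      rw [hz'] at h3
      have h4 : (F.P t).real {ω : Config d | opn e ω ∈ B} = 0 := by
        have := measureReal_nonneg (μ := F.P t) (s := {ω : Config d | opn e ω ∈ B})
        simp only [zero_div] at h3
        exact le_antisymm h3 this
      rwa [measureReal_eq_zero_iff] at h4
    have := ih hm h2
    simpa [List.foldl_append] using this

theorem foldl_le (l : List (Edge d)) : ∀ ω : Config d, ω ≤ l.foldl (fun η e => opn e η) ω := by
  induction l with
  | nil => intro ω; exact le_rfl
  | cons e l ih => intro ω; exact (le_opn e ω).trans (ih _)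

theorem foldl_mem {e : Edge d} (l : List (Edge d)) : ∀ ω : Config d, e ∈ l → l.foldl (fun η e => opn e η) ω e = true := by
  induction l with
  | nil => intro ω h; simp at h
  | cons e' l ih =>
    intro ω h
    by_cases he : e = e'
    · subst he
      have := foldl_le l (opn e ω) e
      rw [opn_same] at this
      exact top_le_iff.1 this
    · exact ih _ (by simpa [he] using h)

theorem exists_list (x y : V d) : ∃ l : List (Edge d), ∀ ω, Reach (l.foldl (fun η e => opn e η) ω) x y := by
  obtain ⟨w⟩ := reach_top x y
  induction w with
  | nil => exact ⟨[], fun ω => SimpleGraph.Reachable.refl _⟩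
  | cons hadj p ih =>
    rename_i a b c
    obtain ⟨l, hl⟩ := ih
    obtain ⟨h, _⟩ := adj_iff.1 hadj
    refine ⟨mkE a b h :: l, fun ω => ?_⟩
    have h1 : (gr ((mkE a b h :: l).foldl (fun η e => opn e η) ω)).Adj a b := adj_iff.2 ⟨h, foldl_mem _ _ (by simp)⟩
    exact (SimpleGraph.Adj.reachable h1).trans (hl (opn (mkE a b h) ω))

theorem uniq_of_null (F : BernoulliFamily d) {t : ℝ} (h0 : 0 < t) (h1 : t ≤ 1)
    (hz : ∀ k : Fin d, F.P t (⋂ m, Tset m 0 k) = 0) : UniqAS (F.P t) := by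
  have hz' : ∀ (x : V d) (k : Fin d), F.P t (⋂ m, Tset m x k) = 0 := fun x k => by
    rw [iInter_Tset_shift F h0.le h1, hz]
  have hae : ∀ᵐ ω ∂(F.P t), ∀ (l : List (Edge d)) (x : V d) (k : Fin d), l.foldl (fun η e => opn e η) ω ∉ Nset x k := by
    rw [ae_all_iff]; intro l
    rw [ae_all_iff]; intro x
    rw [ae_all_iff]; intro k
    have := foldl_null F h0 h1 (MeasurableSet.iInter fun m => Tset_meas m x k) (hz' x k) l
    rw [ae_iff]
    refine measure_mono_null (fun ω hω => ?_) this
    simp only [Set.mem_ofPred_eq, not_not] at hω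
    exact Nset_subset x k hω
  filter_upwards [hae] with ω hω x y hx hy
  obtain ⟨l, hl⟩ := exists_list x y
  have key : ∀ (l : List (Edge d)) (ω : Config d), (∀ (l : List (Edge d)) (x : V d) (k : Fin d), l.foldl (fun η e => opn e η) ω ∉ Nset x k) →
      Reach (l.foldl (fun η e => opn e η) ω) x y → Inf ω x → Inf ω y → Reach ω x y := by
    intro l
    induction l with
    | nil => intro ω _ h _ _; exact h
    | cons e l ih =>
      intro ω hω h hx hy
      have h2 := ih (opn e ω) (fun l' x k => hω (e :: l') x k) h (hx.mono (le_opn e ω)) (hy.mono (le_opn e ω))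
      by_cases he : ω e = true
      · rwa [opn_of_true he] at h2
      · simp only [Bool.not_eq_true] at he
        have hN : ∀ (u : V d) (k : Fin d), e = mkE u (u + Pi.single k 1) (dist1_single u k) → Inf ω u → Inf ω (u + Pi.single k 1) → Reach ω u (u + Pi.single k 1) := by
          intro u k hek hu hv
          by_contra hr
          apply hω [] u k
          simp only [List.foldl_nil, Nset, Set.mem_ofPred_eq]
          rw [← hek, cls_of_false he]
          exact ⟨hu, hv, hr⟩
        obtain ⟨u, v, huv, rfl⟩ := Edge.exists_rep e
        have hN2 : Inf ω u → Inf ω v → Reach ω u v := by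
          intro hu hv
          obtain ⟨k, hk | hk⟩ := dist1_one_iff huv
          · subst hk; exact hN u k rfl hu hv
          · subst hk; exact (hN v k (ends_injective (by rw [ends_mkE, ends_mkE]; exact Sym2.eq_swap)) hv hu).symm
        rcases reach_opn h2 with h3 | ⟨h3, h4⟩ | ⟨h3, h4⟩
        · exact h3
        · exact (h3.trans (hN2 (hx.of_reach h3) (hy.of_reach h4.symm))).trans h4
        · exact (h3.trans (hN2 (hy.of_reach h4.symm) (hx.of_reach h3)).symm).trans h4
  exact key l ω hω (hl ω) hx hy
end Perco

namespace Perco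
variable {d : ℕ}

theorem ev_small {Ω : Type*} [MeasurableSpace Ω] (m : Measure Ω) [IsProbabilityMeasure m] {A : ℕ → Set Ω} (hA : ∀ n, MeasurableSet (A n))
    (h : ∀ᵐ ω ∂m, ∀ᶠ n in atTop, ω ∉ A n) : Tendsto (fun n => m.real (A n)) atTop (𝓝 0) := by
  have h1 : Tendsto (fun n => m (⋃ k, A (n + k))) atTop (𝓝 (m (⋂ n, ⋃ k, A (n + k)))) := by
    refine tendsto_measure_iInter_atTop (fun n => (MeasurableSet.iUnion fun k => hA _).nullMeasurableSet) ?_ ⟨0, measure_ne_top _ _⟩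
    intro n n' hnn' ω hω
    obtain ⟨k, hk⟩ := Set.mem_iUnion.1 hω
    exact Set.mem_iUnion.2 ⟨n' - n + k, by rwa [show n + (n' - n + k) = n' + k by omega]⟩
  have h2 : m (⋂ n, ⋃ k, A (n + k)) = 0 := by
    rw [ae_iff] at h
    refine measure_mono_null (fun ω hω => ?_) h
    intro hev
    obtain ⟨n, hn⟩ := eventually_atTop.1 hev
    obtain ⟨k, hk⟩ := Set.mem_iUnion.1 (Set.mem_iInter.1 hω n)
    exact hn (n+k) (by omega) hk
  rw [h2] at h1
  have h3 : Tendsto (fun n => m (A n)) atTop (𝓝 0) :=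
    tendsto_of_tendsto_of_tendsto_of_le_of_le tendsto_const_nhds h1 (fun n => zero_le) (fun n => measure_mono fun ω hω => Set.mem_iUnion.2 ⟨0, hω⟩)
  exact (ENNReal.tendsto_toReal_zero_iff (fun n => measure_ne_top _ _)).2 h3

theorem chemDist_eq_nat {ω : Config d} {x y : V d} (h : Reach ω x y) : ∃ n : ℕ, chemDist ω x y = n := by
  obtain ⟨w, hw⟩ := exists_walk_chemDist h
  exact ⟨w.length, hw.symm⟩

theorem measurableSet_chemDist_le (x y : V d) (n : ℕ) : MeasurableSet {ω : Config d | chemDist ω x y ≤ n} := by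
  have : {ω : Config d | chemDist ω x y ≤ n} = {ω : Config d | chemDist (restr (box x n) ω) x y ≤ n} := by
    ext ω; exact chemDist_le_iff_restr (le_refl n)
  rw [this]
  exact measurableSet_of_local _ _ (dependsOn_restr (S := box x n) (fun ω => chemDist ω x y ≤ n))

theorem chemDist_top_iff {ω : Config d} {x y : V d} : chemDist ω x y = ⊤ ↔ ¬ Reach ω x y := by
  rw [← connected_iff, Connected]; tauto

theorem measurable_chemDist (x y : V d) : Measurable (fun ω : Config d => chemDist ω x y) := by
  refine measurable_of_Iic fun a => ?_
  by_cases ha : a = ⊤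
  · subst ha; simp
  · have : (fun ω : Config d => chemDist ω x y) ⁻¹' Set.Iic a = {ω | chemDist ω x y ≤ (⌊a.toReal⌋₊ : ℕ)} := by
      ext ω
      simp only [Set.mem_preimage, Set.mem_Iic, Set.mem_ofPred_eq]
      by_cases hr : Reach ω x y
      · obtain ⟨n, hn⟩ := chemDist_eq_nat hr
        rw [hn]
        rw [Nat.cast_le, Nat.le_floor_iff ENNReal.toReal_nonneg, ← ENNReal.ofReal_le_iff_le_toReal ha, ENNReal.ofReal_natCast]
      · rw [chemDist_top_iff.2 hr]
        simp [ha]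
    rw [this]
    exact measurableSet_chemDist_le x y _

/-! ### regPoint -/
theorem regPoint_spec {ω : Config d} (h : ∃ x, Inf ω x) (x : V d) :
    Inf ω (regPoint ω x) ∧ ∀ z, Inf ω z → dist1 x (regPoint ω x) ≤ dist1 x z := by
  have h1 : ∃ y : V d, InInfiniteCluster ω y ∧ ∀ z : V d, InInfiniteCluster ω z → dist1 x y ≤ dist1 x z := by
    classical
    have hex : ∃ n : ℕ, ∃ y, Inf ω y ∧ dist1 x y = n := by obtain ⟨y, hy⟩ := h; exact ⟨_, y, hy, rfl⟩
    obtain ⟨y, hy, hn⟩ := Nat.find_spec hex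
    refine ⟨y, hy, fun z hz => ?_⟩
    rw [hn]
    exact Nat.find_min' hex ⟨z, hz, rfl⟩
  unfold regPoint
  rw [dif_pos h1]
  exact h1.choose_spec

theorem regPoint_none {ω : Config d} (h : ¬ ∃ x, Inf ω x) (x : V d) : regPoint ω x = x := by
  unfold regPoint
  rw [dif_neg]
  rintro ⟨y, hy, _⟩
  exact h ⟨y, hy⟩

/-- almost sure existence and uniqueness -/
def UE (m : Measure (Config d)) : Prop := UniqAS m ∧ ∀ᵐ ω ∂m, ∃ x, Inf ω x

theorem top_inf (hd : 1 ≤ d) : Inf (⊤ : Config d) 0 := by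
  refine inf_iff.2 fun K => ?_
  refine ⟨fun _ => (K:ℤ)+1, reach_top _ _, ?_⟩
  rw [mem_box]
  push Not
  refine ⟨⟨0, hd⟩, ?_⟩
  simp only [Pi.zero_apply, sub_zero]
  exact lt_of_lt_of_le (by omega) (le_abs_self _)

theorem theta_pos (hd : 1 ≤ d) (F : BernoulliFamily d) {p : ℝ} (hp : pc F < p) (hp1 : p ≤ 1) :
    0 < F.P p {ω | Inf ω 0} := by
  have hne : {p : ℝ | 0 ≤ p ∧ p ≤ 1 ∧ 0 < F.P p {ω : Config d | InInfiniteCluster ω 0}}.Nonempty := by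
    refine ⟨1, zero_le_one, le_rfl, ?_⟩
    have hall : ∀ᵐ ω ∂(F.P 1), ∀ e, ω e = true := by
      rw [ae_all_iff]; intro e
      have := F.iid 1 zero_le_one le_rfl {e} (fun _ => false)
      simp at this
      rw [ae_iff]
      simpa using this
    have h2 : ∀ᵐ ω ∂(F.P 1), Inf ω 0 := by
      filter_upwards [hall] with ω hω
      have : ω = ⊤ := by funext e; exact hω e
      rw [this]; exact top_inf hd
    have := F.prob 1
    have h3 : F.P 1 {ω | Inf ω 0} = 1 := (prob_compl_eq_zero_iff (measurableSet_inf 0)).1 h2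
    rw [h3]; exact one_pos
  obtain ⟨q, ⟨hq0, hq1, hq⟩, hlt⟩ := exists_lt_of_csInf_lt hne hp
  exact hq.trans_le (prob_mono F hq0 hlt.le hp1 (measurableSet_inf 0) fun ω ω' h h' => Inf.mono h h')

theorem pc_nonneg (F : BernoulliFamily d) : 0 ≤ pc F := by
  unfold pc
  exact Real.sInf_nonneg fun x hx => hx.1

theorem measurableSet_exinf : MeasurableSet {ω : Config d | ∃ x, Inf ω x} := by
  have : {ω : Config d | ∃ x, Inf ω x} = ⋃ x, {ω | Inf ω x} := by ext; simp
  rw [this]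
  exact MeasurableSet.iUnion fun x => measurableSet_inf x

theorem exists_as (hd : 1 ≤ d) (F : BernoulliFamily d) {p : ℝ} (hp : pc F < p) (hp1 : p ≤ 1)
    (hu : UniqAS (F.P p)) {μ : V d → ℝ} (hconv : ASTimeConstant (F.P p) μ) : ∀ᵐ ω ∂(F.P p), ∃ x, Inf ω x := by
  have hp0 : 0 ≤ p := (pc_nonneg F).trans hp.le
  have := F.prob p
  by_contra hcon
  let e : V d := Pi.single ⟨0, hd⟩ 1
  have hde : ∀ n : ℕ, dist1 (0 : V d) (n • e) = n := by
    intro n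
    have h1 := dist1_nsmul n (0 : V d) e
    have h2 := dist1_single (0 : V d) ⟨0, hd⟩
    rw [zero_add] at h2
    rw [smul_zero] at h1
    rw [h1, h2, mul_one]
  have hc := hconv e
  -- the limit vanishes
  have hmu : μ e = 0 := by
    have hfreq : ∃ᵐ ω ∂(F.P p), ¬ ∃ x, Inf ω x := by
      rw [Filter.Frequently]; simpa using hcon
    obtain ⟨ω, hω, hlim⟩ := (hfreq.and_eventually hc).exists
    refine tendsto_nhds_unique hlim ?_
    refine tendsto_const_nhds.congr' ?_
    have hfin : (cluster ω (0 : V d)).Finite := by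
      by_contra h; exact hω ⟨0, h⟩
    obtain ⟨N, hN⟩ : ∃ N : ℕ, ∀ y ∈ cluster ω (0 : V d), dist1 0 y ≤ N := by
      refine ⟨hfin.toFinset.sup (dist1 0), fun y hy => ?_⟩
      exact Finset.le_sup (f := dist1 0) (hfin.mem_toFinset.2 hy)
    filter_upwards [eventually_gt_atTop N] with n hn
    unfold DReg
    rw [regPoint_none hω, regPoint_none hω]
    have : chemDist ω 0 (n • e) = ⊤ := by
      rw [chemDist_top_iff]
      intro hr
      have := hN _ (mem_cluster.2 hr)
      rw [hde] at this; omega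
    rw [this]; simp
  rw [hmu] at hc
  have hev : ∀ᵐ ω ∂(F.P p), ∀ᶠ n : ℕ in atTop, ω ∉ {ω : Config d | Inf ω (n • e)} := by
    filter_upwards [hc, hu] with ω hlim huω
    by_cases hex : ∃ x, Inf ω x
    · have h0 := regPoint_spec hex 0
      have h1 := hlim.eventually (gt_mem_nhds (show (0:ℝ) < 1/2 by norm_num))
      filter_upwards [h1, eventually_gt_atTop (2 * dist1 0 (regPoint ω 0))] with n hn hn2
      intro hinf
      have hn' := regPoint_spec hex (n • e)
      have h3 : dist1 (n • e) (regPoint ω (n • e)) = 0 := by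
        have := hn'.2 _ hinf
        rw [dist1_self] at this; omega
      have h4 := (dist1_eq_zero h3).symm
      have hr : Reach ω (regPoint ω 0) (regPoint ω (n • e)) := huω _ _ h0.1 hn'.1
      obtain ⟨k, hk⟩ := chemDist_eq_nat hr
      have h5 := dist1_le_chemDist ω (regPoint ω 0) (regPoint ω (n • e))
      rw [hk, Nat.cast_le, h4] at h5
      unfold DReg at hn
      rw [hk] at hn
      simp only [ENNReal.toReal_natCast] at hn
      have hnpos : (0:ℝ) < n := by exact_mod_cast (by omega : 0 < n)
      rw [div_lt_iff₀ hnpos] at hn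
      have h6 := dist1_triangle 0 (regPoint ω 0) (n • e)
      rw [hde] at h6
      have h7 : (2:ℝ) * k < n := by linarith
      have h8 : 2 * k < n := by exact_mod_cast h7
      omega
    · exact Eventually.of_forall fun n hn => hex ⟨_, hn⟩
  have hlim0 := ev_small (F.P p) (fun n => measurableSet_inf (n • e)) hev
  have hconst : ∀ n : ℕ, (F.P p).real {ω : Config d | Inf ω (n • e)} = (F.P p).real {ω | Inf ω 0} := by
    intro n
    rw [measureReal_def, measureReal_def, ← sh_prob F hp0 hp1 (n • e) (measurableSet_inf 0)]
    simp only [Set.mem_ofPred_eq, sh_inf, zero_add]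
  simp_rw [hconst] at hlim0
  have hz := tendsto_nhds_unique tendsto_const_nhds hlim0
  have hpos := theta_pos hd F hp hp1
  rw [measureReal_eq_zero_iff] at hz
  exact hpos.ne' hz

/-! ### the H lemma -/
theorem H_lemma (F : BernoulliFamily d) {p : ℝ} (hp0 : 0 ≤ p) (hp1 : p ≤ 1) (hUE : UE (F.P p)) {μ : V d → ℝ}
    (hconv : ASTimeConstant (F.P p) μ) (x : V d) (M : ℕ) {ε : ℝ} (hε : 0 < ε) :
    Tendsto (fun n : ℕ => (F.P p).real {ω | ∃ y ∈ box (0 : V d) M, ∃ y' ∈ box (n • x) M, Inf ω y ∧ Inf ω y' ∧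
      ε * n < |(chemDist ω y y').toReal - μ x * n|}) atTop (𝓝 0) := by
  have := F.prob p
  obtain ⟨hu, hex⟩ := hUE
  rw [Metric.tendsto_atTop]
  intro δ hδ
  -- a box containing an infinite point
  have hM0 : Tendsto (fun M0 : ℕ => (F.P p).real {ω : Config d | ¬ ∃ y ∈ box (0 : V d) M0, Inf ω y}) atTop (𝓝 0) := by
    refine ev_small _ (fun n => ?_) ?_
    · refine (MeasurableSet.compl ?_)
      have : {ω : Config d | ∃ y ∈ box (0 : V d) n, Inf ω y} = ⋃ y ∈ box (0 : V d) n, {ω | Inf ω y} := by ext; simp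
      change MeasurableSet {ω : Config d | ∃ y ∈ box (0 : V d) n, Inf ω y}
      rw [this]
      exact Finset.measurableSet_biUnion _ fun y _ => measurableSet_inf y
    · filter_upwards [hex] with ω ⟨y, hy⟩
      filter_upwards [eventually_ge_atTop (dist1 0 y)] with n hn h
      exact h ⟨y, mem_box_of_dist1 hn, hy⟩
  obtain ⟨M0, hM0⟩ := (hM0.eventually (gt_mem_nhds (show (0:ℝ) < δ/8 by linarith))).exists
  set L := max M (d * M0) with hL
  let Dm : ℕ → V d → Set (Config d) := fun R c => {ω | ∃ y ∈ box c L, ∃ y' ∈ box c L, Inf ω y ∧ Inf ω y' ∧ ¬ chemDist ω y y' ≤ R}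
  have hDmeas : ∀ R c, MeasurableSet (Dm R c) := by
    intro R c
    have : Dm R c = ⋃ y ∈ box c L, ⋃ y' ∈ box c L, ({ω : Config d | Inf ω y} ∩ {ω | Inf ω y'} ∩ {ω | chemDist ω y y' ≤ R}ᶜ) := by
      ext ω; simp only [Dm, Set.mem_ofPred_eq, Set.mem_iUnion, Set.mem_inter_iff, Set.mem_compl_iff, exists_prop]
      simp only [and_assoc]
    rw [this]
    exact Finset.measurableSet_biUnion _ fun y _ => Finset.measurableSet_biUnion _ fun y' _ =>
      ((measurableSet_inf y).inter (measurableSet_inf y')).inter (measurableSet_chemDist_le y y' R).compl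
  have hR : Tendsto (fun R : ℕ => (F.P p).real (Dm R 0)) atTop (𝓝 0) := by
    refine ev_small _ (fun R => hDmeas R 0) ?_
    filter_upwards [hu] with ω hω
    have h1 : ∀ y ∈ box (0 : V d) L, ∀ y' ∈ box (0 : V d) L, ∀ᶠ R : ℕ in atTop, Inf ω y → Inf ω y' → chemDist ω y y' ≤ R := by
      intro y _ y' _
      by_cases hr : Reach ω y y'
      · obtain ⟨k, hk⟩ := chemDist_eq_nat hr
        filter_upwards [eventually_ge_atTop k] with R hR _ _
        rw [hk]; exact_mod_cast hR
      · exact Eventually.of_forall fun R h h' => absurd (hω _ _ h h') hr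
    have h2 : ∀ᶠ R : ℕ in atTop, ∀ y ∈ box (0 : V d) L, ∀ y' ∈ box (0 : V d) L, Inf ω y → Inf ω y' → chemDist ω y y' ≤ R := by
      rw [Filter.eventually_all_finset]; intro y hy
      rw [Filter.eventually_all_finset]; intro y' hy'
      exact h1 y hy y' hy'
    filter_upwards [h2] with R hR ⟨y, hy, y', hy', h3, h4, h5⟩
    exact h5 (hR y hy y' hy' h3 h4)
  obtain ⟨R, hR⟩ := (hR.eventually (gt_mem_nhds (show (0:ℝ) < δ/8 by linarith))).exists
  have hDsh : ∀ c, (F.P p).real (Dm R c) = (F.P p).real (Dm R 0) := by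
    intro c
    rw [measureReal_def, measureReal_def, ← sh_prob F hp0 hp1 c (hDmeas R 0)]
    congr 2
    ext ω
    simp only [Dm, Set.mem_ofPred_eq, sh_inf, sh_chemDist]
    constructor
    · rintro ⟨y, hy, y', hy', h⟩
      refine ⟨y - c, ?_, y' - c, ?_, ?_⟩
      · rw [← mem_box_add (z := c)]; simpa using hy
      · rw [← mem_box_add (z := c)]; simpa using hy'
      · simpa using h
    · rintro ⟨y, hy, y', hy', h⟩
      refine ⟨y + c, ?_, y' + c, ?_, h⟩
      · rw [← mem_box_add (z := c)] at hy; simpa using hy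
      · rw [← mem_box_add (z := c)] at hy'; simpa using hy'
  let Ex : V d → Set (Config d) := fun c => {ω | ∃ y ∈ box c M0, Inf ω y}
  have hExm : ∀ c, MeasurableSet (Ex c) := by
    intro c
    have : Ex c = ⋃ y ∈ box c M0, {ω | Inf ω y} := by ext; simp [Ex]
    rw [this]
    exact Finset.measurableSet_biUnion _ fun y _ => measurableSet_inf y
  have hExsh : ∀ c, (F.P p).real (Ex c)ᶜ = (F.P p).real (Ex 0)ᶜ := by
    intro c
    rw [measureReal_def, measureReal_def, ← sh_prob F hp0 hp1 c (hExm 0).compl]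
    congr 2
    ext ω
    simp only [Ex, Set.mem_compl_iff, Set.mem_ofPred_eq, sh_inf]
    rw [not_iff_not]
    constructor
    · rintro ⟨y, hy, h⟩
      refine ⟨y - c, ?_, ?_⟩
      · rw [← mem_box_add (z := c)]; simpa using hy
      · simpa using h
    · rintro ⟨y, hy, h⟩
      refine ⟨y + c, ?_, h⟩
      · rw [← mem_box_add (z := c)] at hy; simpa using hy
  let Qs : ℕ → Set (Config d) := fun n => (Ex 0 ∩ Ex (n • x)) ∩ {ω | ∀ y ∈ box (0 : V d) L, ∀ y' ∈ box (n • x) L, Inf ω y → Inf ω y' →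
    ε/2 * n < |(chemDist ω y y').toReal - μ x * n|}
  have hQm : ∀ n, MeasurableSet (Qs n) := by
    intro n
    refine ((hExm 0).inter (hExm _)).inter ?_
    have : {ω : Config d | ∀ y ∈ box (0 : V d) L, ∀ y' ∈ box (n • x) L, Inf ω y → Inf ω y' →
      ε/2 * n < |(chemDist ω y y').toReal - μ x * n|} = ⋂ y ∈ box (0 : V d) L, ⋂ y' ∈ box (n • x) L, ({ω : Config d | Inf ω y}ᶜ ∪ ({ω | Inf ω y'}ᶜ ∪ {ω | ε/2 * n < |(chemDist ω y y').toReal - μ x * n|})) := by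
      ext ω; simp only [Set.mem_ofPred_eq, Set.mem_iInter, Set.mem_union, Set.mem_compl_iff, imp_iff_not_or]
    rw [this]
    refine Finset.measurableSet_biInter _ fun y _ => Finset.measurableSet_biInter _ fun y' _ =>
      (measurableSet_inf y).compl.union ((measurableSet_inf y').compl.union ?_)
    exact measurableSet_lt measurable_const ((measurable_chemDist y y').ennreal_toReal.sub_const _).abs
  have hQ := ev_small (F.P p) hQm (by
    filter_upwards [hu, hex, hconv x] with ω hω hexω hlim
    have h1 : ∀ᶠ n : ℕ in atTop, |DReg ω ω 0 (n • x) / n - μ x| < ε/2 := by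
      have := (Metric.tendsto_nhds.1 hlim) (ε/2) (by linarith)
      simpa [Real.dist_eq] using this
    filter_upwards [h1, eventually_gt_atTop 0] with n hn hn0 hmem
    obtain ⟨⟨⟨z, hz, hz'⟩, ⟨z1, hz1, hz1'⟩⟩, hall⟩ := hmem
    have hr0 := regPoint_spec hexω 0
    have hrn := regPoint_spec hexω (n • x)
    have hlt := hall (regPoint ω 0) (box_mono (le_max_right _ _) (mem_box_of_dist1 ((hr0.2 z hz').trans (dist1_of_mem_box hz))))
      (regPoint ω (n • x)) (box_mono (le_max_right _ _) (mem_box_of_dist1 ((hrn.2 z1 hz1').trans (dist1_of_mem_box hz1)))) hr0.1 hrn.1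
    have hnpos : (0:ℝ) < n := by exact_mod_cast hn0
    have h3 : |(chemDist ω (regPoint ω 0) (regPoint ω (n • x))).toReal - μ x * n| = |DReg ω ω 0 (n • x) / n - μ x| * n := by
      rw [← abs_of_pos hnpos, ← abs_mul, abs_of_pos hnpos, sub_mul, div_mul_cancel₀ _ hnpos.ne']
      rfl
    rw [h3] at hlt
    nlinarith)
  obtain ⟨n1, hn1⟩ := eventually_atTop.1 (hQ.eventually (gt_mem_nhds (show (0:ℝ) < δ/8 by linarith)))
  obtain ⟨n2, hn2⟩ := exists_nat_gt (4 * R / ε)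
  refine ⟨max n1 (n2+1), fun n hn => ?_⟩
  have hnn1 : n1 ≤ n := (le_max_left _ _).trans hn
  have hnn2 : n2 + 1 ≤ n := (le_max_right _ _).trans hn
  rw [Real.dist_eq, sub_zero, abs_of_nonneg measureReal_nonneg]
  have hsub : {ω | ∃ y ∈ box (0 : V d) M, ∃ y' ∈ box (n • x) M, Inf ω y ∧ Inf ω y' ∧
      ε * n < |(chemDist ω y y').toReal - μ x * n|} ≤ᵐ[F.P p] ((Qs n ∪ ((Ex 0)ᶜ ∪ (Ex (n • x))ᶜ)) ∪ (Dm R 0 ∪ Dm R (n • x)) : Set (Config d)) := by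
    filter_upwards [hu] with ω hω hmem
    obtain ⟨y, hy, y', hy', hiy, hiy', hlt⟩ := hmem
    by_contra hnot
    replace hnot : ω ∉ ((Qs n ∪ ((Ex 0)ᶜ ∪ (Ex (n • x))ᶜ)) ∪ (Dm R 0 ∪ Dm R (n • x)) : Set (Config d)) := hnot
    simp only [Set.mem_union, not_or, Set.mem_compl_iff, not_not] at hnot
    obtain ⟨⟨hq, he0, hen⟩, hd0, hdn⟩ := hnot
    have hq2 : ¬ ∀ y ∈ box (0 : V d) L, ∀ y' ∈ box (n • x) L, Inf ω y → Inf ω y' →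
      ε/2 * n < |(chemDist ω y y').toReal - μ x * n| := fun h => hq ⟨⟨he0, hen⟩, h⟩
    push Not at hq2
    obtain ⟨z, hz, z', hz', hiz, hiz', hle⟩ := hq2
    have hyL := box_mono (le_max_left M (d*M0)) hy
    have hyL' := box_mono (le_max_left M (d*M0)) hy'
    have a1 : chemDist ω y z ≤ R := by
      by_contra h; exact hd0 ⟨y, hyL, z, hz, hiy, hiz, h⟩
    have a2 : chemDist ω y' z' ≤ R := by
      by_contra h; exact hdn ⟨y', hyL', z', hz', hiy', hiz', h⟩
    obtain ⟨k, hk⟩ := chemDist_eq_nat (hω _ _ hiy hiy')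
    obtain ⟨k', hk'⟩ := chemDist_eq_nat (hω _ _ hiz hiz')
    have b1 : chemDist ω y y' ≤ R + (chemDist ω z z' + R) :=
      (chemDist_triangle ω y z y').trans (add_le_add a1 ((chemDist_triangle ω z z' y').trans (add_le_add le_rfl (by rw [chemDist_comm]; exact a2))))
    have b2 : chemDist ω z z' ≤ R + (chemDist ω y y' + R) :=
      (chemDist_triangle ω z y z').trans (add_le_add (by rw [chemDist_comm]; exact a1) ((chemDist_triangle ω y y' z').trans (add_le_add le_rfl a2)))
    rw [hk, hk'] at b1 b2
    rw [hk'] at hle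
    rw [hk] at hlt
    simp only [ENNReal.toReal_natCast] at hle hlt
    have b1' : k ≤ R + (k' + R) := by exact_mod_cast b1
    have b2' : k' ≤ R + (k + R) := by exact_mod_cast b2
    have b1r : (k:ℝ) ≤ R + (k' + R) := by exact_mod_cast b1'
    have b2r : (k':ℝ) ≤ R + (k + R) := by exact_mod_cast b2'
    have hRn : 2 * (R:ℝ) ≤ ε/2 * n := by
      rw [div_lt_iff₀ hε] at hn2
      have : (n2:ℝ) + 1 ≤ n := by exact_mod_cast hnn2
      nlinarith
    rw [abs_le] at hle
    have : |(k:ℝ) - μ x * n| ≤ ε * n := by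
      rw [abs_le]; constructor <;> linarith [hle.1, hle.2]
    linarith
  have hbound : (F.P p).real {ω | ∃ y ∈ box (0 : V d) M, ∃ y' ∈ box (n • x) M, Inf ω y ∧ Inf ω y' ∧
      ε * n < |(chemDist ω y y').toReal - μ x * n|} ≤ ((F.P p).real (Qs n) + ((F.P p).real (Ex 0)ᶜ + (F.P p).real (Ex (n • x))ᶜ)) + ((F.P p).real (Dm R 0) + (F.P p).real (Dm R (n • x))) := by
    refine (ENNReal.toReal_mono (measure_ne_top _ _) (measure_mono_ae hsub)).trans ?_
    refine (measureReal_union_le _ _).trans (add_le_add ((measureReal_union_le _ _).trans (add_le_add le_rfl (measureReal_union_le _ _))) (measureReal_union_le _ _))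
  rw [hDsh (n • x), hExsh (n • x)] at hbound
  have e1 := hn1 n hnn1
  have e2 : (F.P p).real (Ex 0)ᶜ < δ/8 := hM0
  linarith
end Perco

namespace Perco
variable {d : ℕ}

/-- centre of the tile with index `i` -/
def cen (N : ℕ) (i : V d) : V d := fun k => (N : ℤ) * i k

theorem cen_add (N : ℕ) (i j : V d) : cen N (i + j) = cen N i + cen N j := by
  funext k; simp [cen, mul_add]
theorem cen_zero (N : ℕ) : cen N (0 : V d) = 0 := by funext k; simp [cen]
theorem cen_nsmul (N : ℕ) (i : V d) : cen N i = N • i := by funext k; simp [cen]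

theorem cen_mem_box {N : ℕ} {i i' : V d} (h : dist1 i i' ≤ 1) : cen N i' ∈ box (cen N i) N := by
  rw [mem_box]; intro k
  have := coord_le_dist1 i i' k
  simp only [cen]
  rw [← mul_sub, abs_mul, Nat.abs_cast, abs_sub_comm]
  have h1 : |i k - i' k| ≤ 1 := this.trans (by exact_mod_cast h)
  nlinarith [(Nat.cast_nonneg N : (0:ℤ) ≤ N)]

def Seed (C h M K : ℕ) (ω : Config d) (i : V d) : Prop :=
  (∃ y ∈ box (cen (2*h+1) i) M, Far ω y K) ∧
  ∀ i', dist1 i i' ≤ 1 → ∀ y ∈ box (cen (2*h+1) i) M, ∀ y' ∈ box (cen (2*h+1) i') M, Far ω y K → Far ω y' K →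
    Reach (restr (box (cen (2*h+1) i) (C*(2*h+1))) ω) y y'

theorem dependsOn_seed {C h M K : ℕ} (hC : 3 ≤ C) (hM : M + K + 1 ≤ h) (i : V d) :
    DependsOn (fun ω => Seed C h M K ω i) (edgesIn (box (cen (2*h+1) i) (C*(2*h+1))) : Set (Edge d)) := by
  have hCN : 3 * (2*h+1) ≤ C * (2*h+1) := Nat.mul_le_mul_right _ hC
  intro ω ω' hω
  have h1 : ∀ i', dist1 i i' ≤ 1 → ∀ y ∈ box (cen (2*h+1) i') M, (Far ω y K ↔ Far ω' y K) := by
    intro i' hi' y hy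
    have : Far ω y K = Far ω' y K := dependsOn_far y K (fun e he => hω e (by
      have hs : box y (K+1) ⊆ box (cen (2*h+1) i) (C*(2*h+1)) := box_subset (mem_box_trans (cen_mem_box hi') hy) (by omega)
      exact_mod_cast edgesIn_mono hs (by exact_mod_cast he)))
    exact this.to_iff
  have h2 := restr_congr (S := box (cen (2*h+1) i) (C*(2*h+1))) (ω := ω) (ω' := ω') (fun e he => hω e (by exact_mod_cast he))
  simp only [Seed, eq_iff_iff]
  rw [h2]
  refine and_congr ?_ ?_
  · exact exists_congr fun y => and_congr_right fun hy => h1 i (by rw [dist1_self]; omega) y hy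
  · refine forall_congr' fun i' => forall_congr' fun hi' => forall_congr' fun y => forall_congr' fun hy => forall_congr' fun y' => forall_congr' fun hy' => ?_
    rw [h1 i (by rw [dist1_self]; omega) y hy, h1 i' hi' y' hy']

theorem measurableSet_seed {C h M K : ℕ} (hC : 3 ≤ C) (hM : M + K + 1 ≤ h) (i : V d) :
    MeasurableSet {ω : Config d | Seed C h M K ω i} := measurableSet_of_local _ _ (dependsOn_seed hC hM i)

theorem sh_box {v x y : V d} {r : ℕ} : y + v ∈ box (x + v) r ↔ y ∈ box x r := mem_box_add

theorem forall_box_shift {v x : V d} {r : ℕ} {q : V d → Prop} : (∀ y ∈ box (x + v) r, q y) ↔ ∀ y ∈ box x r, q (y + v) := by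
  constructor
  · intro h y hy; exact h _ (mem_box_add.2 hy)
  · intro h y hy
    have := h (y - v) (by rw [← mem_box_add (z := v)]; simpa using hy)
    simpa using this

theorem exists_box_shift {v x : V d} {r : ℕ} {q : V d → Prop} : (∃ y ∈ box (x + v) r, q y) ↔ ∃ y ∈ box x r, q (y + v) := by
  have := forall_box_shift (v := v) (x := x) (r := r) (q := fun y => ¬ q y)
  rw [← not_iff_not]; push Not; exact this

theorem seed_shift {C h M K : ℕ} {ω : Config d} {i j : V d} :
    Seed C h M K (sh (cen (2*h+1) j) ω) i ↔ Seed C h M K ω (i + j) := by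
  simp only [Seed, sh_far, sh_restr, sh_reach, cen_add, exists_box_shift, forall_box_shift]
  refine and_congr_right fun _ => ?_
  constructor
  · intro H i' hi' y hy y' hy' h1 h2
    have e : i' = (i' - j) + j := by simp
    have hd' : dist1 i (i' - j) ≤ 1 := by rw [← dist1_add_right i (i' - j) j]; simpa using hi'
    rw [e, cen_add] at hy'
    have hy2 : y' - cen (2*h+1) j ∈ box (cen (2*h+1) (i'-j)) M := by rw [← mem_box_add (z := cen (2*h+1) j)]; simpa using hy'
    have := H (i' - j) hd' y hy _ hy2 h1 (by simpa using h2)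
    simpa using this
  · intro H i' hi' y hy y' hy' h1 h2
    exact H (i' + j) (by rw [dist1_add_right]; exact hi') y hy _ (by rw [cen_add]; exact mem_box_add.2 hy') h1 h2

theorem seed_prob (F : BernoulliFamily d) {p : ℝ} (h0 : 0 ≤ p) (h1 : p ≤ 1) {C h M K : ℕ} (hC : 3 ≤ C) (hM : M + K + 1 ≤ h) (i : V d) :
    (F.P p).real {ω : Config d | ¬ Seed C h M K ω i} = (F.P p).real {ω : Config d | ¬ Seed C h M K ω 0} := by
  have hm : MeasurableSet {ω : Config d | ¬ Seed C h M K ω 0} := (measurableSet_seed hC hM 0).compl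
  rw [measureReal_def, measureReal_def, ← sh_prob F h0 h1 (cen (2*h+1) i) hm]
  congr 2
  ext ω
  change _ ↔ ¬ Seed C h M K (sh (cen (2*h+1) i) ω) 0
  rw [seed_shift, zero_add]
  rfl

theorem finite_nbrs (x : V d) : {i : V d | dist1 x i ≤ 1}.Finite :=
  (Finset.finite_toSet (box x 1)).subset fun i hi => by simpa using mem_box_of_dist1 hi

theorem exists_seed (F : BernoulliFamily d) {p : ℝ} (hp0 : 0 ≤ p) (hp1 : p ≤ 1) (hUE : UE (F.P p)) {μ : V d → ℝ}
    (hconv : ASTimeConstant (F.P p) μ) :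
    ∃ C : ℕ, 3 ≤ C ∧ ∀ κ : ℝ, 0 < κ → ∃ h M K : ℕ, M + K + 1 ≤ h ∧
      (F.P p).real {ω : Config d | ¬ Seed C h M K ω 0} ≤ κ := by
  have := F.prob p
  set nb := (finite_nbrs (0 : V d)).toFinset with hnb
  have hmem : ∀ i : V d, i ∈ nb ↔ dist1 0 i ≤ 1 := fun i => by simp [hnb]
  obtain ⟨C0, hC0⟩ : ∃ C0 : ℕ, ∀ i ∈ nb, μ i + 1 ≤ C0 := by
    refine ⟨nb.sup (fun i => ⌈μ i + 1⌉₊), fun i hi => (Nat.le_ceil _).trans ?_⟩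
    exact_mod_cast Finset.le_sup (f := fun i => ⌈μ i + 1⌉₊) hi
  refine ⟨C0 + 3, by omega, fun κ hκ => ?_⟩
  set B := (nb.card : ℝ) with hB
  have hBpos : 0 ≤ B := by positivity
  -- choose M
  have hM : Tendsto (fun M : ℕ => (F.P p).real {ω : Config d | ¬ ∃ y ∈ box (0 : V d) M, Inf ω y}) atTop (𝓝 0) := by
    refine ev_small _ (fun n => ?_) ?_
    · refine (MeasurableSet.compl ?_)
      have : {ω : Config d | ∃ y ∈ box (0 : V d) n, Inf ω y} = ⋃ y ∈ box (0 : V d) n, {ω | Inf ω y} := by ext; simp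
      change MeasurableSet {ω : Config d | ∃ y ∈ box (0 : V d) n, Inf ω y}
      rw [this]
      exact Finset.measurableSet_biUnion _ fun y _ => measurableSet_inf y
    · filter_upwards [hUE.2] with ω ⟨y, hy⟩
      filter_upwards [eventually_ge_atTop (dist1 0 y)] with n hn h
      exact h ⟨y, mem_box_of_dist1 hn, hy⟩
  obtain ⟨M, hM⟩ := (hM.eventually (gt_mem_nhds (show (0:ℝ) < κ/4 by linarith))).exists
  -- choose K
  let FN : ℕ → V d → Set (Config d) := fun K c => {ω | ∃ y ∈ box c M, Far ω y K ∧ ¬ Inf ω y}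
  have hFNm : ∀ K c, MeasurableSet (FN K c) := by
    intro K c
    have : FN K c = ⋃ y ∈ box c M, ({ω | Far ω y K} ∩ {ω | Inf ω y}ᶜ) := by
      ext ω; simp only [FN, Set.mem_ofPred_eq, Set.mem_iUnion, Set.mem_inter_iff, Set.mem_compl_iff, exists_prop]
    rw [this]
    exact Finset.measurableSet_biUnion _ fun y _ => (measurableSet_far y K).inter (measurableSet_inf y).compl
  have hK : Tendsto (fun K : ℕ => (F.P p).real (FN K 0)) atTop (𝓝 0) := by
    refine ev_small _ (fun n => hFNm n 0) (Eventually.of_forall fun ω => ?_)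
    have : ∀ᶠ K : ℕ in atTop, ∀ y ∈ box (0 : V d) M, Far ω y K → Inf ω y := by
      rw [Filter.eventually_all_finset]; intro y _
      by_cases hy : Inf ω y
      · exact Eventually.of_forall fun _ _ => hy
      · obtain ⟨K0, hK0⟩ : ∃ K, ¬ Far ω y K := by
          by_contra hh; push Not at hh; exact hy (inf_iff.2 hh)
        filter_upwards [eventually_ge_atTop K0] with K hK hf
        exact absurd (hf.anti hK) hK0
    filter_upwards [this] with K hK ⟨y, hy, h1, h2⟩
    exact h2 (hK y hy h1)
  obtain ⟨K, hK⟩ := (hK.eventually (gt_mem_nhds (show (0:ℝ) < κ/(4*(B+1)) by positivity))).exists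
  have hFNsh : ∀ c, (F.P p).real (FN K c) = (F.P p).real (FN K 0) := by
    intro c
    rw [measureReal_def, measureReal_def, ← sh_prob F hp0 hp1 c (hFNm K 0)]
    congr 2
    ext ω
    simp only [FN, Set.mem_ofPred_eq, sh_inf, sh_far]
    have := exists_box_shift (v := c) (x := (0 : V d)) (r := M) (q := fun y => Far ω y K ∧ ¬ Inf ω y)
    rw [zero_add] at this
    exact this
  -- choose N
  let HB : ℕ → V d → Set (Config d) := fun n x => {ω | ∃ y ∈ box (0 : V d) M, ∃ y' ∈ box (n • x) M, Inf ω y ∧ Inf ω y' ∧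
      1 * (n:ℝ) < |(chemDist ω y y').toReal - μ x * n|}
  have hN : ∀ᶠ n : ℕ in atTop, ∀ x ∈ nb, (F.P p).real (HB n x) < κ/(4*(B+1)) := by
    rw [Filter.eventually_all_finset]; intro x _
    exact (H_lemma F hp0 hp1 hUE hconv x M one_pos).eventually (gt_mem_nhds (by positivity))
  obtain ⟨n0, hn0⟩ := eventually_atTop.1 hN
  set h := max n0 (M + K + 1) with hh
  have hhM : M + K + 1 ≤ h := le_max_right _ _
  refine ⟨h, M, K, hhM, ?_⟩
  have hNb := hn0 (2*h+1) (by have := le_max_left n0 (M+K+1); omega)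
  set N := 2*h+1 with hNdef
  -- the inclusion
  have hsub : {ω : Config d | ¬ Seed (C0+3) h M K ω 0} ≤ᵐ[F.P p]
      ({ω : Config d | ¬ ∃ y ∈ box (0 : V d) M, Inf ω y} ∪ (FN K 0 ∪ ((⋃ i ∈ nb, FN K (cen N i)) ∪ (⋃ i ∈ nb, HB N i))) : Set (Config d)) := by
    filter_upwards [hUE.1] with ω hω hbad
    by_contra hnot
    replace hnot : ω ∉ ({ω : Config d | ¬ ∃ y ∈ box (0 : V d) M, Inf ω y} ∪ (FN K 0 ∪ ((⋃ i ∈ nb, FN K (cen N i)) ∪ (⋃ i ∈ nb, HB N i))) : Set (Config d)) := hnot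
    simp only [Set.mem_union, not_or] at hnot
    obtain ⟨hE, hF0, hFi, hHi⟩ := hnot
    obtain ⟨y0, hy0, hi0⟩ := not_not.1 hE
    simp only [Set.mem_iUnion, not_exists] at hFi hHi
    apply hbad
    unfold Seed
    rw [cen_zero]
    refine ⟨⟨y0, hy0, inf_iff.1 hi0 K⟩, ?_⟩
    intro i hi y hy y' hy' hfy hfy'
    have hin := (hmem i).2 hi
    have hiy : Inf ω y := by by_contra hc; exact hF0 ⟨y, hy, hfy, hc⟩
    have hiy' : Inf ω y' := by by_contra hc; exact hFi i hin ⟨y', hy', hfy', hc⟩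
    have hch : ¬ (1 * (N:ℝ) < |(chemDist ω y y').toReal - μ i * N|) := fun hc =>
      hHi i hin ⟨y, hy, y', by rw [← cen_nsmul]; exact hy', hiy, hiy', hc⟩
    push Not at hch
    obtain ⟨w, hw⟩ := exists_walk_chemDist (hω _ _ hiy hiy')
    rw [← hw] at hch
    simp only [ENNReal.toReal_natCast] at hch
    have hlen : w.length ≤ C0 * N := by
      have h1 := (abs_le.1 hch).2
      have h2 := hC0 i hin
      have h3 : (w.length : ℝ) ≤ C0 * N := by nlinarith [(Nat.cast_nonneg N : (0:ℝ) ≤ N)]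
      exact_mod_cast h3
    obtain ⟨w', _, _⟩ := restr_walk (S := (box (0 : V d) ((C0+3)*N) : Set (V d))) w (fun z hz => by
      have h1 := mem_box_of_dist1 ((dist1_le_of_mem_support w hz).trans hlen)
      have h2 := box_mono (show M + C0*N ≤ (C0+3)*N by rw [add_mul]; omega) (mem_box_trans hy h1)
      exact_mod_cast h2)
    exact ⟨w'⟩
  have hbound : (F.P p).real {ω : Config d | ¬ Seed (C0+3) h M K ω 0} ≤
      (F.P p).real {ω : Config d | ¬ ∃ y ∈ box (0 : V d) M, Inf ω y} + ((F.P p).real (FN K 0) + (∑ i ∈ nb, (F.P p).real (FN K (cen N i)) + ∑ i ∈ nb, (F.P p).real (HB N i))) := by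
    refine (ENNReal.toReal_mono (measure_ne_top _ _) (measure_mono_ae hsub)).trans ?_
    refine (measureReal_union_le _ _).trans (add_le_add le_rfl ((measureReal_union_le _ _).trans (add_le_add le_rfl ((measureReal_union_le _ _).trans (add_le_add ?_ ?_)))))
    · exact measureReal_biUnion_finset_le _ _
    · exact measureReal_biUnion_finset_le _ _
  have s1 : ∑ i ∈ nb, (F.P p).real (FN K (cen N i)) ≤ B * (κ/(4*(B+1))) := by
    rw [hB, ← nsmul_eq_mul]
    exact Finset.sum_le_card_nsmul _ _ _ fun i _ => by rw [hFNsh]; exact hK.le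
  have s2 : ∑ i ∈ nb, (F.P p).real (HB N i) ≤ B * (κ/(4*(B+1))) := by
    rw [hB, ← nsmul_eq_mul]
    exact Finset.sum_le_card_nsmul _ _ _ fun i hi => (hNb i hi).le
  have s3 : B * (κ/(4*(B+1))) ≤ κ/4 := by
    rw [mul_div_assoc', div_le_div_iff₀ (by positivity) (by norm_num)]; nlinarith
  have s4 : κ/(4*(B+1)) ≤ κ/4 := by
    rw [div_le_div_iff₀ (by positivity) (by norm_num)]; nlinarith
  linarith
end Perco

namespace Perco
variable {d : ℕ}

/-! ### Deterministic hierarchy of good sites -/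
def win (ℓ : ℕ) (j : V d) : Set (V d) := {a | ∀ κ, (ℓ:ℤ) * j κ - ℓ ≤ a κ ∧ a κ < ℓ * j κ + 2 * ℓ}

def good (g : V d → Prop) (ℓ s : ℕ) : ℕ → V d → Prop
  | 0, j => g j
  | k+1, j => ∀ a ∈ win ℓ j, ∀ b ∈ win ℓ j, ¬ good g ℓ s k a → ¬ good g ℓ s k b → ∀ κ, |a κ - b κ| ≤ s

def unexcl (g : V d → Prop) (ℓ s k : ℕ) (j a : V d) : Prop :=
  a ∈ win ℓ j ∧ ∃ κ, ∀ b ∈ win ℓ j, ¬ good g ℓ s k b → a κ ≠ b κ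

def Core (g : V d → Prop) (ℓ s : ℕ) : ℕ → V d → Set (V d)
  | 0, j => {j}
  | k+1, j => {i | ∃ a, unexcl g ℓ s k j a ∧ i ∈ Core g ℓ s k a}

/-- one step between neighbouring good sites inside `S` -/
def stp (g : V d → Prop) (S : Set (V d)) (i i' : V d) : Prop := dist1 i i' ≤ 1 ∧ g i ∧ g i' ∧ i ∈ S ∧ i' ∈ S

def Jn (g : V d → Prop) (S : Set (V d)) : V d → V d → Prop := Relation.ReflTransGen (stp g S)

theorem Jn.symm' {g : V d → Prop} {S : Set (V d)} {i i' : V d} (h : Jn g S i i') : Jn g S i' i := by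
  induction h with
  | refl => exact Relation.ReflTransGen.refl
  | tail _ hab ih =>
    exact Relation.ReflTransGen.head ⟨by rw [dist1_comm]; exact hab.1, hab.2.2.1, hab.2.1, hab.2.2.2.2, hab.2.2.2.1⟩ ih

theorem Jn.mono' {g : V d → Prop} {S T : Set (V d)} (hST : S ⊆ T) {i i' : V d} (h : Jn g S i i') : Jn g T i i' := by
  induction h with
  | refl => exact Relation.ReflTransGen.refl
  | tail _ hab ih =>
    exact Relation.ReflTransGen.tail ih ⟨hab.1, hab.2.1, hab.2.2.1, hST hab.2.2.2.1, hST hab.2.2.2.2⟩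

def Rg (ℓ k : ℕ) (j : V d) : Set (V d) := {i | ∀ κ, |i κ - (ℓ:ℤ)^k * j κ| ≤ 3 * (ℓ:ℤ)^k}

theorem unexcl_good {g : V d → Prop} {ℓ s k : ℕ} {j a : V d} (h : unexcl g ℓ s k j a) : good g ℓ s k a := by
  by_contra hb
  obtain ⟨hw, κ, hκ⟩ := h
  exact hκ a hw hb rfl

theorem Rg_sub {ℓ k : ℕ} (hℓ : 3 ≤ ℓ) {j a : V d} (h : a ∈ win ℓ j) : Rg ℓ k a ⊆ Rg ℓ (k+1) j := by
  intro i hi κ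
  have h1 := hi κ
  have h2 := h κ
  have h3 : |(ℓ:ℤ)^k * a κ - (ℓ:ℤ)^(k+1) * j κ| ≤ 2 * (ℓ:ℤ)^(k+1) := by
    have : (ℓ:ℤ)^k * a κ - (ℓ:ℤ)^(k+1) * j κ = (ℓ:ℤ)^k * (a κ - ℓ * j κ) := by ring
    rw [this, abs_mul, abs_of_nonneg (by positivity)]
    have h4 : |a κ - ℓ * j κ| ≤ 2 * ℓ := by rw [abs_le]; constructor <;> linarith [h2.1, h2.2, (Nat.cast_nonneg ℓ : (0:ℤ) ≤ ℓ)]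
    calc (ℓ:ℤ)^k * |a κ - ℓ * j κ| ≤ (ℓ:ℤ)^k * (2 * ℓ) := mul_le_mul_of_nonneg_left h4 (by positivity)
      _ = 2 * (ℓ:ℤ)^(k+1) := by ring
  have h5 : 3 * (ℓ:ℤ)^k ≤ (ℓ:ℤ)^(k+1) := by
    rw [pow_succ, mul_comm]; exact mul_le_mul_of_nonneg_left (by exact_mod_cast hℓ) (by positivity)
  calc |i κ - (ℓ:ℤ)^(k+1) * j κ| = |(i κ - (ℓ:ℤ)^k * a κ) + ((ℓ:ℤ)^k * a κ - (ℓ:ℤ)^(k+1) * j κ)| := by ring_nf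
    _ ≤ _ := abs_add_le _ _
    _ ≤ _ := by linarith

theorem Core_sub_Rg {g : V d → Prop} {ℓ s : ℕ} (hℓ : 3 ≤ ℓ) : ∀ k (j : V d), Core g ℓ s k j ⊆ Rg ℓ k j := by
  intro k
  induction k with
  | zero => intro j i hi κ; simp only [Core, Set.mem_singleton_iff] at hi; subst hi; simp
  | succ k ih =>
    rintro j i ⟨a, ha, hi⟩
    exact Rg_sub hℓ ha.1 (ih a hi)

theorem Core_good {g : V d → Prop} {ℓ s : ℕ} : ∀ k (j : V d), good g ℓ s k j → ∀ i ∈ Core g ℓ s k j, g i := by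
  intro k
  induction k with
  | zero => intro j hj i hi; simp only [Core, Set.mem_singleton_iff] at hi; subst hi; exact hj
  | succ k ih =>
    rintro j hj i ⟨a, ha, hi⟩
    exact ih a (unexcl_good ha) i hi

theorem good_congr {g g' : V d → Prop} {ℓ s : ℕ} (hℓ : 3 ≤ ℓ) : ∀ k (j : V d), (∀ i ∈ Rg ℓ k j, g i ↔ g' i) →
    (good g ℓ s k j ↔ good g' ℓ s k j) := by
  intro k
  induction k with
  | zero => intro j h; exact h j (fun κ => by simp)
  | succ k ih =>
    intro j h
    have h1 : ∀ a ∈ win ℓ j, (good g ℓ s k a ↔ good g' ℓ s k a) := fun a ha => ih a fun i hi => h i (Rg_sub hℓ ha hi)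
    simp only [good]
    refine forall_congr' fun a => forall_congr' fun ha => forall_congr' fun b => forall_congr' fun hb => ?_
    rw [h1 a ha, h1 b hb]

/-- a monotone chain between two points -/
theorem mono_chain {g : V d → Prop} {S : Set (V d)} (n : ℕ) : ∀ u v : V d, dist1 u v = n →
    (∀ z : V d, (∀ κ, min (u κ) (v κ) ≤ z κ ∧ z κ ≤ max (u κ) (v κ)) → g z ∧ z ∈ S) → Jn g S u v := by
  induction n with
  | zero => intro u v h _; obtain rfl := dist1_eq_zero h; exact Relation.ReflTransGen.refl
  | succ n ih =>
    intro u v h hz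
    have hne : u ≠ v := by rintro rfl; rw [dist1_self] at h; omega
    obtain ⟨u', h1, h2, h3⟩ := exists_step hne
    have hu := hz u (fun κ => ⟨min_le_left _ _, le_max_left _ _⟩)
    have hb : ∀ κ, min (u κ) (v κ) ≤ u' κ ∧ u' κ ≤ max (u κ) (v κ) := h3
    have hu' := hz u' hb
    refine Relation.ReflTransGen.head (⟨h1.le, hu.1, hu'.1, hu.2, hu'.2⟩ : stp g S u u') (ih u' v (by omega) fun z hzz => hz z fun κ => ?_)
    have := hzz κ
    have := hb κ
    constructor
    · exact (le_min this.1 (min_le_right _ _)).trans (hzz κ).1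
    · exact (hzz κ).2.trans (max_le this.2 (le_max_right _ _))

theorem exists_hub {g : V d → Prop} {ℓ s k : ℕ} (hs : s + 17 ≤ ℓ) {j : V d} (hj : good g ℓ s (k+1) j) :
    ∃ h ∈ win ℓ j, ∀ κ, ∀ b ∈ win ℓ j, ¬ good g ℓ s k b → h κ ≠ b κ := by
  have : ∀ κ, ∃ v : ℤ, (ℓ:ℤ) * j κ - ℓ ≤ v ∧ v < ℓ * j κ + 2 * ℓ ∧ ∀ b ∈ win ℓ j, ¬ good g ℓ s k b → v ≠ b κ := by
    intro κ
    by_contra hcon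
    push Not at hcon
    obtain ⟨b1, hb1, hg1, e1⟩ := hcon ((ℓ:ℤ) * j κ - ℓ) le_rfl (by linarith [(by omega : (0:ℤ) < ℓ)])
    obtain ⟨b2, hb2, hg2, e2⟩ := hcon ((ℓ:ℤ) * j κ + 2 * ℓ - 1) (by linarith [(by omega : (0:ℤ) < ℓ)]) (by linarith)
    have := hj b1 hb1 b2 hb2 hg1 hg2 κ
    rw [← e1, ← e2, abs_le] at this
    have := this.1
    have : (s:ℤ) + 17 ≤ ℓ := by exact_mod_cast hs
    linarith
  choose h h1 h2 h3 using this
  exact ⟨h, fun κ => ⟨h1 κ, h2 κ⟩, fun κ b hb hg => h3 κ b hb hg⟩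

theorem win_between {ℓ : ℕ} {j u v z : V d} (hu : u ∈ win ℓ j) (hv : v ∈ win ℓ j)
    (hz : ∀ κ, min (u κ) (v κ) ≤ z κ ∧ z κ ≤ max (u κ) (v κ)) : z ∈ win ℓ j := by
  intro κ
  exact ⟨(le_min (hu κ).1 (hv κ).1).trans (hz κ).1, (hz κ).2.trans_lt (max_lt (hu κ).2 (hv κ).2)⟩

/-- every non excluded site is joined to the hub inside the window -/
theorem join_hub (hd : 2 ≤ d) {g : V d → Prop} {ℓ s k : ℕ} {j : V d} {h a : V d} (hw : h ∈ win ℓ j)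
    (hh : ∀ κ, ∀ b ∈ win ℓ j, ¬ good g ℓ s k b → h κ ≠ b κ) (ha : unexcl g ℓ s k j a) :
    Jn (good g ℓ s k) (win ℓ j) a h := by
  classical
  obtain ⟨haw, κ, hκ⟩ := ha
  let a' : V d := Function.update h κ (a κ)
  have ha' : a' ∈ win ℓ j := by
    intro l
    by_cases hl : l = κ
    · subst hl; simp only [a', Function.update_self]; exact haw l
    · simp only [a', Function.update_of_ne hl]; exact hw l
  have c1 : Jn (good g ℓ s k) (win ℓ j) a a' := by
    refine mono_chain _ _ _ rfl fun z hz => ?_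
    have hzw := win_between haw ha' hz
    refine ⟨unexcl_good ⟨hzw, κ, fun b hb hg => ?_⟩, hzw⟩
    have := hz κ
    simp only [a', Function.update_self, min_self, max_self] at this
    have : z κ = a κ := le_antisymm this.2 this.1
    rw [this]; exact hκ b hb hg
  obtain ⟨l, hl⟩ : ∃ l : Fin d, l ≠ κ := by
    have : Nontrivial (Fin d) := Fin.nontrivial_iff_two_le.2 hd
    exact exists_ne κ
  have c2 : Jn (good g ℓ s k) (win ℓ j) a' h := by
    refine mono_chain _ _ _ rfl fun z hz => ?_
    have hzw := win_between ha' hw hz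
    refine ⟨unexcl_good ⟨hzw, l, fun b hb hg => ?_⟩, hzw⟩
    have := hz l
    simp only [a', Function.update_of_ne hl, min_self, max_self] at this
    have : z l = h l := le_antisymm this.2 this.1
    rw [this]; exact hh l b hb hg
  exact c1.trans c2

theorem hub_unexcl (hd : 2 ≤ d) {g : V d → Prop} {ℓ s k : ℕ} {j : V d} {h : V d} (hw : h ∈ win ℓ j)
    (hh : ∀ κ, ∀ b ∈ win ℓ j, ¬ good g ℓ s k b → h κ ≠ b κ) : unexcl g ℓ s k j h :=
  ⟨hw, ⟨0, by omega⟩, hh _⟩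

theorem Core_nonempty (hd : 2 ≤ d) {g : V d → Prop} {ℓ s : ℕ} (hs : s + 17 ≤ ℓ) : ∀ k (j : V d), good g ℓ s k j → (Core g ℓ s k j).Nonempty := by
  intro k
  induction k with
  | zero => intro j _; exact ⟨j, rfl⟩
  | succ k ih =>
    intro j hj
    obtain ⟨h, hw, hh⟩ := exists_hub hs hj
    have hu := hub_unexcl hd hw hh
    obtain ⟨i, hi⟩ := ih h (unexcl_good hu)
    exact ⟨i, h, hu, hi⟩

/-- common non excluded site of two neighbouring windows -/
theorem exists_common (hd : 2 ≤ d) {g : V d → Prop} {ℓ s k : ℕ} (hs : s + 17 ≤ ℓ) {j j' : V d} (hjj : dist1 j j' ≤ 1)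
    (hj : good g ℓ s (k+1) j) (hj' : good g ℓ s (k+1) j') : ∃ a, unexcl g ℓ s k j a ∧ unexcl g ℓ s k j' a := by
  classical
  let lo : V d := fun κ => (ℓ:ℤ) * max (j κ) (j' κ) - ℓ
  have hcl : ∀ κ, max (j κ) (j' κ) ≤ j κ + 1 ∧ max (j κ) (j' κ) ≤ j' κ + 1 := by
    intro κ
    have h1 := coord_le_dist1 j j' κ
    have h2 : |j κ - j' κ| ≤ 1 := h1.trans (by exact_mod_cast hjj)
    rw [abs_le] at h2
    constructor <;> simp only [max_le_iff] <;> constructor <;> linarith [h2.1, h2.2]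
  have hsZ : (s:ℤ) + 17 ≤ ℓ := by exact_mod_cast hs
  have hin : ∀ z : V d, (∀ κ, lo κ ≤ z κ ∧ z κ < lo κ + 2 * ℓ) → z ∈ win ℓ j ∧ z ∈ win ℓ j' := by
    intro z hz
    have hl0 : (0:ℤ) ≤ ℓ := by positivity
    constructor <;> intro κ <;> have h1 := hz κ <;> have h2 := hcl κ <;> simp only [lo] at h1
    · have := mul_le_mul_of_nonneg_left (le_max_left (j κ) (j' κ)) hl0
      have := mul_le_mul_of_nonneg_left h2.1 hl0
      constructor <;> linarith [h1.1, h1.2]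
    · have := mul_le_mul_of_nonneg_left (le_max_right (j κ) (j' κ)) hl0
      have := mul_le_mul_of_nonneg_left h2.2 hl0
      constructor <;> linarith [h1.1, h1.2]
  let κ : Fin d := ⟨0, by omega⟩
  obtain ⟨v, hv1, hv2, hv3, hv4⟩ : ∃ v : ℤ, lo κ ≤ v ∧ v < lo κ + 2 * ℓ ∧ (∀ b ∈ win ℓ j, ¬ good g ℓ s k b → v ≠ b κ) ∧
      (∀ b ∈ win ℓ j', ¬ good g ℓ s k b → v ≠ b κ) := by
    by_contra hcon
    have key : ∀ v : ℤ, lo κ ≤ v → v < lo κ + 2 * ℓ → (∃ b ∈ win ℓ j, ¬ good g ℓ s k b ∧ v = b κ) ∨ (∃ b ∈ win ℓ j', ¬ good g ℓ s k b ∧ v = b κ) := by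
      intro v h1 h2
      by_contra hn
      push Not at hn
      exact hcon ⟨v, h1, h2, hn.1, hn.2⟩
    have A : ∀ u v : ℤ, (s:ℤ) + 1 ≤ v - u → (∃ b ∈ win ℓ j, ¬ good g ℓ s k b ∧ u = b κ) → (∃ b ∈ win ℓ j, ¬ good g ℓ s k b ∧ v = b κ) → False := by
      rintro u v huv ⟨b, hb, hg, rfl⟩ ⟨b', hb', hg', rfl⟩
      have := (abs_le.1 (hj b hb b' hb' hg hg' κ)).1
      linarith
    have B : ∀ u v : ℤ, (s:ℤ) + 1 ≤ v - u → (∃ b ∈ win ℓ j', ¬ good g ℓ s k b ∧ u = b κ) → (∃ b ∈ win ℓ j', ¬ good g ℓ s k b ∧ v = b κ) → False := by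
      rintro u v huv ⟨b, hb, hg, rfl⟩ ⟨b', hb', hg', rfl⟩
      have := (abs_le.1 (hj' b hb b' hb' hg hg' κ)).1
      linarith
    have k1 := key (lo κ) le_rfl (by linarith)
    have k2 := key (lo κ + (s+1)) (by linarith) (by linarith)
    have k3 := key (lo κ + (2*s+2)) (by linarith) (by linarith)
    rcases k1 with k1 | k1 <;> rcases k2 with k2 | k2 <;> rcases k3 with k3 | k3
    · exact A _ _ (by linarith) k1 k2
    · exact A _ _ (by linarith) k1 k2
    · exact A _ _ (by linarith) k1 k3
    · exact B _ _ (by linarith) k2 k3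
    · exact A _ _ (by linarith) k2 k3
    · exact B _ _ (by linarith) k1 k3
    · exact B _ _ (by linarith) k1 k2
    · exact B _ _ (by linarith) k1 k2
  obtain ⟨w1, w2⟩ := hin (Function.update lo κ v) (fun l => by
    by_cases hl : l = κ
    · subst hl; simp only [Function.update_self]; exact ⟨hv1, hv2⟩
    · simp only [Function.update_of_ne hl]; exact ⟨le_rfl, by linarith⟩)
  exact ⟨_, ⟨w1, κ, fun b hb hg => by simp only [Function.update_self]; exact hv3 b hb hg⟩,
    ⟨w2, κ, fun b hb hg => by simp only [Function.update_self]; exact hv4 b hb hg⟩⟩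

theorem core_joined (hd : 2 ≤ d) {g : V d → Prop} {ℓ s : ℕ} (hs : s + 17 ≤ ℓ) : ∀ k,
    (∀ j : V d, good g ℓ s k j → ∀ i ∈ Core g ℓ s k j, ∀ i' ∈ Core g ℓ s k j, Jn g (Rg ℓ k j) i i') ∧
    (∀ j j' : V d, dist1 j j' ≤ 1 → good g ℓ s k j → good g ℓ s k j' →
      ∀ i ∈ Core g ℓ s k j, ∀ i' ∈ Core g ℓ s k j', Jn g (Rg ℓ k j ∪ Rg ℓ k j') i i') := by
  have hℓ : 3 ≤ ℓ := by omega
  intro k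
  induction k with
  | zero =>
    constructor
    · rintro j _ i hi i' hi'
      simp only [Core, Set.mem_singleton_iff] at hi hi'; subst hi; subst hi'; exact Relation.ReflTransGen.refl
    · rintro j j' h hj hj' i hi i' hi'
      simp only [Core, Set.mem_singleton_iff] at hi hi'; subst hi; subst hi'
      exact Relation.ReflTransGen.single ⟨h, hj, hj', Or.inl (fun κ => by simp), Or.inr (fun κ => by simp)⟩
  | succ k ih =>
    obtain ⟨ih1, ih2⟩ := ih
    have chain : ∀ j a b : V d, Jn (good g ℓ s k) (win ℓ j) a b → a ∈ win ℓ j → good g ℓ s k a →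
        ∀ i ∈ Core g ℓ s k a, ∀ i' ∈ Core g ℓ s k b, Jn g (Rg ℓ (k+1) j) i i' := by
      intro j a b hab haw hga
      induction hab with
      | refl => intro i hi i' hi'; exact (ih1 a hga i hi i' hi').mono' (Rg_sub hℓ haw)
      | tail hab hbc ihc =>
        rename_i b c
        intro i hi i' hi'
        obtain ⟨i0, hi0⟩ := Core_nonempty hd hs k b hbc.2.1
        refine (ihc i hi i0 hi0).trans ?_
        exact (ih2 b c hbc.1 hbc.2.1 hbc.2.2.1 i0 hi0 i' hi').mono' (Set.union_subset (Rg_sub hℓ hbc.2.2.2.1) (Rg_sub hℓ hbc.2.2.2.2))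
    have c1 : ∀ j : V d, good g ℓ s (k+1) j → ∀ i ∈ Core g ℓ s (k+1) j, ∀ i' ∈ Core g ℓ s (k+1) j, Jn g (Rg ℓ (k+1) j) i i' := by
      rintro j hj i ⟨a, ha, hi⟩ i' ⟨a', ha', hi'⟩
      obtain ⟨h, hw, hh⟩ := exists_hub hs hj
      exact chain j a a' ((join_hub hd hw hh ha).trans (join_hub hd hw hh ha').symm') ha.1 (unexcl_good ha) i hi i' hi'
    refine ⟨c1, ?_⟩
    intro j j' hjj hj hj' i hi i' hi'
    obtain ⟨a, ha, ha'⟩ := exists_common hd hs hjj hj hj'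
    obtain ⟨i0, hi0⟩ := Core_nonempty hd hs k a (unexcl_good ha)
    exact ((c1 j hj i hi i0 ⟨a, ha, hi0⟩).mono' Set.subset_union_left).trans ((c1 j' hj' i0 ⟨a, ha', hi0⟩ i' hi').mono' Set.subset_union_right)
end Perco

namespace Perco
variable {d : ℕ}

/-! ### Crossing paths visit many core sites -/
def st (ℓ k : ℕ) (i : V d) : V d := fun κ => i κ / (ℓ:ℤ)^k

theorem st_zero (ℓ : ℕ) (i : V d) : st ℓ 0 i = i := by funext κ; simp [st]

theorem st_succ (ℓ k : ℕ) (i : V d) (κ : Fin d) : st ℓ (k+1) i κ = st ℓ k i κ / ℓ := by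
  simp only [st]
  rw [pow_succ, Int.ediv_ediv_of_nonneg (by positivity)]

theorem ediv_near {a b m c : ℤ} (hm : 0 < m) (hab : |a - b| ≤ c * m) : |a / m - b / m| ≤ c := by
  rw [abs_le] at hab ⊢
  have h1 := Int.mul_ediv_add_emod a m
  have h2 := Int.mul_ediv_add_emod b m
  have h3 := Int.emod_nonneg a hm.ne'
  have h4 := Int.emod_nonneg b hm.ne'
  have h5 := Int.emod_lt_of_pos a hm
  have h6 := Int.emod_lt_of_pos b hm
  constructor
  · by_contra hc
    push Not at hc
    nlinarith
  · by_contra hc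
    push Not at hc
    nlinarith

theorem st_near {ℓ k : ℕ} (hℓ : 0 < ℓ) {i i' : V d} {κ : Fin d} (h : |i κ - i' κ| ≤ 1) : |st ℓ k i κ - st ℓ k i' κ| ≤ 1 := by
  have : (0:ℤ) < (ℓ:ℤ)^k := by positivity
  exact ediv_near this (by linarith)

theorem int_ivt (φ : ℕ → ℤ) (n : ℕ) (h : ∀ t < n, |φ (t+1) - φ t| ≤ 1) {y : ℤ} (h0 : φ 0 ≤ y) (hn : y < φ n) :
    ∃ t < n, φ t = y := by
  induction n with
  | zero => omega
  | succ n ih =>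
    by_cases hy : y < φ n
    · obtain ⟨t, ht, e⟩ := ih (fun t ht => h t (by omega)) hy
      exact ⟨t, by omega, e⟩
    · have := h n (by omega)
      rw [abs_le] at this
      exact ⟨n, by omega, by omega⟩

theorem cross_step {g : V d → Prop} {ℓ s k : ℕ} (hs : s + 17 ≤ ℓ) 
    (ih : ∀ (j : V d) (f : ℕ → V d) n, (∀ t < n, ∀ κ, |f (t+1) κ - f t κ| ≤ 1) → st ℓ k (f 0) = j →
      (∃ κ, 1 < |st ℓ k (f n) κ - j κ|) → good g ℓ s k j →
      ∃ T : Finset (V d), 2^k ≤ T.card ∧ ∀ i ∈ T, i ∈ Core g ℓ s k j ∧ ∃ t ≤ n, f t = i)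
    (j : V d) (f : ℕ → V d) (n : ℕ) (hf : ∀ t < n, ∀ κ, |f (t+1) κ - f t κ| ≤ 1)
    (hin : ∀ t < n, st ℓ k (f t) ∈ win ℓ j) (hj : good g ℓ s (k+1) j) (κ : Fin d) (ψ : ℤ → ℤ)
    (hψ : ∀ a b, |ψ a - ψ b| = |a - b|) (h0 : ψ (st ℓ k (f 0) κ) < ℓ) (hn : 2 * ℓ ≤ ψ (st ℓ k (f n) κ)) :
    ∃ T : Finset (V d), 2^(k+1) ≤ T.card ∧ ∀ i ∈ T, i ∈ Core g ℓ s (k+1) j ∧ ∃ t ≤ n, f t = i := by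
  classical
  have hy : ∃ y : ℤ, ℓ ≤ y ∧ y + 7 ≤ 2 * ℓ - 2 ∧ (∀ b ∈ win ℓ j, ¬ good g ℓ s k b → y ≠ ψ (b κ)) ∧
      (∀ b ∈ win ℓ j, ¬ good g ℓ s k b → y + 7 ≠ ψ (b κ)) := by
    by_contra hcon
    push Not at hcon
    have hb : ∀ y : ℤ, ℓ ≤ y → y + 7 ≤ 2 * ℓ - 2 → ∃ b ∈ win ℓ j, ¬ good g ℓ s k b ∧ (ψ (b κ) = y ∨ ψ (b κ) = y + 7) := by
      intro y h1 h2
      by_cases h3 : ∀ b ∈ win ℓ j, ¬ good g ℓ s k b → y ≠ ψ (b κ)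
      · obtain ⟨b, hb, hg, e⟩ := hcon y h1 h2 h3
        exact ⟨b, hb, hg, Or.inr e.symm⟩
      · push Not at h3
        obtain ⟨b, hb, hg, e⟩ := h3
        exact ⟨b, hb, hg, Or.inl e.symm⟩
    obtain ⟨b1, hb1, hg1, e1⟩ := hb ℓ le_rfl (by omega)
    obtain ⟨b2, hb2, hg2, e2⟩ := hb (ℓ + s + 8) (by omega) (by omega)
    have h1 := hj b1 hb1 b2 hb2 hg1 hg2 κ
    rw [← hψ, abs_le] at h1
    omega
  obtain ⟨y, hy1, hy2, hy3, hy4⟩ := hy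
  have key : ∀ y : ℤ, ℓ ≤ y → y ≤ 2 * ℓ - 2 → (∀ b ∈ win ℓ j, ¬ good g ℓ s k b → y ≠ ψ (b κ)) →
      ∃ a, unexcl g ℓ s k j a ∧ ψ (a κ) = y ∧ ∃ T : Finset (V d), 2^k ≤ T.card ∧ ∀ i ∈ T, i ∈ Core g ℓ s k a ∧ ∃ t ≤ n, f t = i := by
    intro y h1 h2 h3
    obtain ⟨t, ht, e⟩ := int_ivt (fun t => ψ (st ℓ k (f t) κ)) n (fun t ht => by
      rw [hψ]; exact st_near (by omega) (hf t ht κ)) (y := y) (by omega) (by omega)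
    have hun : unexcl g ℓ s k j (st ℓ k (f t)) := ⟨hin t ht, κ, fun b hb hg he => h3 b hb hg (by rw [← e, he])⟩
    refine ⟨_, hun, e, ?_⟩
    obtain ⟨T, hT, hT'⟩ := ih (st ℓ k (f t)) (fun r => f (t + r)) (n - t) (fun r hr κ' => hf (t + r) (by omega) κ') rfl
      ⟨κ, by
        have : t + (n - t) = n := by omega
        simp only [this]
        rw [← hψ, e]
        exact lt_of_lt_of_le (by omega) (le_abs_self _)⟩ (unexcl_good hun)
    refine ⟨T, hT, fun i hi => ⟨(hT' i hi).1, ?_⟩⟩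
    obtain ⟨r, hr, e⟩ := (hT' i hi).2
    exact ⟨t + r, by omega, e⟩
  obtain ⟨a1, hu1, e1, T1, hT1, hT1'⟩ := key y hy1 (by omega) hy3
  obtain ⟨a2, hu2, e2, T2, hT2, hT2'⟩ := key (y+7) (by omega) (by omega) hy4
  have hdis : Disjoint T1 T2 := by
    rw [Finset.disjoint_left]
    intro i hi1 hi2
    have r1 := Core_sub_Rg (by omega) k a1 (hT1' i hi1).1 κ
    have r2 := Core_sub_Rg (by omega) k a2 (hT2' i hi2).1 κ
    have h7 : |a1 κ - a2 κ| = 7 := by rw [← hψ, e1, e2]; rw [show y - (y+7) = -7 by ring]; rfl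
    have hpos : (0:ℤ) < (ℓ:ℤ)^k := by have : 0 < ℓ := by omega
                                      positivity
    have h8 : |(ℓ:ℤ)^k * a1 κ - (ℓ:ℤ)^k * a2 κ| = 7 * (ℓ:ℤ)^k := by
      rw [← mul_sub, abs_mul, h7, abs_of_pos hpos, mul_comm]
    have h9 : |(ℓ:ℤ)^k * a1 κ - (ℓ:ℤ)^k * a2 κ| ≤ |i κ - (ℓ:ℤ)^k * a1 κ| + |i κ - (ℓ:ℤ)^k * a2 κ| := by
      have := abs_sub_le ((ℓ:ℤ)^k * a1 κ) (i κ) ((ℓ:ℤ)^k * a2 κ)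
      rwa [abs_sub_comm _ (i κ)] at this
    linarith
  refine ⟨T1 ∪ T2, ?_, ?_⟩
  · rw [Finset.card_union_of_disjoint hdis, pow_succ]; omega
  · intro i hi
    rcases Finset.mem_union.1 hi with hi | hi
    · exact ⟨⟨a1, hu1, (hT1' i hi).1⟩, (hT1' i hi).2⟩
    · exact ⟨⟨a2, hu2, (hT2' i hi).1⟩, (hT2' i hi).2⟩

theorem mem_win_iff {ℓ : ℕ} (hℓ : 0 < ℓ) {j a : V d} : a ∈ win ℓ j ↔ ∀ κ, |a κ / ℓ - j κ| ≤ 1 := by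
  have hl : (0:ℤ) < ℓ := by exact_mod_cast hℓ
  refine forall_congr' fun κ => ?_
  rw [abs_le]
  constructor
  · rintro ⟨h1, h2⟩
    constructor
    · have : j κ - 1 ≤ a κ / ℓ := by rw [Int.le_ediv_iff_mul_le hl]; linarith
      omega
    · have : a κ / ℓ < j κ + 2 := by rw [Int.ediv_lt_iff_lt_mul hl]; linarith
      omega
  · rintro ⟨h1, h2⟩
    constructor
    · have : j κ - 1 ≤ a κ / ℓ := by omega
      rw [Int.le_ediv_iff_mul_le hl] at this; linarith
    · have : a κ / ℓ < j κ + 2 := by omega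
      rw [Int.ediv_lt_iff_lt_mul hl] at this; linarith

theorem cross {g : V d → Prop} {ℓ s : ℕ} (hs : s + 17 ≤ ℓ) (k : ℕ) :
   ∀ (j : V d) (f : ℕ → V d) n, (∀ t < n, ∀ κ, |f (t+1) κ - f t κ| ≤ 1) → st ℓ k (f 0) = j →
      (∃ κ, 1 < |st ℓ k (f n) κ - j κ|) → good g ℓ s k j →
      ∃ T : Finset (V d), 2^k ≤ T.card ∧ ∀ i ∈ T, i ∈ Core g ℓ s k j ∧ ∃ t ≤ n, f t = i := by
  induction k with
  | zero =>
    intro j f n _ h0 _ _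
    rw [st_zero] at h0
    exact ⟨{j}, by simp, fun i hi => by rw [Finset.mem_singleton] at hi; subst hi; exact ⟨rfl, 0, by omega, h0⟩⟩
  | succ k ih =>
    intro j f n hf h0 hn hj
    classical
    have hex : ∃ t, t ≤ n ∧ ∃ κ, 1 < |st ℓ (k+1) (f t) κ - j κ| := ⟨n, le_rfl, hn⟩
    obtain ⟨hm, κ, hκ⟩ := Nat.find_spec hex
    have hmin := fun t (ht : t < Nat.find hex) => Nat.find_min hex ht
    set m := Nat.find hex
    have hin : ∀ t < m, st ℓ k (f t) ∈ win ℓ j := by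
      intro t ht
      rw [mem_win_iff (by omega)]
      intro κ'
      have := hmin t ht
      push Not at this
      rw [← st_succ]
      exact this (by omega) κ'
    have hl : (0:ℤ) < ℓ := by omega
    have e0 : st ℓ k (f 0) κ / ℓ = j κ := by rw [← st_succ, h0]
    have b0 : j κ * ℓ ≤ st ℓ k (f 0) κ := (Int.le_ediv_iff_mul_le hl).1 e0.ge
    have b1 : st ℓ k (f 0) κ < (j κ + 1) * ℓ := (Int.ediv_lt_iff_lt_mul hl).1 (by omega)
    rw [st_succ] at hκ
    have : ∃ T : Finset (V d), 2^(k+1) ≤ T.card ∧ ∀ i ∈ T, i ∈ Core g ℓ s (k+1) j ∧ ∃ t ≤ m, f t = i := by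
      rcases lt_abs.1 hκ with h | h
      · have c : (j κ + 2) * ℓ ≤ st ℓ k (f m) κ := (Int.le_ediv_iff_mul_le hl).1 (by omega)
        exact cross_step hs ih j f m (fun t ht => hf t (by omega)) hin hj κ (fun a => a - ℓ * j κ) 
          (fun a b => by simp) (by linarith) (by linarith)
      · have c : st ℓ k (f m) κ < (j κ - 1) * ℓ := (Int.ediv_lt_iff_lt_mul hl).1 (by omega)
        exact cross_step hs ih j f m (fun t ht => hf t (by omega)) hin hj κ (fun a => ℓ * j κ + ℓ - 1 - a) 
          (fun a b => by rw [abs_sub_comm a b]; congr 1; ring) (by linarith) (by nlinarith)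
    obtain ⟨T, h1, h2⟩ := this
    exact ⟨T, h1, fun i hi => ⟨(h2 i hi).1, (h2 i hi).2.imp fun t ht => ⟨by omega, ht.2⟩⟩⟩

end Perco

namespace Perco
variable {d : ℕ}

/-! ### Probability that a level `k` site is bad -/
noncomputable def winF (ℓ : ℕ) (j : V d) : Finset (V d) := Fintype.piFinset fun κ => Finset.Ico ((ℓ:ℤ) * j κ - ℓ) (ℓ * j κ + 2 * ℓ)

theorem mem_winF {ℓ : ℕ} {j a : V d} : a ∈ winF ℓ j ↔ a ∈ win ℓ j := by
  simp [winF, win, Set.mem_ofPred_eq]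

theorem card_winF (ℓ : ℕ) (j : V d) : (winF ℓ j).card = (3*ℓ)^d := by
  simp only [winF, Fintype.card_piFinset, Int.card_Ico]
  have : ∀ κ : Fin d, ((ℓ:ℤ) * j κ + 2 * ℓ - (ℓ * j κ - ℓ)).toNat = 3 * ℓ := by intro κ; omega
  rw [Finset.prod_congr rfl fun κ _ => this κ]; simp

theorem dependsOn_good {C h M K ℓ s : ℕ} (hC : 3 ≤ C) (hM : M + K + 1 ≤ h) (hℓ : 3 ≤ ℓ) (k : ℕ) (j : V d) :
    DependsOn (fun ω => good (Seed C h M K ω) ℓ s k j)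
      (edgesIn (box (cen ((2*h+1)*ℓ^k) j) ((3+C)*((2*h+1)*ℓ^k))) : Set (Edge d)) := by
  intro ω ω' hω
  simp only [eq_iff_iff]
  refine good_congr hℓ k j fun i hi => ?_
  have : Seed C h M K ω i = Seed C h M K ω' i := dependsOn_seed hC hM i (fun e he => hω e (by
    have hs : box (cen (2*h+1) i) (C*(2*h+1)) ⊆ box (cen ((2*h+1)*ℓ^k) j) ((3+C)*((2*h+1)*ℓ^k)) := by
      refine box_subset (r := 3*((2*h+1)*ℓ^k)) ?_ ?_
      · rw [mem_box]
        intro κ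
        have h1 := hi κ
        simp only [cen]
        have : ((2*h+1 : ℕ):ℤ) * i κ - (((2*h+1)*ℓ^k : ℕ):ℤ) * j κ = ((2*h+1 : ℕ):ℤ) * (i κ - (ℓ:ℤ)^k * j κ) := by push_cast; ring
        rw [this, abs_mul, Nat.abs_cast]
        calc ((2*h+1 : ℕ):ℤ) * |i κ - (ℓ:ℤ)^k * j κ| ≤ ((2*h+1 : ℕ):ℤ) * (3 * (ℓ:ℤ)^k) := mul_le_mul_of_nonneg_left h1 (by positivity)
          _ = _ := by push_cast; ring
      · have : 1 ≤ ℓ^k := Nat.one_le_pow _ _ (by omega)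
        nlinarith [Nat.mul_le_mul_left (C*(2*h+1)) this]
    exact_mod_cast edgesIn_mono hs (by exact_mod_cast he)))
  exact this.to_iff

theorem disjoint_edgesIn {S T : Finset (V d)} (h : Disjoint S T) : Disjoint (edgesIn S) (edgesIn T) := by
  rw [Finset.disjoint_left]
  intro e h1 h2
  obtain ⟨x, y, hxy, rfl⟩ := e.exists_rep
  rw [mkE_mem_edgesIn] at h1 h2
  exact Finset.disjoint_left.1 h h1.1 h2.1

theorem good_rec (F : BernoulliFamily d) {p : ℝ} (h0 : 0 ≤ p) (h1 : p ≤ 1) {C h M K ℓ : ℕ} (hC : 3 ≤ C) (hM : M + K + 1 ≤ h) (hℓ : 3 ≤ ℓ)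
    (k : ℕ) {r : ℝ} (hr : ∀ j, (F.P p).real {ω : Config d | ¬ good (Seed C h M K ω) ℓ (2*(3+C)) k j} ≤ r) (j : V d) :
    (F.P p).real {ω : Config d | ¬ good (Seed C h M K ω) ℓ (2*(3+C)) (k+1) j} ≤ ((3*ℓ)^d : ℕ)^2 * r^2 := by
  classical
  have := F.prob p
  have hr0 : 0 ≤ r := measureReal_nonneg.trans (hr 0)
  let Bd : V d → V d → Set (Config d) := fun a b => {ω | ¬ good (Seed C h M K ω) ℓ (2*(3+C)) k a ∧ ¬ good (Seed C h M K ω) ℓ (2*(3+C)) k b}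
  let I := ((winF ℓ j) ×ˢ (winF ℓ j)).filter fun ab => ∃ κ, ((2*(3+C) : ℕ):ℤ) < |ab.1 κ - ab.2 κ|
  have hsub : {ω : Config d | ¬ good (Seed C h M K ω) ℓ (2*(3+C)) (k+1) j} ⊆ ⋃ ab ∈ I, Bd ab.1 ab.2 := by
    intro ω hω
    replace hω : ¬ good (Seed C h M K ω) ℓ (2*(3+C)) (k+1) j := hω
    simp only [good] at hω
    push Not at hω
    obtain ⟨a, ha, b, hb, ga, gb, κ, hκ⟩ := hω
    refine Set.mem_biUnion (x := (a,b)) ?_ ⟨ga, gb⟩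
    simp only [I, Finset.coe_filter, Finset.mem_product]
    exact ⟨⟨mem_winF.2 ha, mem_winF.2 hb⟩, κ, by exact_mod_cast hκ⟩
  have hB : ∀ ab ∈ I, (F.P p).real (Bd ab.1 ab.2) ≤ r^2 := by
    rintro ⟨a, b⟩ hab
    obtain ⟨κ, hκ⟩ := (Finset.mem_filter.1 hab).2
    have hdis : Disjoint (box (cen ((2*h+1)*ℓ^k) a) ((3+C)*((2*h+1)*ℓ^k))) (box (cen ((2*h+1)*ℓ^k) b) ((3+C)*((2*h+1)*ℓ^k))) := by
      rw [Finset.disjoint_left]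
      intro z hz1 hz2
      have e1 := mem_box.1 hz1 κ
      have e2 := mem_box.1 hz2 κ
      simp only [cen] at e1 e2
      set m : ℕ := (2*h+1)*ℓ^k
      have hm : 0 < m := by have : 0 < ℓ := by omega
                            positivity
      have e3 : |(m:ℤ) * a κ - m * b κ| ≤ (3+C) * m + (3+C)*m := by
        have := abs_sub_le ((m:ℤ) * a κ) (z κ) (m * b κ)
        rw [abs_sub_comm _ (z κ)] at this
        push_cast at e1 e2
        linarith
      rw [← mul_sub, abs_mul, Nat.abs_cast] at e3
      push_cast at hκ
      have hm' : (0:ℤ) < m := by exact_mod_cast hm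
      nlinarith
    have := indep_local F h0 h1 (disjoint_edgesIn hdis) (A := fun ω => ¬ good (Seed C h M K ω) ℓ (2*(3+C)) k a)
      (B := fun ω => ¬ good (Seed C h M K ω) ℓ (2*(3+C)) k b)
      (fun ω ω' hω => by
        have : good (Seed C h M K ω) ℓ (2*(3+C)) k a = good (Seed C h M K ω') ℓ (2*(3+C)) k a := dependsOn_good hC hM hℓ k a hω
        simp only [this])
      (fun ω ω' hω => by
        have : good (Seed C h M K ω) ℓ (2*(3+C)) k b = good (Seed C h M K ω') ℓ (2*(3+C)) k b := dependsOn_good hC hM hℓ k b hω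
        simp only [this])
    calc (F.P p).real (Bd a b) = _ := this
      _ ≤ r * r := mul_le_mul (hr a) (hr b) measureReal_nonneg hr0
      _ = r^2 := by ring
  calc _ ≤ (F.P p).real (⋃ ab ∈ I, Bd ab.1 ab.2) := measureReal_mono hsub (measure_ne_top _ _)
    _ ≤ ∑ ab ∈ I, (F.P p).real (Bd ab.1 ab.2) := measureReal_biUnion_finset_le _ _
    _ ≤ ∑ ab ∈ I, r^2 := Finset.sum_le_sum hB
    _ = I.card * r^2 := by simp
    _ ≤ _ := by
      refine mul_le_mul_of_nonneg_right ?_ (by positivity)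
      have : I.card ≤ ((3*ℓ)^d)^2 := by
        refine (Finset.card_filter_le _ _).trans ?_
        rw [Finset.card_product, card_winF, sq]
      exact_mod_cast this

theorem exists_hier (F : BernoulliFamily d) {p : ℝ} (hp0 : 0 ≤ p) (hp1 : p ≤ 1) (hUE : UE (F.P p)) {μ : V d → ℝ}
    (hconv : ASTimeConstant (F.P p) μ) :
    ∃ C h M K : ℕ, 3 ≤ C ∧ M + K + 1 ≤ h ∧
      ∀ k j, (F.P p).real {ω : Config d | ¬ good (Seed C h M K ω) (2*(3+C)+17) (2*(3+C)) k j} ≤ (1/2)^(2^k) := by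
  have := F.prob p
  obtain ⟨C, hC, hκ⟩ := exists_seed F hp0 hp1 hUE hconv
  set D : ℝ := ((3*(2*(3+C)+17))^d : ℕ)^2 with hD
  have hD1 : 1 ≤ D := by
    rw [hD]
    have : 1 ≤ (3*(2*(3+C)+17))^d := Nat.one_le_pow _ _ (by omega)
    exact one_le_pow₀ (by exact_mod_cast this)
  obtain ⟨h, M, K, hM, hs⟩ := hκ (1/(2*D)) (by positivity)
  refine ⟨C, h, M, K, hC, hM, ?_⟩
  have key : ∀ k j, (F.P p).real {ω : Config d | ¬ good (Seed C h M K ω) (2*(3+C)+17) (2*(3+C)) k j} ≤ (1/2)^(2^k) / D := by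
    intro k
    induction k with
    | zero =>
      intro j
      simp only [good]
      have := seed_prob F hp0 hp1 hC hM j
      calc _ ≤ 1/(2*D) := by rw [this]; exact hs
        _ = _ := by simp; ring
    | succ k ih =>
      intro j
      refine (good_rec F hp0 hp1 hC hM (by omega) k ih j).trans (le_of_eq ?_)
      rw [← hD, pow_succ 2 k, pow_mul]
      field_simp
  intro k j
  exact (key k j).trans (div_le_self (by positivity) hD1)

end Perco

namespace Perco
variable {d : ℕ}

/-! ### Sprinkling: a cluster visiting many tiles meets a fully open one -/
noncomputable def tile (h : ℕ) (i : V d) : Finset (V d) := box (cen (2*h+1) i) h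

def Full (h : ℕ) (σ : Config d) (i : V d) : Prop := ∀ e ∈ edgesIn (tile h i), σ e = true

theorem tile_disjoint {h : ℕ} {i j : V d} (hij : i ≠ j) : Disjoint (tile h i) (tile h j) := by
  rw [Finset.disjoint_left]
  intro z h1 h2
  refine hij (funext fun κ => ?_)
  have e1 := mem_box.1 h1 κ
  have e2 := mem_box.1 h2 κ
  simp only [cen] at e1 e2
  by_contra hne
  rw [abs_le] at e1 e2
  push_cast at e1 e2
  have h0 : (0:ℤ) ≤ h := by positivity
  rcases lt_or_gt_of_ne hne with hl | hl
  · have : i κ + 1 ≤ j κ := hl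
    nlinarith
  · have : j κ + 1 ≤ i κ := hl
    nlinarith

theorem dependsOn_full (h : ℕ) (i : V d) : DependsOn (fun σ => Full h σ i) (edgesIn (tile h i) : Set (Edge d)) := by
  intro ω ω' hω
  simp only [Full, eq_iff_iff]
  exact forall_congr' fun e => forall_congr' fun he => by rw [hω e he]

noncomputable def qf (F : BernoulliFamily d) (s : ℝ) (h : ℕ) : ℝ := (F.P s).real {σ : Config d | ¬ Full h σ 0}

theorem full_shift {h : ℕ} {σ : Config d} {i : V d} : Full h (sh (cen (2*h+1) i) σ) 0 ↔ Full h σ i := by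
  unfold Full tile
  rw [cen_zero]
  constructor
  · intro H e he
    obtain ⟨x, y, hxy, rfl⟩ := e.exists_rep
    rw [mkE_mem_edgesIn] at he
    have h1 : dist1 (x - cen (2*h+1) i) (y - cen (2*h+1) i) = 1 := by
      rw [← dist1_add_right _ _ (cen (2*h+1) i)]; simpa using hxy
    have := H (mkE _ _ h1) (by
      rw [mkE_mem_edgesIn]
      constructor
      · have := (mem_box_add (z := cen (2*h+1) i) (x := 0) (y := x - cen (2*h+1) i) (r := h)).1
        simp only [sub_add_cancel, zero_add] at this
        exact this he.1
      · have := (mem_box_add (z := cen (2*h+1) i) (x := 0) (y := y - cen (2*h+1) i) (r := h)).1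
        simp only [sub_add_cancel, zero_add] at this
        exact this he.2)
    simpa [sh, shE_mkE] using this
  · intro H e he
    obtain ⟨x, y, hxy, rfl⟩ := e.exists_rep
    rw [mkE_mem_edgesIn] at he
    simp only [sh, shE_mkE]
    refine H _ ?_
    rw [mkE_mem_edgesIn]
    have h1 := (mem_box_add (z := cen (2*h+1) i) (x := 0) (y := x) (r := h)).2 he.1
    have h2 := (mem_box_add (z := cen (2*h+1) i) (x := 0) (y := y) (r := h)).2 he.2
    rw [zero_add] at h1 h2
    exact ⟨h1, h2⟩

theorem qf_eq (F : BernoulliFamily d) {s : ℝ} (h0 : 0 ≤ s) (h1 : s ≤ 1) (h : ℕ) (i : V d) :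
    (F.P s).real {σ : Config d | ¬ Full h σ i} = qf F s h := by
  have hm : MeasurableSet {σ : Config d | Full h σ 0} := measurableSet_of_local _ _ (dependsOn_full h 0)
  rw [qf, measureReal_def, measureReal_def]
  congr 1
  have hm' : MeasurableSet {σ : Config d | ¬ Full h σ 0} := hm.compl
  rw [← sh_prob F h0 h1 (cen (2*h+1) i) hm']
  congr 1
  ext σ
  exact not_congr full_shift.symm

theorem dependsOn_not {A : Config d → Prop} {S : Set (Edge d)} (h : DependsOn A S) : DependsOn (fun ω => ¬ A ω) S := by
  intro ω ω' hω
  have : A ω = A ω' := h hω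
  simp only [this]

theorem none_full (F : BernoulliFamily d) {s : ℝ} (h0 : 0 ≤ s) (h1 : s ≤ 1) (h : ℕ) (T : Finset (V d)) :
    (F.P s).real {σ : Config d | ∀ t ∈ T, ¬ Full h σ t} = qf F s h ^ T.card := by
  classical
  have := F.prob s
  induction T using Finset.induction_on with
  | empty => simp
  | insert t T ht ih =>
    have e : {σ : Config d | ∀ t' ∈ insert t T, ¬ Full h σ t'} = {σ | (¬ Full h σ t) ∧ ∀ t' ∈ T, ¬ Full h σ t'} := by
      ext σ; simp [Finset.forall_mem_insert]
    rw [e, indep_local F h0 h1 (S := edgesIn (tile h t)) (T := T.biUnion fun t' => edgesIn (tile h t')) ?_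
      (A := fun σ => ¬ Full h σ t) (B := fun σ => ∀ t' ∈ T, ¬ Full h σ t') (dependsOn_not (dependsOn_full h t)) ?_,
      ih, qf_eq F h0 h1, Finset.card_insert_of_notMem ht, pow_succ, mul_comm]
    · rw [Finset.disjoint_biUnion_right]
      intro t' ht'
      exact disjoint_edgesIn (tile_disjoint (by rintro rfl; exact ht ht'))
    · intro ω ω' hω
      simp only [eq_iff_iff]
      refine forall_congr' fun t' => forall_congr' fun ht' => not_congr ?_
      have : Full h ω t' = Full h ω' t' := dependsOn_full h t' (fun e he => hω e (by
        exact_mod_cast Finset.mem_biUnion.2 ⟨t', ht', by exact_mod_cast he⟩))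
      exact this.to_iff

open Classical in
noncomputable def Vis (h : ℕ) (G : Finset (V d)) (η : Config d) (u : V d) : Finset (V d) :=
  G.filter fun t => ∃ x ∈ tile h t, Reach η u x

theorem reach_off {η η' : Config d} {u : V d} {X : Set (V d)} (hX : ∀ x, Reach η u x → x ∉ X)
    (hag : ∀ e : Edge d, ¬ (∀ v ∈ ends e, v ∈ X) → η e = η' e) : ∀ x, Reach η u x ↔ Reach η' u x := by
  have step : ∀ x y, Reach η u x → ((gr η).Adj x y ↔ (gr η').Adj x y) := by
    intro x y hx
    simp only [adj_iff]
    refine exists_congr fun hxy => ?_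
    rw [hag]
    rw [ends_mkE]
    intro hc
    exact hX x hx (hc x (by simp))
  intro x
  constructor
  · intro hx
    replace hx := (SimpleGraph.reachable_iff_reflTransGen _ _).1 hx
    induction hx with
    | refl => exact SimpleGraph.Reachable.refl _
    | tail hb hbc ih =>
      exact ih.trans ((step _ _ ((SimpleGraph.reachable_iff_reflTransGen _ _).2 hb)).1 hbc).reachable
  · intro hx
    replace hx := (SimpleGraph.reachable_iff_reflTransGen _ _).1 hx
    induction hx with
    | refl => exact SimpleGraph.Reachable.refl _
    | tail hb hbc ih =>
      exact ih.trans ((step _ _ ih).2 hbc).reachable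

theorem link (F : BernoulliFamily d) {s : ℝ} (h0 : 0 ≤ s) (h1 : s ≤ 1) (h : ℕ) (hq : 0 < qf F s h) (G B : Finset (V d)) (u : V d)
    (Ψ : Config d → Config d) (hΨ : ∀ σ σ' e, σ e = σ' e → Ψ σ e = Ψ σ' e) (m : ℕ) :
    (F.P s).real {σ : Config d | m ≤ (Vis h G (restr B (Ψ σ)) u).card ∧ ∀ t ∈ Vis h G (restr B (Ψ σ)) u, ¬ Full h σ t} ≤ qf F s h ^ m := by
  classical
  have := F.prob s
  set q := qf F s h with hqdef
  have hq1 : q ≤ 1 := measureReal_le_one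
  let vis : Config d → Finset (V d) := fun σ => Vis h G (restr B (Ψ σ)) u
  have hvG : ∀ σ, vis σ ⊆ G := fun σ => Finset.filter_subset _ _
  let A : Finset (V d) → Config d → Prop := fun S σ => vis σ = S ∧ ∀ t ∈ S, ¬ Full h σ t
  let Db : Finset (Edge d) := edgesIn B ∪ G.biUnion fun t => edgesIn (tile h t)
  let Ds : Finset (V d) → Finset (Edge d) := fun S => Db \ (G \ S).biUnion fun t => edgesIn (tile h t)
  have hdepV : ∀ S ⊆ G, ∀ σ σ', (∀ e ∈ Ds S, σ e = σ' e) → A S σ → A S σ' := by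
    rintro S hS σ σ' hσ ⟨hv, hF⟩
    have hX : ∀ x, Reach (restr B (Ψ σ)) u x → x ∉ (⋃ t ∈ G \ S, (tile h t : Set (V d))) := by
      intro x hx hmem
      simp only [Set.mem_iUnion] at hmem
      obtain ⟨t, ht, hxt⟩ := hmem
      rw [Finset.mem_sdiff] at ht
      exact ht.2 (by rw [← hv]; exact Finset.mem_filter.2 ⟨ht.1, x, by exact_mod_cast hxt, hx⟩)
    have hr := reach_off (η' := restr B (Ψ σ')) hX (by
      intro e he
      by_cases heB : ∀ v ∈ ends e, v ∈ (B : Set (V d))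
      · simp only [restr, if_pos heB]
        refine hΨ _ _ _ (hσ e ?_)
        simp only [Ds, Finset.mem_sdiff, Db, Finset.mem_union]
        refine ⟨Or.inl (mem_edgesIn.2 (by exact_mod_cast heB)), fun hc => he ?_⟩
        obtain ⟨t, ht, het⟩ := Finset.mem_biUnion.1 hc
        intro v hv
        simp only [Set.mem_iUnion]
        exact ⟨t, ht, by exact_mod_cast mem_edgesIn.1 het v hv⟩
      · simp only [restr, if_neg heB])
    refine ⟨?_, fun t ht => ?_⟩
    · rw [← hv]
      refine Finset.filter_congr fun t _ => ?_
      exact exists_congr fun x => and_congr_right fun _ => (hr x).symm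
    · have : Full h σ t = Full h σ' t := dependsOn_full h t (fun e he => hσ e (by
        simp only [Ds, Finset.mem_sdiff, Db, Finset.mem_union]
        refine ⟨Or.inr (Finset.mem_biUnion.2 ⟨t, hS ht, by exact_mod_cast he⟩), fun hc => ?_⟩
        obtain ⟨t', ht', het⟩ := Finset.mem_biUnion.1 hc
        rw [Finset.mem_sdiff] at ht'
        have hne : t ≠ t' := by rintro rfl; exact ht'.2 ht
        exact Finset.disjoint_left.1 (disjoint_edgesIn (tile_disjoint hne)) (by exact_mod_cast he) het))
      rw [← this]; exact hF t ht
  have hdep : ∀ S ⊆ G, DependsOn (A S) (Ds S : Set (Edge d)) := by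
    intro S hS σ σ' hσ
    exact propext ⟨hdepV S hS σ σ' (fun e he => hσ e (by exact_mod_cast he)), hdepV S hS σ' σ (fun e he => (hσ e (by exact_mod_cast he)).symm)⟩
  have hdepF : ∀ T : Finset (V d), DependsOn (fun σ => ∀ t ∈ T, ¬ Full h σ t) (T.biUnion fun t => edgesIn (tile h t) : Finset (Edge d)) := by
    intro T ω ω' hω
    simp only [eq_iff_iff]
    refine forall_congr' fun t' => forall_congr' fun ht' => not_congr ?_
    have : Full h ω t' = Full h ω' t' := dependsOn_full h t' (fun e he => hω e (by
        exact_mod_cast Finset.mem_biUnion.2 ⟨t', ht', by exact_mod_cast he⟩))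
    exact this.to_iff
  have hprod : ∀ S ⊆ G, (F.P s).real {σ | A S σ ∧ ∀ t ∈ G \ S, ¬ Full h σ t} = (F.P s).real {σ | A S σ} * q ^ (G.card - S.card) := by
    intro S hS
    rw [indep_local F h0 h1 (S := Ds S) (T := (G \ S).biUnion fun t => edgesIn (tile h t)) Finset.sdiff_disjoint
      (A := A S) (B := fun σ => ∀ t ∈ G \ S, ¬ Full h σ t) (hdep S hS) (hdepF _), none_full F h0 h1, Finset.card_sdiff_of_subset hS]
  have hsum : ∑ S ∈ G.powerset, (F.P s).real {σ | A S σ} * q ^ (G.card - S.card) ≤ q ^ G.card := by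
    calc ∑ S ∈ G.powerset, (F.P s).real {σ | A S σ} * q ^ (G.card - S.card)
        = ∑ S ∈ G.powerset, (F.P s).real {σ | A S σ ∧ ∀ t ∈ G \ S, ¬ Full h σ t} :=
          Finset.sum_congr rfl fun S hS => (hprod S (Finset.mem_powerset.1 hS)).symm
      _ = (F.P s).real (⋃ S ∈ G.powerset, {σ | A S σ ∧ ∀ t ∈ G \ S, ¬ Full h σ t}) := by
          rw [measureReal_biUnion_finset]
          · intro S _ S' _ hne
            rw [Function.onFun, Set.disjoint_left]
            rintro σ ⟨⟨e1, _⟩, _⟩ ⟨⟨e2, _⟩, _⟩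
            exact hne (e1.symm.trans e2)
          · intro S hS
            exact (measurableSet_of_local _ _ (hdep S (Finset.mem_powerset.1 hS))).inter (measurableSet_of_local _ _ (hdepF _))
      _ ≤ (F.P s).real {σ | ∀ t ∈ G, ¬ Full h σ t} := by
          refine measureReal_mono ?_ (measure_ne_top _ _)
          intro σ hσ
          simp only [Set.mem_iUnion] at hσ
          obtain ⟨S, hS, ⟨_, h3⟩, h4⟩ := hσ
          intro t ht
          by_cases htS : t ∈ S
          · exact h3 t htS
          · exact h4 t (Finset.mem_sdiff.2 ⟨ht, htS⟩)
      _ = _ := none_full F h0 h1 h G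
  have hsub : {σ : Config d | m ≤ (vis σ).card ∧ ∀ t ∈ vis σ, ¬ Full h σ t} ⊆ ⋃ S ∈ G.powerset.filter (fun S => m ≤ S.card), {σ | A S σ} := by
    rintro σ ⟨h1, h2⟩
    simp only [Set.mem_iUnion]
    exact ⟨vis σ, Finset.mem_filter.2 ⟨Finset.mem_powerset.2 (hvG σ), h1⟩, rfl, h2⟩
  calc _ ≤ (F.P s).real (⋃ S ∈ G.powerset.filter (fun S => m ≤ S.card), {σ | A S σ}) := measureReal_mono hsub (measure_ne_top _ _)
    _ ≤ ∑ S ∈ G.powerset.filter (fun S => m ≤ S.card), (F.P s).real {σ | A S σ} := measureReal_biUnion_finset_le _ _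
    _ ≤ ∑ S ∈ G.powerset.filter (fun S => m ≤ S.card), (F.P s).real {σ | A S σ} * q ^ (G.card - S.card) * (q ^ m / q ^ G.card) := by
        refine Finset.sum_le_sum fun S hS => ?_
        rw [Finset.mem_filter, Finset.mem_powerset] at hS
        rw [mul_assoc]
        refine le_mul_of_one_le_right measureReal_nonneg ?_
        rw [mul_div_assoc', one_le_div (by positivity), ← pow_add]
        refine pow_le_pow_of_le_one hq.le hq1 ?_
        have := Finset.card_le_card hS.1
        omega
    _ ≤ ∑ S ∈ G.powerset, (F.P s).real {σ | A S σ} * q ^ (G.card - S.card) * (q ^ m / q ^ G.card) :=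
        Finset.sum_le_sum_of_subset_of_nonneg (Finset.filter_subset _ _) fun S _ _ => by positivity
    _ = (∑ S ∈ G.powerset, (F.P s).real {σ | A S σ} * q ^ (G.card - S.card)) * (q ^ m / q ^ G.card) := by rw [Finset.sum_mul]
    _ ≤ q ^ G.card * (q ^ m / q ^ G.card) := by gcongr
    _ = q ^ m := by field_simp

theorem qf_pos (hd : 1 ≤ d) (F : BernoulliFamily d) {s : ℝ} (h0 : 0 < s) (h1 : s < 1) {h : ℕ} (hh : 1 ≤ h) : 0 < qf F s h ∧ qf F s h < 1 := by
  classical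
  have := F.prob s
  have hm : MeasurableSet {σ : Config d | Full h σ 0} := measurableSet_of_local _ _ (dependsOn_full h 0)
  have e1 : (F.P s) {σ : Config d | Full h σ 0} = ENNReal.ofReal s ^ (edgesIn (tile h (0 : V d))).card := by
    have := F.iid s h0.le h1.le (edgesIn (tile h (0 : V d))) (fun _ => true)
    simpa [Full] using this
  have e2 : qf F s h = 1 - s ^ (edgesIn (tile h (0 : V d))).card := by
    have : {σ : Config d | ¬ Full h σ 0} = {σ : Config d | Full h σ 0}ᶜ := rfl
    rw [qf, this, probReal_compl_eq_one_sub hm, measureReal_def, e1, ENNReal.toReal_pow, ENNReal.toReal_ofReal h0.le]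
  have hc : (edgesIn (tile h (0 : V d))).card ≠ 0 := by
    let v : V d := Pi.single ⟨0, hd⟩ 1
    have hv : dist1 (0 : V d) v = 1 := by
      unfold dist1
      rw [Finset.sum_eq_single ⟨0, hd⟩]
      · simp [v]
      · intro b _ hb; simp [v, Pi.single_eq_of_ne hb]
      · simp
    rw [Finset.card_ne_zero]
    refine ⟨mkE 0 v hv, mkE_mem_edgesIn.2 ⟨?_, ?_⟩⟩
    · rw [tile, cen_zero]; exact self_mem_box _ _
    · rw [tile, cen_zero]; exact box_mono hh (mem_box_of_dist1 hv.le)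
  rw [e2]
  have h3 := pow_lt_one₀ h0.le h1 hc
  have h4 : 0 < s ^ (edgesIn (tile h (0 : V d))).card := by positivity
  constructor <;> linarith

end Perco

namespace Perco
variable {d : ℕ}

/-! ### Linking, deterministic part -/
def site (h : ℕ) (x : V d) : V d := fun κ => (x κ + h) / ((2*h+1 : ℕ):ℤ)

theorem site_tile (h : ℕ) (x : V d) : x ∈ tile h (site h x) := by
  rw [tile, mem_box]
  intro κ
  simp only [cen, site]
  have h1 := Int.mul_ediv_add_emod (x κ + h) ((2*h+1 : ℕ):ℤ)
  have h3 := Int.emod_nonneg (x κ + h) (b := ((2*h+1 : ℕ):ℤ)) (by positivity)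
  have h5 := Int.emod_lt_of_pos (x κ + h) (b := ((2*h+1 : ℕ):ℤ)) (by positivity)
  push_cast at *
  rw [abs_le]
  constructor <;> linarith

theorem st_site (h ℓ k : ℕ) (x : V d) (κ : Fin d) : st ℓ k (site h x) κ = (x κ + h) / (((2*h+1)*ℓ^k : ℕ):ℤ) := by
  simp only [st, site]
  rw [Int.ediv_ediv_of_nonneg (by positivity)]
  push_cast; rfl

theorem Jn_reach {C h M K : ℕ} {ω : Config d} {S : Set (V d)} {D : Finset (V d)}
    (hD : ∀ i ∈ S, box (cen (2*h+1) i) (C*(2*h+1)) ⊆ D) {i i' : V d} (hJ : Jn (Seed C h M K ω) S i i')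
    (hi : i ∈ S) (hg : Seed C h M K ω i) {y : V d} (hy : y ∈ box (cen (2*h+1) i) M) (hyF : Far ω y K) :
    ∀ y' ∈ box (cen (2*h+1) i') M, Far ω y' K → Reach (restr D ω) y y' := by
  have mono : ∀ b ∈ S, ∀ y y', Reach (restr (box (cen (2*h+1) b) (C*(2*h+1))) ω) y y' → Reach (restr D ω) y y' :=
    fun b hb y y' h => Reach.mono (restr_mono_set (by exact_mod_cast hD b hb) ω) h
  induction hJ with
  | refl =>
    intro y' hy' hF'
    exact mono i hi _ _ (hg.2 i (by rw [dist1_self]; omega) y hy y' hy' hyF hF')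
  | tail _ hbc ih =>
    intro y' hy' hF'
    obtain ⟨h1, hb, hc, hbS, hcS⟩ := hbc
    obtain ⟨z, hz, hzF⟩ := hb.1
    exact (ih z hz hzF).trans (mono _ hbS _ _ (hb.2 _ h1 z hz y' hy' hzF hF'))

theorem cores_joined (hd : 2 ≤ d) {g : V d → Prop} {ℓ s k : ℕ} (hs : s + 17 ≤ ℓ) {S : Set (V d)} {j j' : V d}
    (hJ : Jn (good g ℓ s k) S j j') (hj : j ∈ S) (hg : good g ℓ s k j) {i : V d} (hi : i ∈ Core g ℓ s k j) :
    ∀ i' ∈ Core g ℓ s k j', Jn g (⋃ b ∈ S, Rg ℓ k b) i i' := by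
  have sub : ∀ b ∈ S, Rg ℓ k b ⊆ ⋃ b ∈ S, Rg ℓ k b := fun b hb => Set.subset_biUnion_of_mem (u := fun b => Rg ℓ k b) hb
  induction hJ with
  | refl =>
    intro i' hi'
    exact Jn.mono' (sub j hj) ((core_joined hd hs k).1 j hg i hi i' hi')
  | tail _ hbc ih =>
    intro i' hi'
    obtain ⟨h1, hb, hc, hbS, hcS⟩ := hbc
    obtain ⟨z, hz⟩ := Core_nonempty hd hs k _ hb
    exact (ih z hz).trans (Jn.mono' (Set.union_subset (sub _ hbS) (sub _ hcS)) ((core_joined hd hs k).2 _ _ h1 hb hc z hz i' hi'))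

/-- `u` is linked (in `η`) to a fully open tile of its level-`k` core -/
def Linked (g : V d → Prop) (h ℓ s k : ℕ) (η : Config d) (u : V d) (r : ℕ) : Prop :=
  ∃ i ∈ Core g ℓ s k (st ℓ k (site h u)), Full h η i ∧ ∃ x ∈ tile h i, Reach (restr (box u r) η) u x

theorem mem_cen_st (h ℓ k : ℕ) (hℓ : 1 ≤ ℓ) (u : V d) : u ∈ box (cen ((2*h+1)*ℓ^k) (st ℓ k (site h u))) ((2*h+1)*ℓ^k) := by
  rw [mem_box]
  intro κ
  simp only [cen, st_site]
  set m : ℕ := (2*h+1)*ℓ^k with hm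
  have hmh : 2*h+1 ≤ m := Nat.le_mul_of_pos_right _ (by positivity)
  have h1 := Int.mul_ediv_add_emod (u κ + h) (m:ℤ)
  have h3 := Int.emod_nonneg (u κ + h) (b := (m:ℤ)) (by omega)
  have h5 := Int.emod_lt_of_pos (u κ + h) (b := (m:ℤ)) (by omega)
  have hmh' : (2*h+1 : ℤ) ≤ m := by exact_mod_cast hmh
  rw [abs_le]
  constructor <;> linarith [(Nat.cast_nonneg h : (0:ℤ) ≤ h)]

theorem linked_reach (hd : 2 ≤ d) {C h M K ℓ s k : ℕ} (hC : 3 ≤ C) (hMh : M + K + 1 ≤ h) (hs : s + 17 ≤ ℓ) {ω η : Config d} (hωη : ω ≤ η) {u w : V d}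
    (hw : w ∈ box u ((2*h+1)*ℓ^k))
    (hgood : ∀ j ∈ box (st ℓ k (site h u)) 1, good (Seed C h M K ω) ℓ s k j)
    (hu' : Linked (Seed C h M K ω) h ℓ s k η u (2*((2*h+1)*ℓ^k)+1)) (hw' : Linked (Seed C h M K ω) h ℓ s k η w (2*((2*h+1)*ℓ^k)+1)) :
    Reach (restr (box u ((5+C)*((2*h+1)*ℓ^k))) η) u w := by
  set m : ℕ := (2*h+1)*ℓ^k with hm
  have hℓ : 1 ≤ ℓ := by omega
  have hmh : 2*h+1 ≤ m := Nat.le_mul_of_pos_right _ (by positivity)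
  set j0 := st ℓ k (site h u) with hj0
  have hj : st ℓ k (site h w) ∈ box j0 1 := by
    rw [mem_box]
    intro κ
    rw [hj0, st_site, st_site, ← hm]
    have := mem_box.1 hw κ
    exact_mod_cast ediv_near (c := 1) (m := (m:ℤ)) (by omega) (by simpa using this)
  obtain ⟨i, hi, hiF, x, hx, hxr⟩ := hu'
  obtain ⟨i', hi', hiF', x', hx', hxr'⟩ := hw'
  set S : Set (V d) := (box j0 1 : Set (V d)) with hS
  have hS0 : j0 ∈ S := by simpa [hS] using self_mem_box j0 1
  have hJ : Jn (good (Seed C h M K ω) ℓ s k) S j0 (st ℓ k (site h w)) := by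
    refine mono_chain _ _ _ rfl fun z hz => ?_
    have hz1 : z ∈ box j0 1 := box_convex (self_mem_box _ _) hj hz
    exact ⟨hgood z hz1, by simpa [hS] using hz1⟩
  have hJ2 := cores_joined hd hs hJ hS0 (hgood j0 (self_mem_box _ _)) hi i' hi'
  have hg := Core_good k j0 (hgood j0 (self_mem_box _ _)) i hi
  have hg' := Core_good k _ (hgood _ hj) i' hi'
  obtain ⟨y, hy, hyF⟩ := hg.1
  obtain ⟨y', hy', hyF'⟩ := hg'.1
  have hucen := mem_box_comm.1 (mem_cen_st h ℓ k hℓ u)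
  have hreg : ∀ b ∈ (⋃ b ∈ S, Rg ℓ k b), box (cen (2*h+1) b) (C*(2*h+1)) ⊆ box u ((5+C)*m) := by
    intro i hi
    simp only [Set.mem_iUnion] at hi
    obtain ⟨b, hb, hib⟩ := hi
    have hb' : b ∈ box j0 1 := by simpa [hS] using hb
    have h1 : cen (2*h+1) i ∈ box (cen m j0) (4*m) := by
      rw [mem_box]
      intro κ
      have e1 := hib κ
      have e2 := mem_box.1 hb' κ
      simp only [cen]
      have e3 : ((2*h+1 : ℕ):ℤ) * i κ - (m:ℤ) * j0 κ = ((2*h+1 : ℕ):ℤ) * (i κ - (ℓ:ℤ)^k * b κ) + m * (b κ - j0 κ) := by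
        rw [hm]; push_cast; ring
      have e4 : ((2*h+1 : ℕ):ℤ) * |i κ - (ℓ:ℤ)^k * b κ| ≤ 3 * m := by
        calc ((2*h+1 : ℕ):ℤ) * |i κ - (ℓ:ℤ)^k * b κ| ≤ ((2*h+1 : ℕ):ℤ) * (3 * (ℓ:ℤ)^k) := mul_le_mul_of_nonneg_left e1 (by positivity)
          _ = 3 * m := by rw [hm]; push_cast; ring
      have e5 : (m:ℤ) * |b κ - j0 κ| ≤ m := by
        have : (m:ℤ) * |b κ - j0 κ| ≤ m * 1 := mul_le_mul_of_nonneg_left (by exact_mod_cast e2) (by positivity)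
        linarith
      rw [e3]
      refine (abs_add_le _ _).trans ?_
      rw [abs_mul, abs_mul, Nat.abs_cast, Nat.abs_cast]
      push_cast at *
      linarith
    refine box_subset (r := 5*m) ?_ ?_
    · have := mem_box_trans hucen h1
      exact box_mono (by omega) this
    · have := Nat.mul_le_mul_left C hmh
      nlinarith
  have hiS : i ∈ ⋃ b ∈ S, Rg ℓ k b := by
    simp only [Set.mem_iUnion]
    exact ⟨j0, hS0, Core_sub_Rg (by omega) k j0 hi⟩
  have hiS' : i' ∈ ⋃ b ∈ S, Rg ℓ k b := by
    simp only [Set.mem_iUnion]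
    exact ⟨_, by simpa [hS] using hj, Core_sub_Rg (by omega) k _ hi'⟩
  have hyy := Jn_reach (D := box u ((5+C)*m)) hreg hJ2 hiS hg hy hyF y' hy' hyF'
  replace hyy : Reach (restr (box u ((5+C)*m)) η) y y' := Reach.mono (restr_mono hωη) hyy
  have tile_reach : ∀ i ∈ (⋃ b ∈ S, Rg ℓ k b), Full h η i → ∀ x ∈ tile h i, ∀ y ∈ tile h i, Reach (restr (box u ((5+C)*m)) η) x y := by
    intro i hi hF x hx y hy
    obtain ⟨w, _⟩ := box_walk (ω := η) (c := cen (2*h+1) i) (r := h) hF _ x y rfl hx hy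
    have hsub : box (cen (2*h+1) i) h ⊆ box u ((5+C)*m) := 
      (box_mono (by nlinarith)).trans (hreg i hi)
    exact Reach.mono (restr_mono_set (by exact_mod_cast hsub) η) ⟨w⟩
  have hMt : ∀ i : V d, box (cen (2*h+1) i) M ⊆ tile h i := fun i => box_mono (by omega)
  have r1 : Reach (restr (box u ((5+C)*m)) η) u x := Reach.mono (restr_mono_set (by
    exact_mod_cast box_mono (x := u) (by nlinarith : 2*m+1 ≤ (5+C)*m)) η) hxr
  have r2 : Reach (restr (box u ((5+C)*m)) η) w x' := Reach.mono (restr_mono_set (by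
    exact_mod_cast box_subset hw (by nlinarith : m + (2*m+1) ≤ (5+C)*m)) η) hxr'
  exact r1.trans ((tile_reach i hiS hiF x hx y (hMt i hy)).trans (hyy.trans
    ((tile_reach i' hiS' hiF' y' (hMt i' hy') x' hx').trans r2.symm)))

end Perco

namespace Perco
variable {d : ℕ}

/-! ### Linking, probabilistic part -/
theorem Far.anti' {ω : Config d} {x : V d} {K K' : ℕ} (h : K ≤ K') (hf : Far ω x K') : Far ω x K := by
  obtain ⟨y, h1, h2⟩ := hf
  exact ⟨y, h1, fun h3 => h2 (box_mono h h3)⟩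

theorem edge_tile_unique {h : ℕ} {e : Edge d} {i j : V d} (hi : e ∈ edgesIn (tile h i)) (hj : e ∈ edgesIn (tile h j)) : i = j := by
  by_contra hij
  obtain ⟨x, y, hxy, rfl⟩ := e.exists_rep
  rw [mkE_mem_edgesIn] at hi hj
  exact Finset.disjoint_left.1 (tile_disjoint hij) hi.1 hj.1

theorem far_vis {g : V d → Prop} {h ℓ s k : ℕ} (hs : s + 17 ≤ ℓ) {η : Config d} {u : V d} (e : Edge d)
    (hg : good g ℓ s k (st ℓ k (site h u))) (hF : Far η u (2*((2*h+1)*ℓ^k))) (G : Finset (V d))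
    (hG : ∀ i, i ∈ Core g ℓ s k (st ℓ k (site h u)) → e ∉ edgesIn (tile h i) → i ∈ G) :
    2^k - 1 ≤ (Vis h G (restr (box u (2*((2*h+1)*ℓ^k)+1)) η) u).card := by
  classical
  set m : ℕ := (2*h+1)*ℓ^k with hm
  have hm0 : 0 < m := by have : 1 ≤ ℓ := by omega
                         positivity
  obtain ⟨y, ⟨w⟩, hy⟩ := far_iff_restr.1 hF
  obtain ⟨T, hT, hTi⟩ := cross (g := g) hs k (st ℓ k (site h u)) (fun t => site h (w.getVert t)) w.length
    (by
      intro t ht κ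
      have hadj := w.adj_getVert_succ ht
      obtain ⟨hd1, -⟩ := adj_iff.1 hadj
      have h2 := coord_le_dist1 (w.getVert t) (w.getVert (t+1)) κ
      rw [hd1] at h2
      simp only [site]
      refine ediv_near (by positivity) ?_
      have h3 : |w.getVert (t+1) κ - w.getVert t κ| ≤ 1 := by rw [abs_le] at *; push_cast at h2; constructor <;> linarith [h2.1, h2.2]
      have h4 : w.getVert (t+1) κ + h - (w.getVert t κ + h) = w.getVert (t+1) κ - w.getVert t κ := by ring
      rw [h4]
      refine h3.trans ?_
      push_cast; linarith [(Nat.cast_nonneg h : (0:ℤ) ≤ h)])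
    (by simp)
    (by
      rw [mem_box] at hy
      push Not at hy
      obtain ⟨κ, hκ⟩ := hy
      refine ⟨κ, ?_⟩
      rw [SimpleGraph.Walk.getVert_length, st_site, st_site, ← hm]
      by_contra hc
      push Not at hc
      have h1 := Int.mul_ediv_add_emod (y κ + h) m
      have h2 := Int.mul_ediv_add_emod (u κ + h) m
      have h3 := Int.emod_nonneg (y κ + h) (b := (m:ℤ)) (by omega)
      have h4 := Int.emod_nonneg (u κ + h) (b := (m:ℤ)) (by omega)
      have h5 := Int.emod_lt_of_pos (y κ + h) (b := (m:ℤ)) (by omega)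
      have h6 := Int.emod_lt_of_pos (u κ + h) (b := (m:ℤ)) (by omega)
      have h7 : |(m:ℤ) * ((y κ + h)/m - (u κ + h)/m)| ≤ m := by
        rw [abs_mul, Nat.abs_cast]
        have := mul_le_mul_of_nonneg_left hc (by positivity : (0:ℤ) ≤ m)
        linarith
      rw [mul_sub] at h7
      rw [abs_le] at h7
      rw [lt_abs] at hκ
      push_cast at hκ
      rcases hκ with hκ | hκ <;> linarith [h7.1, h7.2])
    hg
  have hsub : T.filter (fun i => e ∉ edgesIn (tile h i)) ⊆ Vis h G (restr (box u (2*m+1)) η) u := by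
    intro i hi
    rw [Finset.mem_filter] at hi
    obtain ⟨h1, t, ht, h2⟩ := hTi i hi.1
    rw [Vis, Finset.mem_filter]
    refine ⟨hG i h1 hi.2, w.getVert t, ?_, ⟨w.take t⟩⟩
    rw [← h2]; exact site_tile h _
  have hc : (T.filter (fun i => ¬ e ∉ edgesIn (tile h i))).card ≤ 1 := by
    rw [Finset.card_le_one]
    intro i hi j hj
    rw [Finset.mem_filter, not_not] at hi hj
    exact edge_tile_unique hi.2 hj.2
  have hc2 := Finset.card_filter_add_card_filter_not (s := T) (fun i => e ∉ edgesIn (tile h i))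
  have := Finset.card_le_card hsub
  omega

theorem link_prob (F : BernoulliFamily d) {s' : ℝ} (h0 : 0 ≤ s') (h1 : s' ≤ 1) {g : V d → Prop} {h ℓ s k : ℕ} (hs : s + 17 ≤ ℓ)
    (hq : 0 < qf F s' h) (ω₁ a : Config d) (e : Edge d) (u : V d) (hg : good g ℓ s k (st ℓ k (site h u))) :
    (F.P s').real {σ : Config d | Far (cls e ((ω₁ ⊔ σ) ⊔ a)) u (2*((2*h+1)*ℓ^k)) ∧
      ¬ Linked g h ℓ s k (cls e ((ω₁ ⊔ σ) ⊔ a)) u (2*((2*h+1)*ℓ^k)+1)} ≤ qf F s' h ^ (2^k-1) := by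
  classical
  have := F.prob s'
  set m : ℕ := (2*h+1)*ℓ^k with hm
  have hfin : (Core g ℓ s k (st ℓ k (site h u))).Finite := by
    refine Set.Finite.subset (box (cen (ℓ^k) (st ℓ k (site h u))) (3*ℓ^k)).finite_toSet ?_
    intro i hi
    have := Core_sub_Rg (by omega) k _ hi
    rw [Finset.mem_coe, mem_box]
    intro κ
    have := this κ
    simp only [cen]; push_cast; exact this
  refine le_trans (measureReal_mono ?_ (measure_ne_top _ _)) (link F h0 h1 h hq (hfin.toFinset.filter fun i => e ∉ edgesIn (tile h i))
    (box u (2*m+1)) u (fun σ => cls e ((ω₁ ⊔ σ) ⊔ a)) ?_ (2^k-1))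
  · rintro σ ⟨hF, hL⟩
    refine ⟨far_vis hs e hg hF _ ?_, ?_⟩
    · intro i hi he
      rw [Finset.mem_filter, Set.Finite.mem_toFinset]
      exact ⟨hi, he⟩
    · intro t ht hfull
      rw [Vis, Finset.mem_filter, Finset.mem_filter, Set.Finite.mem_toFinset] at ht
      refine hL ⟨t, ht.1.1, ?_, ht.2⟩
      intro e' he'
      have hne : e' ≠ e := by rintro rfl; exact ht.1.2 he'
      rw [cls_ne hne]
      simp [hfull e' he']
  · intro σ σ' e' hσ
    by_cases hne : e' = e
    · subst hne; simp
    · rw [cls_ne hne, cls_ne hne]; simp [hσ]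

theorem prod_bound {m1 m2 : Measure (Config d)} [IsProbabilityMeasure m1] [IsProbabilityMeasure m2] {E : Set (Config d × Config d)}
    (hE : MeasurableSet E) {B : Set (Config d)} (hB : MeasurableSet B) {c : ℝ} (hc : 0 ≤ c)
    (h : ∀ ω₁ ∉ B, m2.real {σ | (ω₁, σ) ∈ E} ≤ c) : (m1.prod m2).real E ≤ m1.real B + c := by
  have h1 : (m1.prod m2) E ≤ m1 B + ENNReal.ofReal c := by
    rw [Measure.prod_apply hE]
    calc ∫⁻ x, m2 (Prod.mk x ⁻¹' E) ∂m1 ≤ ∫⁻ x, (B.indicator 1 x + ENNReal.ofReal c) ∂m1 := by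
          refine lintegral_mono fun x => ?_
          by_cases hx : x ∈ B
          · simp only [Set.indicator_of_mem hx, Pi.one_apply]
            exact prob_le_one.trans le_self_add
          · refine le_trans ?_ le_add_self
            have := h x hx
            rw [measureReal_def] at this
            exact (ENNReal.le_ofReal_iff_toReal_le (measure_ne_top _ _) hc).2 this
      _ = m1 B + ENNReal.ofReal c := by
          rw [lintegral_add_right _ measurable_const, lintegral_indicator_one hB]; simp
  rw [measureReal_def, measureReal_def, ← ENNReal.toReal_ofReal hc, ← ENNReal.toReal_add (measure_ne_top _ _) ENNReal.ofReal_ne_top]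
  exact ENNReal.toReal_mono (by simp [measure_ne_top]) h1

/-- the local-uniqueness failure event -/
def LUbad (C m : ℕ) (η : Config d) (u w : V d) : Prop :=
  Far η u (2*m) ∧ Far η w (2*m) ∧ ¬ Reach (restr (box u (C*m)) η) u w

theorem dependsOn_LUbad {C m : ℕ} (hC : 4 ≤ C) (hm : 1 ≤ m) {u w : V d} (hw : w ∈ box u m) :
    DependsOn (fun η => LUbad C m η u w) (edgesIn (box u (C*m)) : Set (Edge d)) := by
  intro ω ω' h
  have e1 : Far ω u (2*m) = Far ω' u (2*m) := dependsOn_far u (2*m) fun e he => h e (by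
    exact_mod_cast edgesIn_mono (box_mono (by nlinarith : 2*m+1 ≤ C*m)) (by exact_mod_cast he))
  have e2 : Far ω w (2*m) = Far ω' w (2*m) := dependsOn_far w (2*m) fun e he => h e (by
    exact_mod_cast edgesIn_mono (box_subset hw (by nlinarith : m + (2*m+1) ≤ C*m)) (by exact_mod_cast he))
  have e3 : restr (box u (C*m)) ω = restr (box u (C*m)) ω' := restr_congr (fun e he => h e he)
  simp only [LUbad, e1, e2, e3]

theorem dependsOn_cls_sup {q : Config d → Prop} {S : Set (Edge d)} (hq : DependsOn q S) (a : Config d) (e : Edge d) :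
    DependsOn (fun ω => q (cls e (ω ⊔ a))) S := by
  intro ω ω' h
  refine hq fun e' he' => ?_
  by_cases hne : e' = e
  · subst hne; simp
  · rw [cls_ne hne, cls_ne hne]; simp [h e' he']

theorem measurableSet_LUbad {C m : ℕ} (hC : 4 ≤ C) (hm : 1 ≤ m) {u w : V d} (hw : w ∈ box u m) (a : Config d) (e : Edge d) :
    MeasurableSet {ω | LUbad C m (cls e (ω ⊔ a)) u w} :=
  measurableSet_of_local _ _ (dependsOn_cls_sup (dependsOn_LUbad hC hm hw) a e)

theorem LU_base (hd : 2 ≤ d) (F : BernoulliFamily d) {p₁ p₀ : ℝ} (hp1 : 0 ≤ p₁) (h10 : p₁ < p₀) (hp0 : p₀ < 1) (hUE : UE (F.P p₁)) {μ : V d → ℝ}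
    (hconv : ASTimeConstant (F.P p₁) μ) :
    ∃ N ℓ C : ℕ, ∃ A b : ℝ, 1 ≤ N ∧ 2 ≤ ℓ ∧ 4 ≤ C ∧ 0 ≤ A ∧ 0 < b ∧ b < 1 ∧ ∀ a e k u w, w ∈ box u (N*ℓ^k) →
      (F.P p₀).real {ω | LUbad C (N*ℓ^k) (cls e (ω ⊔ a)) u w} ≤ A * b^(2^k) := by
  classical
  obtain ⟨C, h, M, K, hC, hM, hgood⟩ := exists_hier F hp1 (by linarith) hUE hconv
  set ℓ := 2*(3+C)+17 with hℓ
  set s := 2*(3+C) with hs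
  have hsl : s + 17 ≤ ℓ := by omega
  obtain ⟨hs0, hs1, hsp⟩ := exists_s h10.le hp0.le (by linarith)
  set s' := (p₀-p₁)/(1-p₁) with hs'
  have hs0' : 0 < s' := div_pos (by linarith) (by linarith)
  have hs1' : s' < 1 := by rw [hs', div_lt_one (by linarith)]; linarith
  obtain ⟨hq0, hq1⟩ := qf_pos (by omega) F hs0' hs1' (h := h) (by omega)
  set q := qf F s' h with hq
  have i1 := F.prob p₁
  have i2 := F.prob s'
  have i3 := F.prob p₀
  refine ⟨2*h+1, ℓ, 5+C, 3^d/(1-p₁) + 2/q, max (1/2) q, by omega, by omega, by omega, ?_, by positivity, by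
    rw [max_lt_iff]; exact ⟨by norm_num, hq1⟩, ?_⟩
  · have : 0 < 1 - p₁ := by linarith
    positivity
  intro a e k u w hw
  set m : ℕ := (2*h+1)*ℓ^k with hm
  have hm1 : 1 ≤ m := Nat.mul_pos (by omega) (by positivity)
  have hE := measurableSet_LUbad (C := 5+C) (m := m) (by omega) hm1 hw a e
  set j0 := st ℓ k (site h u) with hj0
  set Bs : Set (Config d) := {ω | ∃ j ∈ box j0 1, ¬ good (Seed C h M K ω) ℓ s k j} with hBs
  have hmg : ∀ j, MeasurableSet {ω : Config d | ¬ good (Seed C h M K ω) ℓ s k j} := fun j =>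
    measurableSet_of_local _ _ (dependsOn_not (dependsOn_good hC hM (by omega) k j))
  have hBeq : Bs = ⋃ j ∈ box j0 1, {ω : Config d | ¬ good (Seed C h M K ω) ℓ s k j} := by
    ext ω; simp [hBs]
  have hBm : MeasurableSet Bs := by
    rw [hBeq]; exact Finset.measurableSet_biUnion _ fun j _ => hmg j
  have hBp : (F.P p₁).real Bs ≤ 3^d * (1/2)^(2^k) := by
    rw [hBeq]
    refine (measureReal_biUnion_finset_le _ _).trans ?_
    refine (Finset.sum_le_sum fun j _ => hgood k j).trans ?_
    rw [Finset.sum_const, card_box, nsmul_eq_mul]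
    push_cast; norm_num
  have hcm : Measurable (cls e : Config d → Config d) := measurable_cls e
  have hB' : (F.P p₁).real (cls e ⁻¹' Bs) ≤ 3^d * (1/2)^(2^k) / (1-p₁) :=
    (cls_real_le F hp1 (by linarith) e hBm).trans (div_le_div_of_nonneg_right hBp (by linarith))
  rw [← sup_law F hp1 (by linarith) hs0 hs1 hsp, map_measureReal_apply measurable_sup_config hE]
  have key := prod_bound (m1 := F.P p₁) (m2 := F.P s') (measurable_sup_config hE) (hcm hBm) (c := 2 * q^(2^k-1)) (by positivity) (by
    intro ω₁ hω₁
    have hgd : ∀ j ∈ box j0 1, good (Seed C h M K (cls e ω₁)) ℓ s k j := by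
      intro j hj; by_contra hc; exact hω₁ ⟨j, hj, hc⟩
    have hj : st ℓ k (site h w) ∈ box j0 1 := by
      rw [mem_box]
      intro κ
      rw [hj0, st_site, st_site, ← hm]
      have := mem_box.1 hw κ
      exact_mod_cast ediv_near (c := 1) (m := (m:ℤ)) (by omega) (by simpa using this)
    have l1 := link_prob F hs0 hs1 hsl hq0 ω₁ a e u (hgd _ (self_mem_box _ _))
    have l2 := link_prob F hs0 hs1 hsl hq0 ω₁ a e w (hgd _ hj)
    have hsub : {σ | (ω₁, σ) ∈ (fun x : Config d × Config d => x.1 ⊔ x.2) ⁻¹' {ω | LUbad (5+C) m (cls e (ω ⊔ a)) u w}} ⊆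
      {σ : Config d | Far (cls e ((ω₁ ⊔ σ) ⊔ a)) u (2*m) ∧ ¬ Linked (Seed C h M K (cls e ω₁)) h ℓ s k (cls e ((ω₁ ⊔ σ) ⊔ a)) u (2*m+1)} ∪
      {σ : Config d | Far (cls e ((ω₁ ⊔ σ) ⊔ a)) w (2*m) ∧ ¬ Linked (Seed C h M K (cls e ω₁)) h ℓ s k (cls e ((ω₁ ⊔ σ) ⊔ a)) w (2*m+1)} := by
      rintro σ hσ
      replace hσ : LUbad (5+C) m (cls e ((ω₁ ⊔ σ) ⊔ a)) u w := hσ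
      by_contra hc
      rw [Set.mem_union, not_or] at hc
      obtain ⟨hc1, hc2⟩ := hc
      have a1 : Linked (Seed C h M K (cls e ω₁)) h ℓ s k (cls e ((ω₁ ⊔ σ) ⊔ a)) u (2*m+1) := by
        by_contra hh; exact hc1 ⟨hσ.1, hh⟩
      have a2 : Linked (Seed C h M K (cls e ω₁)) h ℓ s k (cls e ((ω₁ ⊔ σ) ⊔ a)) w (2*m+1) := by
        by_contra hh; exact hc2 ⟨hσ.2.1, hh⟩
      exact hσ.2.2 (linked_reach hd hC hM hsl (cls_mono e (le_sup_left.trans le_sup_left)) hw hgd a1 a2)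
    refine (measureReal_mono hsub (measure_ne_top _ _)).trans ((measureReal_union_le _ _).trans ?_)
    linarith)
  refine key.trans ((add_le_add_left hB' _).trans ?_)
  set b := max (1/2) q with hb
  have b1 : (1/2:ℝ)^(2^k) ≤ b^(2^k) := pow_le_pow_left₀ (by norm_num) (le_max_left _ _) _
  have b2 : q^(2^k) ≤ b^(2^k) := pow_le_pow_left₀ hq0.le (le_max_right _ _) _
  have b3 : q^(2^k-1) = q^(2^k) / q := by
    rw [eq_div_iff hq0.ne', ← pow_succ]
    congr 1
    have : 1 ≤ 2^k := Nat.one_le_two_pow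
    omega
  rw [b3]
  have hp : 0 < 1 - p₁ := by linarith
  calc 3^d * (1/2:ℝ)^(2^k) / (1-p₁) + 2 * (q^(2^k)/q) ≤ 3^d * b^(2^k) / (1-p₁) + 2 * (b^(2^k)/q) := by gcongr
    _ = _ := by ring

theorem LU (hd : 2 ≤ d) (F : BernoulliFamily d) {p₁ p₀ : ℝ} (hp1 : 0 ≤ p₁) (h10 : p₁ < p₀) (hp0 : p₀ < 1) (hUE : UE (F.P p₁)) {μ : V d → ℝ}
    (hconv : ASTimeConstant (F.P p₁) μ) :
    ∃ N ℓ C : ℕ, ∃ A b : ℝ, 1 ≤ N ∧ 2 ≤ ℓ ∧ 4 ≤ C ∧ 0 ≤ A ∧ 0 < b ∧ b < 1 ∧ ∀ p, p₀ ≤ p → p ≤ 1 → ∀ a e k u w, w ∈ box u (N*ℓ^k) →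
      (F.P p).real {ω | LUbad C (N*ℓ^k) (cls e (ω ⊔ a)) u w} ≤ A * b^(2^k) := by
  obtain ⟨N, ℓ, C, A, b, hN, hℓ, hC, hA, hb, hb1, H⟩ := LU_base hd F hp1 h10 hp0 hUE hconv
  refine ⟨N, ℓ, C, A, b, hN, hℓ, hC, hA, hb, hb1, ?_⟩
  intro p hpp hp a e k u w hw
  obtain ⟨hs0, hs1, hsp⟩ := exists_s hpp hp hp0
  set s' := (p-p₀)/(1-p₀) with hs'
  have i1 := F.prob p₀
  have i2 := F.prob s'
  have hm1 : 1 ≤ N*ℓ^k := Nat.mul_pos (by omega) (by positivity)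
  have hE := measurableSet_LUbad (C := C) (m := N*ℓ^k) hC hm1 hw a e
  rw [mul_comm] at hsp
  rw [← sup_law F hs0 hs1 (by linarith) hp0.le hsp, map_measureReal_apply measurable_sup_config hE]
  have := prod_bound (m1 := F.P s') (m2 := F.P p₀) (measurable_sup_config hE) MeasurableSet.empty (c := A * b^(2^k)) (by positivity) (by
    intro τ _
    have := H (τ ⊔ a) e k u w hw
    refine le_of_eq_of_le ?_ this
    congr 1
    ext σ
    simp only [Set.mem_preimage, Set.mem_ofPred_eq]
    rw [show τ ⊔ σ ⊔ a = σ ⊔ (τ ⊔ a) by rw [sup_comm τ σ, sup_assoc]])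
  simpa using this

end Perco

namespace Perco
variable {d : ℕ}

/-! ### Chains of bad vertices -/
def Sep (R : ℕ) (U : Finset (V d)) : Prop := ∀ u ∈ U, ∀ v ∈ U, u ≠ v → v ∉ box u (2*R)

def Ev (bad : V d → Prop) (R : ℕ) : ℕ → V d → ℕ → Finset (V d) → Prop
  | 0, _, _, _ => True
  | M+1, x, T, U => ∃ y, dist1 x y ≤ T ∧ bad y ∧ (∀ u ∈ U, y ∉ box u (2*R)) ∧ Ev bad R M y (T - dist1 x y) (U ∪ {y})

theorem box_disj {u v : V d} {R : ℕ} (h : v ∉ box u (2*R)) : Disjoint (box u R) (box v R) := by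
  rw [Finset.disjoint_left]
  intro z h1 h2
  refine h ?_
  have := mem_box_trans h1 (mem_box_comm.1 h2)
  rwa [← two_mul] at this

theorem all_bad_prob (F : BernoulliFamily d) {t : ℝ} (h0 : 0 ≤ t) (h1 : t ≤ 1) {bad : V d → Config d → Prop} {R : ℕ} {π : ℝ}
    (hdep : ∀ y, DependsOn (bad y) (edgesIn (box y R) : Set (Edge d))) (hπ0 : 0 ≤ π) (hπ : ∀ y, (F.P t).real {ω | bad y ω} ≤ π)
    (U : Finset (V d)) (hU : Sep R U) : (F.P t).real {ω | ∀ u ∈ U, bad u ω} ≤ π ^ U.card := by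
  classical
  have := F.prob t
  induction U using Finset.induction_on with
  | empty => simp
  | insert y U hy ih =>
    have e1 : {ω : Config d | ∀ u ∈ insert y U, bad u ω} = {ω | bad y ω ∧ ∀ u ∈ U, bad u ω} := by
      ext ω; simp [Finset.forall_mem_insert]
    have hdis : Disjoint (edgesIn (box y R)) (U.biUnion fun u => edgesIn (box u R)) := by
      rw [Finset.disjoint_biUnion_right]
      intro u hu
      refine disjoint_edgesIn (box_disj (hU y (by simp) u (by simp [hu]) ?_))
      rintro rfl; exact hy hu
    rw [e1, indep_local F h0 h1 hdis (A := bad y) (B := fun ω => ∀ u ∈ U, bad u ω) (hdep y), Finset.card_insert_of_notMem hy, pow_succ, mul_comm]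
    · refine mul_le_mul (ih ?_) (hπ y) measureReal_nonneg (by positivity)
      intro u hu v hv; exact hU u (by simp [hu]) v (by simp [hv])
    · intro ω ω' h
      simp only [eq_iff_iff]
      refine forall_congr' fun u => forall_congr' fun hu => ?_
      have : bad u ω = bad u ω' := hdep u fun e he => h e (by
        exact_mod_cast Finset.mem_biUnion.2 ⟨u, hu, by exact_mod_cast he⟩)
      rw [this]

theorem sum1 (x : ℤ) (T : ℕ) {θ : ℝ} (h0 : 0 ≤ θ) (h1 : θ < 1) : ∑ j ∈ Finset.Icc (x - T) (x + T), θ ^ (x - j).natAbs ≤ 2 / (1 - θ) := by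
  have hm : ∀ j ∈ Finset.Icc (x - T) (x + T), (x - j).natAbs ∈ Finset.range (T+1) := by
    intro j hj
    rw [Finset.mem_Icc] at hj
    rw [Finset.mem_range]
    omega
  rw [← Finset.sum_fiberwise_of_maps_to hm]
  have h2 : ∀ i ∈ Finset.range (T+1), ∑ j ∈ Finset.Icc (x - T) (x + T) with (x - j).natAbs = i, θ ^ (x - j).natAbs ≤ 2 * θ^i := by
    intro i _
    rw [Finset.sum_congr rfl (g := fun _ => θ^i) (by intro j hj; rw [Finset.mem_filter] at hj; rw [hj.2]), Finset.sum_const, nsmul_eq_mul]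
    refine mul_le_mul_of_nonneg_right ?_ (by positivity)
    have : (Finset.filter (fun j => (x - j).natAbs = i) (Finset.Icc (x - T) (x + T))) ⊆ {x - i, x + i} := by
      intro j hj
      rw [Finset.mem_filter] at hj
      simp only [Finset.mem_insert, Finset.mem_singleton]
      omega
    exact_mod_cast (Finset.card_le_card this).trans Finset.card_le_two
  refine (Finset.sum_le_sum h2).trans ?_
  rw [← Finset.mul_sum, show (2:ℝ)/(1-θ) = 2*(1/(1-θ)) by ring]
  refine mul_le_mul_of_nonneg_left ?_ (by norm_num)
  rw [le_div_iff₀ (by linarith), geom_sum_mul_neg]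
  have : 0 ≤ θ^(T+1) := by positivity
  linarith

theorem sum_box (x : V d) (T : ℕ) {θ : ℝ} (h0 : 0 ≤ θ) (h1 : θ < 1) : ∑ y ∈ box x T, θ ^ (dist1 x y) ≤ (2 / (1 - θ))^d := by
  classical
  have e1 : box x T = Fintype.piFinset fun k => Finset.Icc (x k - T) (x k + T) := rfl
  have e2 : ∀ y : V d, θ ^ (dist1 x y) = ∏ i, θ ^ (x i - y i).natAbs := by
    intro y; rw [dist1, Finset.prod_pow_eq_pow_sum]
  rw [e1, Finset.sum_congr rfl fun y _ => e2 y, ← Finset.prod_univ_sum (fun k => Finset.Icc (x k - T) (x k + T)) (fun i j => θ ^ (x i - j).natAbs)]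
  calc _ ≤ ∏ _i : Fin d, (2/(1-θ)) := Finset.prod_le_prod (fun i _ => Finset.sum_nonneg fun _ _ => by positivity) fun i _ => sum1 _ _ h0 h1
    _ = _ := by simp [div_pow]

theorem Ev_prob (F : BernoulliFamily d) {t : ℝ} (h0 : 0 ≤ t) (h1 : t ≤ 1) {bad : V d → Config d → Prop} {R : ℕ} {π : ℝ}
    (hdep : ∀ y, DependsOn (bad y) (edgesIn (box y R) : Set (Edge d))) (hπ0 : 0 ≤ π) (hπ : ∀ y, (F.P t).real {ω | bad y ω} ≤ π)
    {θ : ℝ} (hθ0 : 0 ≤ θ) (hθ1 : θ < 1) (M : ℕ) : ∀ (x : V d) (T : ℕ) (U : Finset (V d)), Sep R U →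
    (F.P t).real {ω | (∀ u ∈ U, bad u ω) ∧ Ev (fun y => bad y ω) R M x T U} * θ^T ≤ π ^ U.card * ((2/(1-θ))^d * π)^M := by
  classical
  have := F.prob t
  induction M with
  | zero =>
    intro x T U hU
    have hb := all_bad_prob F h0 h1 hdep hπ0 hπ U hU
    simp only [Ev, and_true, pow_zero, mul_one]
    calc _ ≤ (F.P t).real {ω | ∀ u ∈ U, bad u ω} * 1 := mul_le_mul_of_nonneg_left (pow_le_one₀ hθ0 hθ1.le) measureReal_nonneg
      _ ≤ _ := by rw [mul_one]; exact hb
  | succ M ih =>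
    intro x T U hU
    set I := (box x T).filter fun y => dist1 x y ≤ T ∧ ∀ u ∈ U, y ∉ box u (2*R) with hI
    have hsub : {ω | (∀ u ∈ U, bad u ω) ∧ Ev (fun y => bad y ω) R (M+1) x T U} ⊆
        ⋃ y ∈ I, {ω | (∀ u ∈ U ∪ {y}, bad u ω) ∧ Ev (fun y => bad y ω) R M y (T - dist1 x y) (U ∪ {y})} := by
      rintro ω ⟨h2, y, hy1, hy2, hy3, hy4⟩
      simp only [Set.mem_iUnion]
      refine ⟨y, by rw [hI, Finset.mem_filter]; exact ⟨mem_box_of_dist1 hy1, hy1, hy3⟩, ?_, hy4⟩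
      intro u hu
      rw [Finset.mem_union, Finset.mem_singleton] at hu
      rcases hu with hu | rfl
      · exact h2 u hu
      · exact hy2
    have hle := (measureReal_mono hsub (measure_ne_top _ _)).trans (measureReal_biUnion_finset_le (μ := F.P t) I _)
    refine (mul_le_mul_of_nonneg_right hle (by positivity)).trans ?_
    rw [Finset.sum_mul]
    have hterm : ∀ y ∈ I, (F.P t).real {ω | (∀ u ∈ U ∪ {y}, bad u ω) ∧ Ev (fun y => bad y ω) R M y (T - dist1 x y) (U ∪ {y})} * θ^T ≤
        (π ^ (U.card + 1) * ((2/(1-θ))^d * π)^M) * θ^(dist1 x y) := by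
      intro y hy
      rw [hI, Finset.mem_filter] at hy
      obtain ⟨_, hy1, hy2⟩ := hy
      have hyU : y ∉ U := fun h => hy2 y h (self_mem_box _ _)
      have hsep : Sep R (U ∪ {y}) := by
        intro u hu v hv huv
        simp only [Finset.mem_union, Finset.mem_singleton] at hu hv
        rcases hu with hu | rfl <;> rcases hv with hv | rfl
        · exact hU u hu v hv huv
        · exact hy2 u hu
        · rw [mem_box_comm]; exact hy2 v hv
        · exact absurd rfl huv
      have := ih y (T - dist1 x y) (U ∪ {y}) hsep
      have hcard : (U ∪ {y}).card = U.card + 1 := by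
        rw [Finset.union_comm, ← Finset.insert_eq, Finset.card_insert_of_notMem hyU]
      rw [hcard] at this
      have hT : θ^T = θ^(T - dist1 x y) * θ^(dist1 x y) := by rw [← pow_add]; congr 1; omega
      rw [hT, ← mul_assoc]
      exact mul_le_mul_of_nonneg_right this (by positivity)
    refine (Finset.sum_le_sum hterm).trans ?_
    rw [← Finset.mul_sum]
    have hs : ∑ y ∈ I, θ^(dist1 x y) ≤ (2/(1-θ))^d :=
      (Finset.sum_le_sum_of_subset_of_nonneg (Finset.filter_subset _ _) fun _ _ _ => by positivity).trans (sum_box x T hθ0 hθ1)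
    have hA : 0 ≤ 2/(1-θ) := div_nonneg (by norm_num) (by linarith)
    calc _ ≤ (π ^ (U.card + 1) * ((2/(1-θ))^d * π)^M) * (2/(1-θ))^d := mul_le_mul_of_nonneg_left hs (by positivity)
      _ = _ := by ring

theorem Ev_bound (F : BernoulliFamily d) {t : ℝ} (h0 : 0 ≤ t) (h1 : t ≤ 1) {bad : V d → Config d → Prop} {R : ℕ} {π : ℝ}
    (hdep : ∀ y, DependsOn (bad y) (edgesIn (box y R) : Set (Edge d))) (hπ0 : 0 ≤ π) (hπ : ∀ y, (F.P t).real {ω | bad y ω} ≤ π)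
    {L M B : ℕ} (hL : 2 ≤ L) (hM : 1 ≤ M) (hB : B ≤ M * L) :
    (F.P t).real {ω | Ev (fun y => bad y ω) R M 0 B ∅} ≤ 8 * (2*L)^d * π := by
  have := F.prob t
  have hL' : (2:ℝ) ≤ L := by exact_mod_cast hL
  set θ : ℝ := 1 - 1/L with hθ
  have hL1 : (1:ℝ)/L ≤ 1/2 := one_div_le_one_div_of_le (by norm_num) hL'
  have hL2 : 0 < (1:ℝ)/L := by positivity
  have hθ0 : 0 < θ := by linarith
  have hθ1 : θ < 1 := by linarith
  have key := Ev_prob F h0 h1 hdep hπ0 hπ hθ0.le hθ1 M 0 B ∅ (by intro u hu; simp at hu)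
  have e : 2/(1-θ) = 2*L := by rw [hθ]; field_simp; ring
  simp only [e, Finset.notMem_empty, false_implies, implies_true, true_and, Finset.card_empty, pow_zero, one_mul] at key
  set P := (F.P t).real {ω | Ev (fun y => bad y ω) R M 0 B ∅} with hP
  set a := (2*(L:ℝ))^d * π with ha
  have ha0 : 0 ≤ a := by positivity
  have h8 : 1 ≤ 8 * θ^L := by
    have h2 : Real.exp (-(2/L)) ≤ θ := by
      have := Real.add_one_le_exp (2/(L:ℝ))
      rw [Real.exp_neg]
      rw [inv_le_comm₀ (Real.exp_pos _) hθ0]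
      refine le_trans ?_ this
      rw [inv_le_iff_one_le_mul₀ hθ0, hθ]
      have : (2:ℝ)/L = 2 * (1/L) := by ring
      rw [this]
      nlinarith
    have h3 : Real.exp (-2) ≤ θ^L := by
      calc Real.exp (-2) = Real.exp (-(2/L))^L := by
            rw [← Real.exp_nat_mul]; congr 1; field_simp
        _ ≤ θ^L := pow_le_pow_left₀ (Real.exp_pos _).le h2 _
    have h4 : Real.exp 2 ≤ 8 := by
      have : Real.exp 2 = Real.exp 1 ^ 2 := by rw [← Real.exp_nat_mul]; norm_num
      rw [this]
      have := Real.exp_one_lt_d9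
      have h5 := Real.exp_pos 1
      nlinarith
    have h5 : Real.exp 2 * Real.exp (-2) = 1 := by rw [← Real.exp_add]; norm_num
    have h6 := Real.exp_pos (-2)
    nlinarith
  have hPM : P ≤ (8 * a)^M := by
    have h9 : 1 ≤ 8^M * θ^B := by
      calc (1:ℝ) ≤ (8 * θ^L)^M := one_le_pow₀ h8
        _ = 8^M * θ^(M*L) := by rw [mul_pow, ← pow_mul, mul_comm L M]
        _ ≤ 8^M * θ^B := mul_le_mul_of_nonneg_left (pow_le_pow_of_le_one hθ0.le hθ1.le hB) (by positivity)
    calc P = P * 1 := (mul_one _).symm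
      _ ≤ P * (8^M * θ^B) := mul_le_mul_of_nonneg_left h9 measureReal_nonneg
      _ = 8^M * (P * θ^B) := by ring
      _ ≤ 8^M * a^M := mul_le_mul_of_nonneg_left key (by positivity)
      _ = _ := (mul_pow _ _ _).symm
  have : 8 * (2*(L:ℝ))^d * π = 8 * a := by rw [ha]; ring
  rw [this]
  rcases le_total (8*a) 1 with h | h
  · refine hPM.trans ?_
    calc (8*a)^M ≤ (8*a)^1 := pow_le_pow_of_le_one (by positivity) h hM
      _ = _ := pow_one _
  · exact measureReal_le_one.trans h

theorem Ev_of_path {bad : V d → Prop} {R n : ℕ} {f : ℕ → V d} (hf : ∀ s t, s ≤ t → t ≤ n → dist1 (f s) (f t) ≤ t - s) (M : ℕ) :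
    ∀ (i : ℕ) (T : ℕ) (U D : Finset (V d)), i ≤ n → n - i ≤ T → (∀ y ∈ D, bad y ∧ (∀ u ∈ U, y ∉ box u (2*R)) ∧ ∃ t, i ≤ t ∧ t ≤ n ∧ f t = y) →
      M * (4*R+1)^d ≤ D.card → Ev bad R M (f i) T U := by
  classical
  induction M with
  | zero => intros; trivial
  | succ M ih =>
    intro i T U D hin hT hD hcard
    have hpos : 0 < (4*R+1)^d := by positivity
    have hne : D.Nonempty := by
      rw [← Finset.card_pos]; nlinarith
    have hex : ∃ t, i ≤ t ∧ t ≤ n ∧ f t ∈ D := by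
      obtain ⟨y, hy⟩ := hne
      obtain ⟨-, -, t, h1, h2, h3⟩ := hD y hy
      exact ⟨t, h1, h2, h3 ▸ hy⟩
    obtain ⟨h1, h2, h3⟩ := Nat.find_spec hex
    have hmin : ∀ t, i ≤ t → t ≤ n → f t ∈ D → Nat.find hex ≤ t := fun t a b c => Nat.find_min' hex ⟨a, b, c⟩
    set t0 := Nat.find hex with ht0
    have hdist := hf i t0 h1 h2
    refine ⟨f t0, by omega, (hD _ h3).1, (hD _ h3).2.1, ?_⟩
    refine ih t0 _ _ (D \ box (f t0) (2*R)) h2 (by omega) ?_ ?_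
    · intro y hy
      rw [Finset.mem_sdiff] at hy
      obtain ⟨a1, a2, t, a3, a4, a5⟩ := hD y hy.1
      refine ⟨a1, ?_, t, hmin t a3 a4 (a5 ▸ hy.1), a4, a5⟩
      intro u hu
      rw [Finset.mem_union, Finset.mem_singleton] at hu
      rcases hu with hu | rfl
      · exact a2 u hu
      · exact hy.2
    · have e1 := Finset.le_card_sdiff (box (f t0) (2*R)) D
      rw [card_box] at e1
      have e2 : (2*(2*R)+1)^d = (4*R+1)^d := by congr 1; ring
      rw [e2] at e1
      have e3 : (M+1) * (4*R+1)^d = M * (4*R+1)^d + (4*R+1)^d := by ring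
      omega

end Perco

namespace Perco
variable {d : ℕ}

/-! ### Consequences of local uniqueness -/
structure LUP (F : BernoulliFamily d) (p₀ : ℝ) (N ℓ C : ℕ) (A b : ℝ) : Prop where
  hN : 1 ≤ N
  hℓ : 2 ≤ ℓ
  hC : 4 ≤ C
  hA : 0 ≤ A
  hb : 0 < b
  hb1 : b < 1
  lu : ∀ p, p₀ ≤ p → p ≤ 1 → ∀ a e k u w, w ∈ box u (N*ℓ^k) →
      (F.P p).real {ω | LUbad C (N*ℓ^k) (cls e (ω ⊔ a)) u w} ≤ A * b^(2^k)

variable {F : BernoulliFamily d} {p₀ : ℝ} {N ℓ C : ℕ} {A b : ℝ}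

theorem LUP.hm (h : LUP F p₀ N ℓ C A b) (k : ℕ) : 1 ≤ N * ℓ^k := by
  have h1 := h.hN
  have h2 : 1 ≤ ℓ^k := Nat.one_le_pow _ _ (by have := h.hℓ; omega)
  nlinarith

theorem LUP.plain (hd : 1 ≤ d) (h : LUP F p₀ N ℓ C A b) {p : ℝ} (hp0 : p₀ ≤ p) (hp1 : p ≤ 1) (k : ℕ) {u w : V d} (hw : w ∈ box u (N*ℓ^k)) :
    (F.P p).real {ω | LUbad C (N*ℓ^k) ω u w} ≤ A * b^(2^k) := by
  set m := N*ℓ^k with hm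
  set z : V d := fun i => u i + (C*m+1:ℕ) with hz
  set e : Edge d := mkE z (z + Pi.single ⟨0, hd⟩ 1) (dist1_single _ _) with he
  have hne : e ∉ edgesIn (box u (C*m)) := by
    rw [he, mkE_mem_edgesIn]
    rintro ⟨h1, -⟩
    have := mem_box.1 h1 ⟨0, hd⟩
    rw [abs_le] at this
    simp only [hz] at this
    push_cast at this
    omega
  have := h.lu p hp0 hp1 ⊥ e k u w hw
  convert this using 4 with ω
  have h2 : LUbad C m ω u w = LUbad C m (cls e (ω ⊔ ⊥)) u w := dependsOn_LUbad h.hC (h.hm k) hw fun e' he' => by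
    rw [cls_ne (by rintro rfl; exact hne (by exact_mod_cast he'))]; simp
  rw [← hm, h2]

theorem tendsto_dexp {b : ℝ} (hb : 0 < b) (hb1 : b < 1) (A : ℝ) : Tendsto (fun k : ℕ => A * b^(2^k)) atTop (𝓝 0) := by
  have h1 : Tendsto (fun k : ℕ => 2^k) atTop atTop := tendsto_pow_atTop_atTop_of_one_lt (by norm_num)
  have := ((tendsto_pow_atTop_nhds_zero_of_lt_one hb.le hb1).comp h1).const_mul A
  simpa using this

theorem LUP.m_ge (h : LUP F p₀ N ℓ C A b) (k : ℕ) : k ≤ N * ℓ^k := by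
  have h1 : k < ℓ^k := Nat.lt_pow_self (by have := h.hℓ; omega)
  have := h.hN
  nlinarith

theorem LUP.ue (hd : 1 ≤ d) (h : LUP F p₀ N ℓ C A b) (hp₀ : 0 ≤ p₀) {p₁ : ℝ} (hp1 : 0 ≤ p₁) (h10 : p₁ ≤ p₀) (hUE : UE (F.P p₁))
    {p : ℝ} (hp : p₀ ≤ p) (hp1' : p ≤ 1) : UE (F.P p) := by
  have := F.prob p
  constructor
  · unfold UniqAS
    rw [ae_all_iff]; intro x
    rw [ae_all_iff]; intro y
    rw [ae_iff]
    have hz : (F.P p).real {ω | ¬ (Inf ω x → Inf ω y → Reach ω x y)} ≤ 0 := by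
      refine ge_of_tendsto (tendsto_dexp h.hb h.hb1 A) ?_
      filter_upwards [eventually_ge_atTop (dist1 x y)] with k hk
      have hw : y ∈ box x (N*ℓ^k) := mem_box_of_dist1 (hk.trans (h.m_ge k))
      refine le_trans (measureReal_mono ?_ (measure_ne_top _ _)) (h.plain hd hp hp1' k hw)
      intro ω hω
      have hω : ¬ (Inf ω x → Inf ω y → Reach ω x y) := hω
      push Not at hω
      exact ⟨inf_iff.1 hω.1 _, inf_iff.1 hω.2.1 _, fun hr => hω.2.2 (hr.mono (restr_le _ _))⟩
    have h2 := le_antisymm hz measureReal_nonneg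
    rwa [measureReal_eq_zero_iff (measure_ne_top _ _)] at h2
  · have h1 := hUE.2
    have := F.prob p₁
    have e1 : F.P p₁ {ω | ∃ x, Inf ω x} = 1 := by
      rwa [prob_compl_eq_zero_iff measurableSet_exinf |>.symm]
    have e2 := prob_mono F hp1 (h10.trans hp) hp1' measurableSet_exinf (fun ω ω' hle ⟨x, hx⟩ => ⟨x, hx.mono hle⟩)
    rw [e1] at e2
    have e3 := le_antisymm prob_le_one e2
    rwa [← prob_compl_eq_zero_iff measurableSet_exinf] at e3

def BadV (C m : ℕ) (a : Config d) (z : V d) (ω : Config d) : Prop :=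
  ∃ w, ∃ h : dist1 z w = 1, LUbad C m (cls (mkE z w h) (ω ⊔ a)) z w

theorem dependsOn_BadV (hC : 4 ≤ C) {m : ℕ} (hm : 1 ≤ m) (a : Config d) (z : V d) :
    DependsOn (BadV C m a z) (edgesIn (box z (C*m)) : Set (Edge d)) := by
  intro ω ω' h
  unfold BadV
  simp only [eq_iff_iff]
  refine exists_congr fun w => exists_congr fun hw => ?_
  have : LUbad C m (cls (mkE z w hw) (ω ⊔ a)) z w = LUbad C m (cls (mkE z w hw) (ω' ⊔ a)) z w :=
    dependsOn_cls_sup (dependsOn_LUbad hC hm (mem_box_of_dist1 (hw.le.trans hm))) a _ h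
  rw [this]

theorem LUP.badV (h : LUP F p₀ N ℓ C A b) {p : ℝ} (hp0 : p₀ ≤ p) (hp1 : p ≤ 1) (k : ℕ) (a : Config d) (z : V d) :
    (F.P p).real {ω | BadV C (N*ℓ^k) a z ω} ≤ 3^d * A * b^(2^k) := by
  classical
  have := F.prob p
  have hsub : {ω | BadV C (N*ℓ^k) a z ω} ⊆ ⋃ w ∈ box z 1, {ω | ∃ h : dist1 z w = 1, LUbad C (N*ℓ^k) (cls (mkE z w h) (ω ⊔ a)) z w} := by
    rintro ω ⟨w, hw, hb⟩
    simp only [Set.mem_iUnion]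
    exact ⟨w, mem_box_of_dist1 hw.le, hw, hb⟩
  refine (measureReal_mono hsub (measure_ne_top _ _)).trans ((measureReal_biUnion_finset_le _ _).trans ?_)
  have hAb : 0 ≤ A * b^(2^k) := mul_nonneg h.hA (pow_nonneg h.hb.le _)
  refine (Finset.sum_le_card_nsmul _ _ (A * b^(2^k)) fun w _ => ?_).trans ?_
  · by_cases hw : dist1 z w = 1
    · simp only [hw, exists_true_left]
      exact h.lu p hp0 hp1 a _ k z w (mem_box_of_dist1 (hw.le.trans (h.hm k)))
    · simp only [hw]; simpa using hAb
  · rw [card_box, nsmul_eq_mul]; push_cast; norm_num; rw [mul_assoc]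

end Perco

namespace Perco
variable {d : ℕ}

/-! ### The truncated distance between two opened boxes -/
open Classical in
noncomputable def aC (y : V d) (r : ℕ) : Config d := fun e => decide (e ∈ edgesIn (box 0 r) ∨ e ∈ edgesIn (box y r))

noncomputable def XX (y : V d) (r B : ℕ) (ω : Config d) : ℝ := (min (chemDist (ω ⊔ aC y r) 0 y) (B : ℝ≥0∞)).toReal

theorem XX_nonneg (y : V d) (r B : ℕ) (ω : Config d) : 0 ≤ XX y r B ω := ENNReal.toReal_nonneg

theorem XX_le (y : V d) (r B : ℕ) (ω : Config d) : XX y r B ω ≤ B := by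
  have : min (chemDist (ω ⊔ aC y r) 0 y) (B : ℝ≥0∞) ≤ B := min_le_right _ _
  simpa [XX] using ENNReal.toReal_mono (by simp) this

theorem XX_anti (y : V d) (r B : ℕ) {ω ω' : Config d} (h : ω ≤ ω') : XX y r B ω' ≤ XX y r B ω := by
  refine ENNReal.toReal_mono (ne_top_of_le_ne_top (by simp) (min_le_right _ (B : ℝ≥0∞))) ?_
  exact min_le_min_right _ (chemDist_anti (sup_le_sup_right h _) _ _)

theorem min_chem_restr (η : Config d) (y : V d) (B : ℕ) :
    min (chemDist η 0 y) (B : ℝ≥0∞) = min (chemDist (restr (box (0 : V d) B) η) 0 y) B := by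
  refine le_antisymm (min_le_min_right _ (chemDist_anti (restr_le _ _) _ _)) ?_
  rcases le_or_gt (B : ℝ≥0∞) (chemDist η 0 y) with h | h
  · rw [min_eq_right h]; exact min_le_right _ _
  · rw [min_eq_left h.le]
    obtain ⟨n, hn⟩ := chemDist_eq_nat (connected_iff.1 h.ne_top)
    rw [hn] at h ⊢
    have hnB : n ≤ B := by exact_mod_cast h.le
    exact (min_le_left _ _).trans ((chemDist_le_iff_restr hnB).1 hn.le)

theorem dependsOn_XX (y : V d) (r B : ℕ) : DependsOn (XX y r B) (edgesIn (box (0 : V d) B) : Set (Edge d)) := by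
  intro ω ω' h
  unfold XX
  rw [min_chem_restr, min_chem_restr (ω' ⊔ _)]
  have : restr (box (0 : V d) B) (ω ⊔ aC y r) = restr (box (0 : V d) B) (ω' ⊔ aC y r) := restr_congr fun e he => by
    simp [h e (by exact_mod_cast he)]
  rw [this]

theorem path_chem {η : Config d} {f : ℕ → V d} {s t : ℕ} (hst : s ≤ t) (h : ∀ i, s ≤ i → i < t → (gr η).Adj (f i) (f (i+1))) :
    chemDist η (f s) (f t) ≤ (t - s : ℕ) := by
  induction t, hst using Nat.le_induction with
  | base => simp [chemDist_self]
  | succ t hst ih =>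
    have h1 := ih fun i a b => h i a (by omega)
    have h2 : chemDist η (f t) (f (t+1)) ≤ (1:ℕ) := chemDist_le_iff.2 ⟨(h t hst (by omega)).toWalk, by simp⟩
    calc _ ≤ _ := chemDist_triangle η _ (f t) _
      _ ≤ ((t - s : ℕ) : ℝ≥0∞) + (1:ℕ) := add_le_add h1 h2
      _ = _ := by rw [← Nat.cast_add]; congr 1; omega

theorem reach_of_chem {η : Config d} {x y : V d} {n : ℕ} (h : chemDist η x y ≤ n) : Reach η x y :=
  connected_iff.1 (ne_top_of_le_ne_top (by simp) h)

theorem far_of_box (hd : 1 ≤ d) {η : Config d} {c u : V d} {r m : ℕ} (ho : ∀ e ∈ edgesIn (box c r), η e = true) (hr : Reach η c u)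
    (hm : 2*m < r*1) : Far η u (2*m) := by
  have hR : ∀ v ∈ box c r, Reach η u v := by
    intro v hv
    obtain ⟨w, -⟩ := box_walk ho _ c v rfl (self_mem_box _ _) hv
    exact hr.symm.trans (Reach.mono (restr_le _ _) ⟨w⟩)
  have h1 : (fun i => c i + r) ∈ box c r := mem_box.2 fun k => by simp
  have h2 : (fun i => c i - r) ∈ box c r := mem_box.2 fun k => by simp
  by_contra hcon
  have h3 : ∀ v ∈ box c r, v ∈ box u (2*m) := by
    intro v hv
    by_contra hv2
    exact hcon ⟨v, hR v hv, hv2⟩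
  have a1 := mem_box.1 (h3 _ h1) ⟨0, hd⟩
  have a2 := mem_box.1 (h3 _ h2) ⟨0, hd⟩
  rw [abs_le] at a1 a2
  push_cast at a1 a2
  omega

/-- geodesic path data -/
structure Geo (η : Config d) (y : V d) (D : ℕ) (f : ℕ → V d) : Prop where
  f0 : f 0 = 0
  fD : f D = y
  adj : ∀ i < D, (gr η).Adj (f i) (f (i+1))
  hD : chemDist η 0 y = D

theorem exists_geo {η : Config d} {y : V d} (h : chemDist η 0 y ≠ ⊤) : ∃ D f, Geo η y D f := by
  obtain ⟨w, hw⟩ := exists_walk_chemDist (connected_iff.1 h)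
  obtain ⟨f, h1, h2, h3⟩ := walk_to_path w
  exact ⟨w.length, f, h2, h3, h1, hw.symm⟩

theorem Geo.inj {η : Config d} {y : V d} {D : ℕ} {f : ℕ → V d} (g : Geo η y D f) {s t : ℕ} (hst : s < t) (ht : t ≤ D) : f s ≠ f t := by
  intro he
  have h1 : chemDist η (f 0) (f s) ≤ (s - 0 : ℕ) := path_chem (Nat.zero_le _) fun i _ hi => g.adj i (by omega)
  have h2 : chemDist η (f t) (f D) ≤ (D - t : ℕ) := path_chem ht fun i _ hi => g.adj i hi
  have h3 := chemDist_triangle η 0 (f s) y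
  rw [g.f0] at h1; rw [g.fD, ← he] at h2
  rw [g.hD] at h3
  have h4 : (D : ℝ≥0∞) ≤ ((s - 0 + (D - t) : ℕ) : ℝ≥0∞) := by
    push_cast
    refine h3.trans ?_
    have := add_le_add h1 h2
    exact_mod_cast this
  have : D ≤ s - 0 + (D - t) := by exact_mod_cast h4
  omega

theorem Geo.dist {η : Config d} {y : V d} {D : ℕ} {f : ℕ → V d} (g : Geo η y D f) (s t : ℕ) (hst : s ≤ t) (ht : t ≤ D) :
    dist1 (f s) (f t) ≤ t - s := by
  have h1 : chemDist η (f s) (f t) ≤ (t - s : ℕ) := path_chem hst fun i _ hi => g.adj i (by omega)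
  have := (dist1_le_chemDist η (f s) (f t)).trans h1
  exact_mod_cast this

theorem Geo.avoid {η : Config d} {y : V d} {D : ℕ} {f : ℕ → V d} (g : Geo η y D f) {t : ℕ} (ht : t < D) (h : dist1 (f t) (f (t+1)) = 1)
    {i : ℕ} (hi : i < D) (hit : i ≠ t) : (gr (cls (mkE _ _ h) η)).Adj (f i) (f (i+1)) := by
  obtain ⟨h1, h2⟩ := adj_iff.1 (g.adj i hi)
  refine adj_iff.2 ⟨h1, ?_⟩
  rw [cls_ne, h2]
  intro he
  have := congrArg ends he
  rw [ends_mkE, ends_mkE, Sym2.eq_iff] at this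
  rcases lt_or_gt_of_ne hit with hlt | hlt
  · rcases this with h3 | h3
    · exact g.inj hlt (by omega) h3.1
    · exact g.inj (by omega : i < t+1) (by omega) h3.1
  · rcases this with h3 | h3
    · exact g.inj hlt (by omega) h3.1.symm
    · exact g.inj (by omega : t < i+1) (by omega) h3.2.symm

theorem cls_sup {e : Edge d} {ω a : Config d} (h : a e = false) : cls e ω ⊔ a = cls e (ω ⊔ a) := by
  funext e'
  by_cases he : e' = e
  · subst he; simp [h]
  · simp [cls_ne he]

theorem Geo.bypass (hd : 1 ≤ d) {ω : Config d} {y : V d} {D : ℕ} {f : ℕ → V d} {r C m : ℕ} (g : Geo (ω ⊔ aC y r) y D f) {t : ℕ} (ht : t < D)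
    (h : dist1 (f t) (f (t+1)) = 1) (ha : aC y r (mkE _ _ h) = false) (hm : 2*m < r) (hb : ¬ BadV C m (aC y r) (f t) ω) (B : ℕ) :
    XX y r B (cls (mkE _ _ h) ω) - XX y r B ω ≤ ((2*(C*m)+1)^d : ℕ) := by
  set η := cls (mkE _ _ h) (ω ⊔ aC y r) with hη
  have hop : ∀ e, aC y r e = true → η e = true := by
    intro e he
    rw [hη, cls_ne (by rintro rfl; rw [he] at ha; simp at ha)]; simp [he]
  have h1 : chemDist η (f 0) (f t) ≤ (t - 0 : ℕ) := path_chem (Nat.zero_le _) fun i _ hi => g.avoid ht h (by omega) (by omega)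
  have h2 : chemDist η (f (t+1)) (f D) ≤ (D - (t+1) : ℕ) := path_chem (by omega) fun i hi _ => g.avoid ht h (by omega) (by omega)
  rw [g.f0] at h1; rw [g.fD] at h2
  have F1 : Far η (f t) (2*m) := far_of_box hd (c := 0) (r := r) (fun e he => hop e (by simp [aC, he])) (reach_of_chem h1) (by omega)
  have F2 : Far η (f (t+1)) (2*m) := far_of_box hd (c := y) (r := r) (fun e he => hop e (by simp [aC, he])) (reach_of_chem h2).symm (by omega)
  have hr : Reach (restr (box (f t) (C*m)) η) (f t) (f (t+1)) := by
    by_contra hcon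
    exact hb ⟨_, h, F1, F2, hcon⟩
  have h3 := chemDist_le_card hr (self_mem_box _ _)
  rw [card_box] at h3
  have h4 : chemDist η 0 y ≤ chemDist (ω ⊔ aC y r) 0 y + ((2*(C*m)+1)^d : ℕ) := by
    rw [g.hD]
    calc _ ≤ chemDist η 0 (f t) + (chemDist η (f t) (f (t+1)) + chemDist η (f (t+1)) y) :=
          (chemDist_triangle η _ (f t) _).trans (add_le_add le_rfl (chemDist_triangle η _ (f (t+1)) _))
      _ ≤ ((t-0:ℕ):ℝ≥0∞) + ((((2*(C*m)+1)^d : ℕ)) + ((D - (t+1):ℕ):ℝ≥0∞)) := add_le_add h1 (add_le_add h3 h2)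
      _ ≤ _ := by
        rw [← Nat.cast_add, ← Nat.cast_add, ← Nat.cast_add]
        exact_mod_cast (by omega : t - 0 + ((2*(C*m)+1)^d + (D - (t+1))) ≤ D + (2*(C*m)+1)^d)
  rw [sub_le_iff_le_add']
  unfold XX
  rw [cls_sup ha]
  have hne : min (chemDist (ω ⊔ aC y r) 0 y) (B:ℝ≥0∞) ≠ ⊤ := ne_top_of_le_ne_top (by simp) (min_le_right _ (B : ℝ≥0∞))
  rw [← ENNReal.toReal_natCast ((2*(C*m)+1)^d), ← ENNReal.toReal_add hne (ENNReal.natCast_ne_top _)]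
  refine ENNReal.toReal_mono (ENNReal.add_ne_top.2 ⟨hne, ENNReal.natCast_ne_top _⟩) ?_
  rw [min_add]
  exact min_le_min h4 (by simp)

theorem scale_select (bad : ℕ → Prop) [DecidablePred bad] (Q : ℕ → ℝ) (hQ : ∀ k, 0 ≤ Q k) (B Δ : ℝ) (hB0 : 0 ≤ B) (j : ℕ) (h : ∀ k ≤ j, ¬ bad k → Δ ≤ Q k) (hB : Δ ≤ B) :
    Δ ≤ Q 0 + ∑ k ∈ Finset.range j, Q (k+1) * (if bad k then 1 else 0) + B * (if bad j then 1 else 0) := by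
  have hs : 0 ≤ ∑ k ∈ Finset.range j, Q (k+1) * (if bad k then (1:ℝ) else 0) :=
    Finset.sum_nonneg fun k _ => mul_nonneg (hQ _) (by split_ifs <;> norm_num)
  have h0 := hQ 0
  by_cases hex : ∃ k, k ≤ j ∧ ¬ bad k
  · have hsp := Nat.find_spec hex
    have hmin : ∀ k, k < Nat.find hex → k ≤ j → bad k := fun k hk hkj => by
      have := Nat.find_min hex hk
      tauto
    have hl : 0 ≤ B * (if bad j then (1:ℝ) else 0) := mul_nonneg hB0 (by split_ifs <;> norm_num)
    have hΔ := h _ hsp.1 hsp.2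
    rcases hk : Nat.find hex with _ | k
    · rw [hk] at hΔ; linarith
    · rw [hk] at hΔ hsp hmin
      have hbk := hmin k (by omega) (by omega)
      have := Finset.single_le_sum (f := fun k => Q (k+1) * (if bad k then (1:ℝ) else 0)) (fun k _ => mul_nonneg (hQ _) (by split_ifs <;> norm_num))
        (Finset.mem_range.2 (by omega : k < j))
      simp only [hbk, if_true, mul_one] at this
      linarith
  · push Not at hex
    rw [if_pos (hex j le_rfl)]
    linarith

open Classical in
theorem delta_le (hd : 1 ≤ d) {ω : Config d} {y : V d} {D : ℕ} {f : ℕ → V d} {r C : ℕ} {m : ℕ → ℕ} (g : Geo (ω ⊔ aC y r) y D f)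
    (j : ℕ) (hm : ∀ k ≤ j, 2 * m k < r) (B : ℕ) (e : Edge d) :
    XX y r B (cls e ω) - XX y r B ω ≤ ∑ t ∈ Finset.range D, if ends e = s(f t, f (t+1)) then
      (((2*(C*m 0)+1)^d : ℕ) : ℝ) + ∑ k ∈ Finset.range j, (((2*(C*m (k+1))+1)^d : ℕ):ℝ) * (if BadV C (m k) (aC y r) (f t) ω then 1 else 0)
        + B * (if BadV C (m j) (aC y r) (f t) ω then 1 else 0) else 0 := by
  have hnn : ∀ t, 0 ≤ (((2*(C*m 0)+1)^d : ℕ) : ℝ) + ∑ k ∈ Finset.range j, (((2*(C*m (k+1))+1)^d : ℕ):ℝ) * (if BadV C (m k) (aC y r) (f t) ω then 1 else 0)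
        + B * (if BadV C (m j) (aC y r) (f t) ω then 1 else 0) := fun t => by
    refine add_nonneg (add_nonneg (by positivity) (Finset.sum_nonneg fun k _ => mul_nonneg (by positivity) ?_)) (mul_nonneg (by positivity) ?_) <;>
      split_ifs <;> norm_num
  have hs0 : ∀ t ∈ Finset.range D, 0 ≤ if ends e = s(f t, f (t+1)) then
      (((2*(C*m 0)+1)^d : ℕ) : ℝ) + ∑ k ∈ Finset.range j, (((2*(C*m (k+1))+1)^d : ℕ):ℝ) * (if BadV C (m k) (aC y r) (f t) ω then 1 else 0)
        + B * (if BadV C (m j) (aC y r) (f t) ω then 1 else 0) else 0 := by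
    intro t _
    by_cases hc : ends e = s(f t, f (t+1))
    · rw [if_pos hc]; exact hnn t
    · rw [if_neg hc]
  by_cases hon : ∃ t < D, ends e = s(f t, f (t+1))
  · obtain ⟨t, ht, he⟩ := hon
    refine le_trans ?_ (Finset.single_le_sum hs0 (Finset.mem_range.2 ht))
    rw [if_pos he]
    have hdist : dist1 (f t) (f (t+1)) = 1 := (adj_iff.1 (g.adj t ht)).1
    obtain rfl : e = mkE _ _ hdist := ends_injective he
    by_cases ha : aC y r (mkE _ _ hdist) = false
    · refine scale_select (fun k => BadV C (m k) (aC y r) (f t) ω) (fun k => (((2*(C*m k)+1)^d : ℕ):ℝ)) (fun k => by positivity) B _ (by positivity) j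
        (fun k hk hb => g.bypass hd ht hdist ha (hm k hk) hb B) ?_
      have h1 := XX_le y r B (cls (mkE _ _ hdist) ω)
      have h2 := XX_nonneg y r B ω
      linarith
    · have h3 : cls (mkE _ _ hdist) ω ⊔ aC y r = ω ⊔ aC y r := by
        funext e'
        by_cases he' : e' = mkE _ _ hdist
        · subst he'; simp at ha; simp [ha]
        · simp [cls_ne he']
      refine le_trans (le_of_eq ?_) (hnn t)
      unfold XX; rw [h3, sub_self]
  · refine le_trans ?_ (Finset.sum_nonneg hs0)
    push Not at hon
    have h4 : chemDist (cls e ω ⊔ aC y r) (f 0) (f D) ≤ (D - 0 : ℕ) := path_chem (Nat.zero_le _) fun i _ hi => by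
      obtain ⟨h1, h2⟩ := adj_iff.1 (g.adj i hi)
      refine adj_iff.2 ⟨h1, ?_⟩
      have : mkE _ _ h1 ≠ e := by rintro rfl; exact hon i hi rfl
      simp only [Pi.sup_apply] at h2 ⊢
      rw [cls_ne this]; exact h2
    rw [g.f0, g.fD] at h4
    rw [sub_nonpos]
    refine ENNReal.toReal_mono (ne_top_of_le_ne_top (by simp) (min_le_right _ (B : ℝ≥0∞))) (min_le_min_right _ ?_)
    rw [g.hD]; exact h4

open Classical in
theorem count_bad {η : Config d} {y : V d} {D : ℕ} {f : ℕ → V d} (g : Geo η y D f) {B : ℕ} (hDB : D ≤ B) (bad : V d → Prop) (R M : ℕ) :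
    ∑ t ∈ Finset.range D, (if bad (f t) then (1:ℝ) else 0) ≤ M * ((4*R+1)^d : ℕ) + B * (if Ev bad R M 0 B ∅ then 1 else 0) := by
  rw [Finset.sum_ite]
  simp only [Finset.sum_const, Finset.sum_const_zero, add_zero, nsmul_eq_mul, mul_one]
  set T := (Finset.range D).filter fun t => bad (f t) with hT
  have hcard : (T.image f).card = T.card := by
    refine Finset.card_image_of_injOn ?_
    intro s hs t ht hst
    simp only [hT, Finset.coe_filter, Finset.mem_range, Set.mem_ofPred_eq] at hs ht
    by_contra hne
    rcases lt_or_gt_of_ne hne with h | h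
    · exact g.inj h ht.1.le hst
    · exact g.inj h hs.1.le hst.symm
  split_ifs with hE
  · have : (T.card : ℝ) ≤ B := by
      have h1 := (Finset.card_filter_le (Finset.range D) fun t => bad (f t))
      rw [Finset.card_range] at h1
      exact_mod_cast h1.trans hDB
    have : (0:ℝ) ≤ M * ((4*R+1)^d : ℕ) := by positivity
    linarith
  · have : T.card ≤ M * (4*R+1)^d := by
      by_contra hcon
      push Not at hcon
      refine hE ?_
      have := Ev_of_path (bad := bad) (R := R) (n := D) (f := f) g.dist M 0 B ∅ (T.image f) (Nat.zero_le _) (by omega) ?_ (by rw [hcard]; exact hcon.le)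
      · rwa [g.f0] at this
      · intro z hz
        obtain ⟨t, ht, rfl⟩ := Finset.mem_image.1 hz
        rw [hT, Finset.mem_filter, Finset.mem_range] at ht
        exact ⟨ht.2, by simp, t, Nat.zero_le _, ht.1.le, rfl⟩
    have : (T.card : ℝ) ≤ M * ((4*R+1)^d : ℕ) := by exact_mod_cast this
    linarith

open Classical in
theorem Ysum_le (hd : 1 ≤ d) (ω : Config d) (y : V d) {r C : ℕ} {m M : ℕ → ℕ} (j : ℕ) (hm : ∀ k ≤ j, 2 * m k < r) (B : ℕ) (S : Finset (Edge d)) :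
    ∑ e ∈ S, (if ω e = true then XX y r B (cls e ω) - XX y r B ω else 0) ≤
      (((2*(C*m 0)+1)^d : ℕ) : ℝ) * B + ∑ k ∈ Finset.range j, (((2*(C*m (k+1))+1)^d : ℕ):ℝ) *
        (M k * ((4*(C*m k)+1)^d : ℕ) + B * (if Ev (fun z => BadV C (m k) (aC y r) z ω) (C*m k) (M k) 0 B ∅ then 1 else 0))
        + B * (B * (if ∃ z ∈ box (0 : V d) B, BadV C (m j) (aC y r) z ω then 1 else 0)) := by
  have i01 : ∀ (p : Prop) [Decidable p], (0:ℝ) ≤ if p then 1 else 0 := fun p _ => by split_ifs <;> norm_num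
  have hR : 0 ≤ (((2*(C*m 0)+1)^d : ℕ) : ℝ) * B + ∑ k ∈ Finset.range j, (((2*(C*m (k+1))+1)^d : ℕ):ℝ) *
        (M k * ((4*(C*m k)+1)^d : ℕ) + B * (if Ev (fun z => BadV C (m k) (aC y r) z ω) (C*m k) (M k) 0 B ∅ then 1 else 0))
        + B * (B * (if ∃ z ∈ box (0 : V d) B, BadV C (m j) (aC y r) z ω then 1 else 0)) := by
    refine add_nonneg (add_nonneg (by positivity) (Finset.sum_nonneg fun k _ => mul_nonneg (by positivity) (add_nonneg (by positivity)
      (mul_nonneg (by positivity) (i01 _))))) (mul_nonneg (by positivity) (mul_nonneg (by positivity) (i01 _)))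
  rcases le_or_gt (B : ℝ≥0∞) (chemDist (ω ⊔ aC y r) 0 y) with hB | hB
  · refine le_trans (Finset.sum_nonpos fun e _ => ?_) hR
    split_ifs
    · have h1 := XX_le y r B (cls e ω)
      have h2 : XX y r B ω = B := by unfold XX; rw [min_eq_right hB]; simp
      linarith
    · exact le_rfl
  · obtain ⟨D, f, g⟩ := exists_geo hB.ne_top
    have hDB : D ≤ B := by rw [g.hD] at hB; exact_mod_cast hB.le
    set G : ℕ → ℝ := fun t => (((2*(C*m 0)+1)^d : ℕ) : ℝ) + ∑ k ∈ Finset.range j, (((2*(C*m (k+1))+1)^d : ℕ):ℝ) * (if BadV C (m k) (aC y r) (f t) ω then 1 else 0)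
        + B * (if BadV C (m j) (aC y r) (f t) ω then 1 else 0) with hG
    have hnn : ∀ t, 0 ≤ G t := fun t => 
      add_nonneg (add_nonneg (by positivity) (Finset.sum_nonneg fun k _ => mul_nonneg (by positivity) (i01 _))) (mul_nonneg (by positivity) (i01 _))
    have h1 : ∑ e ∈ S, (if ω e = true then XX y r B (cls e ω) - XX y r B ω else 0) ≤
        ∑ e ∈ S, ∑ t ∈ Finset.range D, if ends e = s(f t, f (t+1)) then G t else 0 := by
      refine Finset.sum_le_sum fun e _ => ?_
      split_ifs
      · exact delta_le hd g j hm B e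
      · exact Finset.sum_nonneg fun t _ => by
          split_ifs
          · exact hnn t
          · exact le_rfl
    have h2 : ∑ e ∈ S, ∑ t ∈ Finset.range D, (if ends e = s(f t, f (t+1)) then G t else 0) ≤ ∑ t ∈ Finset.range D, G t := by
      rw [Finset.sum_comm]
      refine Finset.sum_le_sum fun t _ => ?_
      rw [← Finset.sum_filter, Finset.sum_const, nsmul_eq_mul]
      have : (S.filter fun e => ends e = s(f t, f (t+1))).card ≤ 1 := by
        rw [Finset.card_le_one]
        intro a ha b hb
        rw [Finset.mem_filter] at ha hb
        exact ends_injective (ha.2.trans hb.2.symm)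
      have h3 : ((S.filter fun e => ends e = s(f t, f (t+1))).card : ℝ) ≤ 1 := by exact_mod_cast this
      have := hnn t
      nlinarith
    refine h1.trans (h2.trans ?_)
    rw [hG, Finset.sum_add_distrib, Finset.sum_add_distrib, Finset.sum_comm]
    have hDB' : (D : ℝ) ≤ B := by exact_mod_cast hDB
    refine add_le_add (add_le_add ?_ (Finset.sum_le_sum fun k _ => ?_)) ?_
    · rw [Finset.sum_const, Finset.card_range, nsmul_eq_mul, mul_comm]
      exact mul_le_mul_of_nonneg_left hDB' (by positivity)
    · rw [← Finset.mul_sum]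
      exact mul_le_mul_of_nonneg_left (count_bad g hDB (fun z => BadV C (m k) (aC y r) z ω) _ _) (by positivity)
    · rw [← Finset.mul_sum]
      refine mul_le_mul_of_nonneg_left ?_ (by positivity)
      have hmem : ∀ t < D, f t ∈ box (0 : V d) B := fun t ht => by
        have := g.dist 0 t (Nat.zero_le _) ht.le
        rw [g.f0] at this
        exact mem_box_of_dist1 (by omega)
      calc _ ≤ ∑ t ∈ Finset.range D, (if ∃ z ∈ box (0 : V d) B, BadV C (m j) (aC y r) z ω then (1:ℝ) else 0) := by
            refine Finset.sum_le_sum fun t ht => ?_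
            by_cases hb : BadV C (m j) (aC y r) (f t) ω
            · rw [if_pos hb, if_pos ⟨_, hmem t (Finset.mem_range.1 ht), hb⟩]
            · rw [if_neg hb]; exact i01 _
        _ ≤ _ := by
            rw [Finset.sum_const, Finset.card_range, nsmul_eq_mul]
            exact mul_le_mul_of_nonneg_right hDB' (i01 _)

end Perco

namespace Perco
variable {d : ℕ}

/-! ### Russo's formula for the truncated distance -/
theorem russo_sum (F : BernoulliFamily d) {t : ℝ} (h0 : 0 ≤ t) (h1 : t ≤ 1) (S : Finset (Edge d)) (X : Config d → ℝ)
    (hX : DependsOn X (S : Set (Edge d))) :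
    t * ∑ e ∈ S, ∫ ω, (X (cls e ω) - X (opn e ω)) ∂(F.P t) = ∫ ω, ∑ e ∈ S, (if ω e = true then X (cls e ω) - X ω else 0) ∂(F.P t) := by
  classical
  have hdep : ∀ e ∈ S, DependsOn (fun ω : Config d => if ω e = true then X (cls e ω) - X ω else 0) (S : Set (Edge d)) := by
    intro e he ω ω' hω
    have a1 : X (cls e ω) = X (cls e ω') := hX fun e' he' => by
      by_cases hne : e' = e
      · subst hne; simp
      · rw [cls_ne hne, cls_ne hne]; exact hω e' he'
    have a2 : X ω = X ω' := hX hω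
    have a3 : ω e = ω' e := hω e (by exact_mod_cast he)
    simp only [a1, a2, a3]
  rw [integral_finset_sum _ fun e he => integrable_of_local F t S _ (hdep e he), Finset.mul_sum]
  refine Finset.sum_congr rfl fun e he => ?_
  obtain ⟨c, hc⟩ := local_bounded S _ (hdep e he)
  rw [mix_integral F h0 h1 e (measurable_of_local S _ (hdep e he)) c hc]
  have e1 : ∀ ω : Config d, cls e (opn e ω) = cls e ω := fun ω => by
    funext e'; by_cases hne : e' = e
    · subst hne; simp
    · rw [cls_ne hne, cls_ne hne, opn_ne hne]
  simp [e1]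

theorem measurableSet_Ev {bad : V d → Config d → Prop} (hb : ∀ y, MeasurableSet {ω | bad y ω}) (R M : ℕ) :
    ∀ (x : V d) (T : ℕ) (U : Finset (V d)), MeasurableSet {ω | Ev (fun y => bad y ω) R M x T U} := by
  induction M with
  | zero => intro x T U; simp [Ev]
  | succ M ih =>
    intro x T U
    have : {ω | Ev (fun y => bad y ω) R (M+1) x T U} = ⋃ y, {ω | dist1 x y ≤ T ∧ bad y ω ∧ (∀ u ∈ U, y ∉ box u (2*R)) ∧ Ev (fun y => bad y ω) R M y (T - dist1 x y) (U ∪ {y})} := by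
      ext ω; simp [Ev]
    rw [this]
    refine MeasurableSet.iUnion fun y => ?_
    exact (MeasurableSet.const _).inter ((hb y).inter ((MeasurableSet.const _).inter (ih _ _ _)))

open Classical in
theorem integral_ite (m : Measure (Config d)) {q : Config d → Prop} (hq : MeasurableSet {ω | q ω}) :
    ∫ ω, (if q ω then (1:ℝ) else 0) ∂m = m.real {ω | q ω} := by
  rw [← integral_indicator_one hq]
  refine integral_congr_ae (ae_of_all _ fun ω => ?_)
  by_cases h : q ω
  · simp only [if_pos h]; rw [Set.indicator_of_mem (show ω ∈ {ω | q ω} from h)]; rfl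
  · simp only [if_neg h]; rw [Set.indicator_of_notMem (show ω ∉ {ω | q ω} from h)]

open Classical in
theorem integrable_ite (m : Measure (Config d)) [IsProbabilityMeasure m] {q : Config d → Prop} (hq : MeasurableSet {ω | q ω}) :
    Integrable (fun ω => if q ω then (1:ℝ) else 0) m := by
  refine Integrable.of_bound (C := 1) (Measurable.ite hq measurable_const measurable_const).aestronglyMeasurable ?_
  filter_upwards with ω
  split_ifs <;> simp

variable {F : BernoulliFamily d} {p₀ : ℝ} {N ℓ C : ℕ} {A b : ℝ}

theorem measurableSet_BadV (hC : 4 ≤ C) {m : ℕ} (hm : 1 ≤ m) (a : Config d) (z : V d) : MeasurableSet {ω | BadV C m a z ω} :=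
  measurableSet_of_local _ _ (dependsOn_BadV hC hm a z)

theorem LUP.russo_bound (hd : 1 ≤ d) (h : LUP F p₀ N ℓ C A b) (hp₀ : 0 < p₀) {t : ℝ} (ht0 : p₀ ≤ t) (ht1 : t ≤ 1) (y : V d) (j r B : ℕ) (M L : ℕ → ℕ)
    (hr : ∀ k ≤ j, 2*(N*ℓ^k) < r) (hL : ∀ k, 2 ≤ L k) (hM : ∀ k, 1 ≤ M k) (hB : ∀ k, B ≤ M k * L k) :
    t * ∑ e ∈ edgesIn (box (0 : V d) B), ∫ ω, (XX y r B (cls e ω) - XX y r B (opn e ω)) ∂(F.P t) ≤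
      (((2*(C*(N*ℓ^0))+1)^d : ℕ) : ℝ) * B + ∑ k ∈ Finset.range j, (((2*(C*(N*ℓ^(k+1)))+1)^d : ℕ):ℝ) *
        (M k * ((4*(C*(N*ℓ^k))+1)^d : ℕ) + B * (8 * (2*L k)^d * (3^d * A * b^(2^k))))
        + B * (B * ((2*B+1)^d * (3^d * A * b^(2^j)))) := by
  classical
  have := F.prob t
  have ht : 0 ≤ t := hp₀.le.trans ht0
  rw [russo_sum F ht ht1 _ _ (dependsOn_XX y r B)]
  have hYdep : DependsOn (fun ω : Config d => ∑ e ∈ edgesIn (box (0 : V d) B), (if ω e = true then XX y r B (cls e ω) - XX y r B ω else 0))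
      (edgesIn (box (0 : V d) B) : Set (Edge d)) := by
    intro ω ω' hω
    refine Finset.sum_congr rfl fun e he => ?_
    have a1 : XX y r B (cls e ω) = XX y r B (cls e ω') := dependsOn_XX y r B fun e' he' => by
      by_cases hne : e' = e
      · subst hne; simp
      · rw [cls_ne hne, cls_ne hne]; exact hω e' he'
    have a2 : XX y r B ω = XX y r B ω' := dependsOn_XX y r B hω
    have a3 : ω e = ω' e := hω e (by exact_mod_cast he)
    simp only [a1, a2, a3]
  have hbm : ∀ k z, MeasurableSet {ω | BadV C (N*ℓ^k) (aC y r) z ω} := fun k z => measurableSet_BadV h.hC (h.hm k) _ z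
  have hEm : ∀ k, MeasurableSet {ω | Ev (fun z => BadV C (N*ℓ^k) (aC y r) z ω) (C*(N*ℓ^k)) (M k) 0 B ∅} := fun k =>
    measurableSet_Ev (hbm k) _ _ _ _ _
  have hXm : MeasurableSet {ω | ∃ z ∈ box (0 : V d) B, BadV C (N*ℓ^j) (aC y r) z ω} := by
    have : {ω | ∃ z ∈ box (0 : V d) B, BadV C (N*ℓ^j) (aC y r) z ω} = ⋃ z ∈ box (0 : V d) B, {ω | BadV C (N*ℓ^j) (aC y r) z ω} := by
      ext; simp
    rw [this]
    exact Finset.measurableSet_biUnion _ fun z _ => hbm j z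
  have i1 : ∀ k, Integrable (fun ω => if Ev (fun z => BadV C (N*ℓ^k) (aC y r) z ω) (C*(N*ℓ^k)) (M k) 0 B ∅ then (1:ℝ) else 0) (F.P t) :=
    fun k => integrable_ite _ (hEm k)
  have i2 : Integrable (fun ω => if ∃ z ∈ box (0 : V d) B, BadV C (N*ℓ^j) (aC y r) z ω then (1:ℝ) else 0) (F.P t) := by
    have i2' := integrable_ite (F.P t) hXm
    convert i2'
  have i3 : ∀ k ∈ Finset.range j, Integrable (fun ω => (((2*(C*(N*ℓ^(k+1)))+1)^d : ℕ):ℝ) * (M k * ((4*(C*(N*ℓ^k))+1)^d : ℕ) +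
    B * (if Ev (fun z => BadV C (N*ℓ^k) (aC y r) z ω) (C*(N*ℓ^k)) (M k) 0 B ∅ then (1:ℝ) else 0))) (F.P t) := fun k _ =>
    (((integrable_const _).add ((i1 k).const_mul _)).const_mul _)
  have i4 := integrable_finset_sum (Finset.range j) i3
  have i5 : Integrable (fun _ : Config d => (((2*(C*(N*ℓ^0))+1)^d : ℕ) : ℝ) * B) (F.P t) := integrable_const _
  refine (integral_mono (integrable_of_local F t _ _ hYdep) ((i5.add i4).add ((i2.const_mul B).const_mul B))
    (fun ω => Ysum_le hd ω y (m := fun k => N*ℓ^k) (C := C) (M := M) j hr B _)).trans ?_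
  rw [integral_add' (i5.add i4) ((i2.const_mul B).const_mul B), integral_add' i5 i4, integral_finset_sum _ i3]
  refine add_le_add (add_le_add ?_ (Finset.sum_le_sum fun k _ => ?_)) ?_
  · simp
  · rw [integral_const_mul, integral_add (integrable_const _) ((i1 k).const_mul _), integral_const_mul (B:ℝ), integral_ite _ (hEm k)]
    refine mul_le_mul_of_nonneg_left (add_le_add ?_ (mul_le_mul_of_nonneg_left ?_ (by positivity))) (by positivity)
    · simp
    · exact Ev_bound F ht ht1 (dependsOn_BadV h.hC (h.hm k) _) (mul_nonneg (mul_nonneg (by positivity) h.hA) (pow_nonneg h.hb.le _))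
        (fun z => h.badV ht0 ht1 k _ z) (hL k) (hM k) (hB k)
  · rw [integral_const_mul, integral_const_mul]
    refine mul_le_mul_of_nonneg_left (mul_le_mul_of_nonneg_left ?_ (by positivity)) (by positivity)
    have e1 : ∫ ω, (if ∃ z ∈ box (0 : V d) B, BadV C (N*ℓ^j) (aC y r) z ω then (1:ℝ) else 0) ∂(F.P t) =
      (F.P t).real {ω | ∃ z ∈ box (0 : V d) B, BadV C (N*ℓ^j) (aC y r) z ω} := by
      have i6 := integral_ite (F.P t) hXm
      convert i6
    rw [e1]
    have hsub : {ω | ∃ z ∈ box (0 : V d) B, BadV C (N*ℓ^j) (aC y r) z ω} ⊆ ⋃ z ∈ box (0 : V d) B, {ω | BadV C (N*ℓ^j) (aC y r) z ω} := by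
      intro ω hω
      obtain ⟨z, hz, hb⟩ := hω
      simp only [Set.mem_iUnion]; exact ⟨z, hz, hb⟩
    refine (measureReal_mono hsub (measure_ne_top _ _)).trans ((measureReal_biUnion_finset_le _ _).trans ?_)
    refine (Finset.sum_le_card_nsmul _ _ _ fun z _ => h.badV ht0 ht1 j _ z).trans ?_
    rw [card_box, nsmul_eq_mul]; push_cast; exact le_rfl

theorem summable_dexp {b Λ : ℝ} (hb : 0 < b) (hb1 : b < 1) (hΛ : 0 < Λ) : Summable (fun k : ℕ => Λ^k * b^(2^k)) := by
  refine summable_of_ratio_test_tendsto_lt_one (l := 0) (by norm_num) (Eventually.of_forall fun k => by positivity) ?_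
  refine (tendsto_dexp hb hb1 Λ).congr fun k => ?_
  have h1 : b^(2^(k+1)) = b^(2^k) * b^(2^k) := by rw [← pow_add]; congr 1; ring
  rw [Real.norm_of_nonneg (by positivity), Real.norm_of_nonneg (by positivity), h1, pow_succ]
  field_simp

end Perco

namespace Perco
variable {d : ℕ}
variable {F : BernoulliFamily d} {p₀ : ℝ} {N ℓ C : ℕ} {A b : ℝ}

/-! ### The uniform Russo bound -/
theorem LUP.bound (hd : 1 ≤ d) (h : LUP F p₀ N ℓ C A b) (hp₀ : 0 < p₀) :
    ∃ H : ℕ, 2 * ℓ^(2*d) ≤ H ∧ ∃ C₂ : ℝ, 0 ≤ C₂ ∧ ∀ K : ℕ, 1 ≤ K → ∃ εs : ℕ → ℝ, Tendsto εs atTop (𝓝 0) ∧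
      ∀ j : ℕ, ∀ y : V d, ∀ t : ℝ, p₀ ≤ t → t ≤ 1 →
      t * ∑ e ∈ edgesIn (box (0 : V d) (K*H^j)), ∫ ω, (XX y (2*(N*ℓ^j)+1) (K*H^j) (cls e ω) - XX y (2*(N*ℓ^j)+1) (K*H^j) (opn e ω)) ∂(F.P t)
        ≤ ((K*H^j : ℕ) : ℝ) * (C₂ + εs j) := by
  obtain ⟨a0, ha0⟩ : ∃ a0 : ℕ, a0 = (5*(C*(N*ℓ)))^d := ⟨_, rfl⟩
  have hC := h.hC
  have hN := h.hN
  have hℓ := h.hℓ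
  have hCN : 1 ≤ C*(N*ℓ) := Nat.mul_pos (by omega) (Nat.mul_pos (by omega) (by omega))
  have ha01 : 1 ≤ a0 := by rw [ha0]; exact Nat.one_le_pow _ _ (by omega)
  have hQ1 : ∀ k, (2*(C*(N*ℓ^(k+1)))+1)^d ≤ a0 * (ℓ^d)^k := by
    intro k
    rw [ha0, ← pow_mul, mul_comm d k, pow_mul, ← mul_pow]
    refine Nat.pow_le_pow_left ?_ d
    have h1 : 1 ≤ ℓ^k := Nat.one_le_pow _ _ (by omega)
    have h2 : C*(N*ℓ^(k+1)) = C*(N*ℓ)*ℓ^k := by ring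
    rw [h2, mul_assoc 5]
    have : 1 ≤ C*(N*ℓ)*ℓ^k := Nat.mul_pos hCN h1
    omega
  have hQ2 : ∀ k, (4*(C*(N*ℓ^k))+1)^d ≤ a0 * (ℓ^d)^k := by
    intro k
    rw [ha0, ← pow_mul, mul_comm d k, pow_mul, ← mul_pow]
    refine Nat.pow_le_pow_left ?_ d
    have h1 : 1 ≤ ℓ^k := Nat.one_le_pow _ _ (by omega)
    have h2 : 1 ≤ C*(N*ℓ^k) := Nat.mul_pos (by omega) (Nat.mul_pos (by omega) h1)
    have h3 : C*(N*ℓ^k) * 1 ≤ C*(N*ℓ^k)*ℓ := Nat.mul_le_mul_left _ (by omega)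
    have h4 : 5*(C*(N*ℓ))*ℓ^k = 5*(C*(N*ℓ^k)*ℓ) := by ring
    rw [h4]; omega
  obtain ⟨Q, hQ⟩ : ∃ Q : ℕ → ℕ, ∀ k, Q k = a0 * (ℓ^d)^k := ⟨_, fun _ => rfl⟩
  have hQpos : ∀ k, 1 ≤ Q k := fun k => by
    rw [hQ]; exact Nat.mul_pos (by omega) (Nat.one_le_pow _ _ (Nat.one_le_pow _ _ (by omega)))
  obtain ⟨L, hL⟩ : ∃ L : ℕ → ℕ, ∀ k, L k = 2^(k+1) * (Q k)^2 := ⟨_, fun _ => rfl⟩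
  have hL2 : ∀ k, 2 ≤ L k := fun k => by
    rw [hL, pow_succ]
    have := Nat.one_le_pow k 2 (by norm_num)
    have h2 := Nat.one_le_pow 2 (Q k) (hQpos k)
    nlinarith
  obtain ⟨H, hH⟩ : ∃ H : ℕ, H = 2 * (a0^2 * ℓ^(2*d)) := ⟨_, rfl⟩
  have ha2 : 1 ≤ a0^2 := Nat.one_le_pow _ _ ha01
  have hl2 : 1 ≤ ℓ^(2*d) := Nat.one_le_pow _ _ (by omega)
  have hHge : 2 * ℓ^(2*d) ≤ H := by
    rw [hH]; exact Nat.mul_le_mul_left _ (Nat.le_mul_of_pos_left _ ha2)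
  have hH1 : 1 ≤ H := by omega
  have hLH : ∀ k, L k ≤ H^(k+1) := by
    intro k
    have : L k = 2^(k+1) * (a0^2 * (ℓ^(2*d))^k) := by rw [hL, hQ]; ring
    rw [this, hH, mul_pow, mul_pow]
    refine Nat.mul_le_mul_left _ (Nat.mul_le_mul ?_ (Nat.pow_le_pow_right hl2 (by omega)))
    exact le_self_pow₀ ha2 (by omega)
  obtain ⟨c, hc⟩ : ∃ c : ℝ, c = a0 * (8 * (4*(a0:ℝ)^2)^d * (3^d*A)) := ⟨_, rfl⟩
  obtain ⟨Λ, hΛ⟩ : ∃ Λ : ℝ, Λ = (ℓ:ℝ)^d * (2*(ℓ:ℝ)^(2*d))^d := ⟨_, rfl⟩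
  have hA := h.hA
  have hb := h.hb
  have hb1 := h.hb1
  have hc0 : 0 ≤ c := by rw [hc]; positivity
  have hℓr : (0:ℝ) < ℓ := by exact_mod_cast (by omega : 0 < ℓ)
  have hΛ0 : 0 < Λ := by rw [hΛ]; positivity
  have hsum := summable_dexp hb hb1 hΛ0
  refine ⟨H, hHge, a0 + 2 + c * ∑' k, Λ^k*b^(2^k), ?_, ?_⟩
  · have : 0 ≤ ∑' k, Λ^k*b^(2^k) := tsum_nonneg fun k => by positivity
    positivity
  intro K hK
  refine ⟨fun j => (K:ℝ)^(d+1) * 3^d * (3^d*A) * (((H:ℝ)^(d+1))^j*b^(2^j)), ?_, ?_⟩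
  · have h1 := (summable_dexp hb hb1 (Λ := (H:ℝ)^(d+1)) (by positivity)).tendsto_atTop_zero
    simpa using h1.const_mul ((K:ℝ)^(d+1) * 3^d * (3^d*A))
  intro j y t ht0 ht1
  obtain ⟨B, hB⟩ : ∃ B : ℕ, B = K*H^j := ⟨_, rfl⟩
  have hHj : ∀ k, 1 ≤ H^k := fun k => Nat.one_le_pow _ _ hH1
  have hB1 : 1 ≤ B := by rw [hB]; exact Nat.mul_pos hK (hHj j)
  rw [← hB]
  have main := h.russo_bound hd hp₀ ht0 ht1 y j (2*(N*ℓ^j)+1) B (fun k => B / L k + 1) L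
    (fun k hk => by
      have : N*ℓ^k ≤ N*ℓ^j := Nat.mul_le_mul_left _ (Nat.pow_le_pow_right (by omega) hk)
      omega) hL2 (fun k => Nat.succ_le_succ (Nat.zero_le _))
    (fun k => by
      have := Nat.div_add_mod B (L k)
      have h2 := Nat.mod_lt B (show L k > 0 by have := hL2 k; omega)
      nlinarith)
  refine main.trans ?_
  have t1 : (((2*(C*(N*ℓ^0))+1)^d : ℕ) : ℝ) * B ≤ B * a0 := by
    rw [mul_comm]
    refine mul_le_mul_of_nonneg_left ?_ (by positivity)
    have h1 := hQ2 0
    simp only [pow_zero, mul_one] at h1 ⊢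
    exact_mod_cast (Nat.pow_le_pow_left (by omega) d).trans h1
  have t2 : ∀ k ∈ Finset.range j, (((2*(C*(N*ℓ^(k+1)))+1)^d : ℕ):ℝ) *
        (((B / L k + 1 : ℕ) : ℝ) * ((4*(C*(N*ℓ^k))+1)^d : ℕ) + B * (8 * (2*L k)^d * (3^d * A * b^(2^k)))) ≤
        B * (1/2)^k + B * (c * (Λ^k*b^(2^k))) := by
    intro k hk
    have hkj : k < j := Finset.mem_range.1 hk
    have hQ1' : (((2*(C*(N*ℓ^(k+1)))+1)^d : ℕ):ℝ) ≤ Q k := by rw [hQ]; exact_mod_cast hQ1 k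
    have hQ2' : (((4*(C*(N*ℓ^k))+1)^d : ℕ):ℝ) ≤ Q k := by rw [hQ]; exact_mod_cast hQ2 k
    have hLB : L k ≤ B := by
      refine (hLH k).trans ((Nat.pow_le_pow_right hH1 (show k+1 ≤ j by omega)).trans ?_)
      rw [hB]; exact Nat.le_mul_of_pos_left _ hK
    have hLpos : 0 < L k := by have := hL2 k; omega
    have hMr : ((B / L k + 1 : ℕ) : ℝ) * (L k) ≤ 2 * B := by
      have : (B / L k + 1) * L k ≤ 2*B := by
        have := Nat.div_mul_le_self B (L k)
        nlinarith
      exact_mod_cast this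
    have hMQ : (Q k : ℝ) * (((B / L k + 1 : ℕ) : ℝ) * Q k) ≤ B * (1/2)^k := by
      have e : ((L k : ℕ) : ℝ) = 2^(k+1) * (Q k:ℝ)^2 := by rw [hL]; push_cast; ring
      rw [e] at hMr
      have h2 : (0:ℝ) < 2^k := by positivity
      rw [one_div, inv_pow, ← div_eq_mul_inv, le_div_iff₀ h2]
      rw [pow_succ] at hMr
      nlinarith
    have e2 : (2*(L k:ℝ))^d = (4*(a0:ℝ)^2)^d * ((2*(ℓ:ℝ)^(2*d))^d)^k := by
      have : (2*(L k:ℝ)) = (4*(a0:ℝ)^2) * (2*(ℓ:ℝ)^(2*d))^k := by rw [hL, hQ]; push_cast; ring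
      rw [this, mul_pow, ← pow_mul, ← pow_mul, mul_comm k d]
    have e3 : (Q k : ℝ) * (B * (8 * (2*L k)^d * (3^d * A * b^(2^k)))) = B * (c * (Λ^k*b^(2^k))) := by
      rw [e2, hc, hΛ, hQ]; push_cast; rw [mul_pow ((ℓ:ℝ)^d)]; ring
    rw [← e3]
    calc _ ≤ (Q k : ℝ) * (((B / L k + 1 : ℕ) : ℝ) * Q k + B * (8 * (2*L k)^d * (3^d * A * b^(2^k)))) := by
          gcongr
      _ ≤ _ := by rw [mul_add]; exact add_le_add hMQ le_rfl
  have t3 : (B:ℝ) * (B * ((2*B+1)^d * (3^d * A * b^(2^j)))) ≤ B * ((K:ℝ)^(d+1) * 3^d * (3^d*A) * (((H:ℝ)^(d+1))^j*b^(2^j))) := by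
    have hB1r : (1:ℝ) ≤ B := by exact_mod_cast hB1
    have e : (K:ℝ)^(d+1) * 3^d * (3^d*A) * (((H:ℝ)^(d+1))^j*b^(2^j)) = B * ((3*B)^d * (3^d*A*b^(2^j))) := by
      have : (B:ℝ) = K*(H:ℝ)^j := by rw [hB]; push_cast; ring
      rw [this]
      have : ((H:ℝ)^(d+1))^j = ((H:ℝ)^j)^d * (H:ℝ)^j := by rw [← pow_succ, ← pow_mul, ← pow_mul, mul_comm]
      rw [this, mul_pow, mul_pow]; ring
    rw [e]
    gcongr
    linarith
  have hs1 : ∑ k ∈ Finset.range j, ((1:ℝ)/2)^k ≤ 2 := by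
    have := Summable.sum_le_tsum (Finset.range j) (fun k _ => by positivity) summable_geometric_two
    rw [tsum_geometric_two] at this; exact this
  have hs2 : ∑ k ∈ Finset.range j, Λ^k*b^(2^k) ≤ ∑' k, Λ^k*b^(2^k) :=
    Summable.sum_le_tsum _ (fun k _ => by positivity) hsum
  have t4 := Finset.sum_le_sum t2
  rw [Finset.sum_add_distrib, ← Finset.mul_sum, ← Finset.mul_sum, ← Finset.mul_sum] at t4
  have t5 : (B:ℝ) * ∑ k ∈ Finset.range j, ((1:ℝ)/2)^k + B * (c * ∑ k ∈ Finset.range j, Λ^k*b^(2^k)) ≤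
    B*2 + B*(c*∑' k, Λ^k*b^(2^k)) := by gcongr
  linarith

theorem integral_XX_diff (F : BernoulliFamily d) (y : V d) (r B : ℕ) {p₀ D : ℝ} (hp₀ : 0 < p₀)
    (hb : ∀ t, p₀ ≤ t → t ≤ 1 → t * ∑ e ∈ edgesIn (box (0 : V d) B), ∫ ω, (XX y r B (cls e ω) - XX y r B (opn e ω)) ∂(F.P t) ≤ D)
    {p q : ℝ} (hp : p₀ ≤ p) (hpq : p ≤ q) (hq : q ≤ 1) :
    0 ≤ ∫ ω, XX y r B ω ∂(F.P p) - ∫ ω, XX y r B ω ∂(F.P q) ∧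
    ∫ ω, XX y r B ω ∂(F.P p) - ∫ ω, XX y r B ω ∂(F.P q) ≤ (q - p) * (D / p₀) := by
  have hcont := continuousOn_integral F (edgesIn (box (0 : V d) B)) (XX y r B) (dependsOn_XX y r B)
  have hsub : Set.Icc p q ⊆ Set.Icc 0 1 := Set.Icc_subset_Icc (by linarith) hq
  obtain ⟨S, hS⟩ : ∃ S : ℝ → ℝ, ∀ t, S t = ∑ e ∈ edgesIn (box (0 : V d) B), ∫ ω, (XX y r B (opn e ω) - XX y r B (cls e ω)) ∂(F.P t) := ⟨_, fun _ => rfl⟩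
  have hder : ∀ t ∈ interior (Set.Icc p q), HasDerivAt (fun t => ∫ ω, XX y r B ω ∂(F.P t)) (S t) t := by
    intro t ht
    rw [interior_Icc] at ht
    have := russo F (edgesIn (box (0 : V d) B)) (XX y r B) (dependsOn_XX y r B) t ⟨by linarith [ht.1], by linarith [ht.2]⟩
    rw [hS]
    exact this.hasDerivAt (Icc_mem_nhds (by linarith [ht.1]) (by linarith [ht.2]))
  have hS0 : ∀ t, S t ≤ 0 := by
    intro t
    rw [hS]
    refine Finset.sum_nonpos fun e _ => integral_nonpos fun ω => ?_
    have : cls e ω ≤ opn e ω := by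
      intro e'; by_cases hne : e' = e
      · subst hne; simp
      · rw [cls_ne hne, opn_ne hne]
    have := XX_anti y r B this
    simpa using this
  have hSD : ∀ t ∈ interior (Set.Icc p q), 0 ≤ S t + D/p₀ := by
    intro t ht
    rw [interior_Icc] at ht
    have h1 := hb t (by linarith [ht.1]) (by linarith [ht.2])
    have e : ∑ e ∈ edgesIn (box (0 : V d) B), ∫ ω, (XX y r B (cls e ω) - XX y r B (opn e ω)) ∂(F.P t) = - S t := by
      rw [hS, ← Finset.sum_neg_distrib]
      refine Finset.sum_congr rfl fun e _ => ?_
      rw [← integral_neg]; congr 1; funext ω; ring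
    rw [e] at h1
    have h2 := hS0 t
    have h3 : p₀ * (- S t) ≤ D := by nlinarith [ht.1]
    have : - S t ≤ D/p₀ := by rw [le_div_iff₀ hp₀]; linarith
    linarith
  constructor
  · have := antitoneOn_of_deriv_nonpos (convex_Icc p q) (hcont.mono hsub)
      (fun t ht => (hder t ht).differentiableAt.differentiableWithinAt)
      (fun t ht => by rw [(hder t ht).deriv]; exact hS0 t)
    have := this (Set.left_mem_Icc.2 hpq) (Set.right_mem_Icc.2 hpq) hpq
    simpa using this
  · have hder2 : ∀ t ∈ interior (Set.Icc p q), HasDerivAt (fun t => ∫ ω, XX y r B ω ∂(F.P t) + t*(D/p₀)) (S t + 1*(D/p₀)) t :=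
      fun t ht => (hder t ht).add ((hasDerivAt_id t).mul_const _)
    have := monotoneOn_of_deriv_nonneg (f := fun t => ∫ ω, XX y r B ω ∂(F.P t) + t*(D/p₀)) (convex_Icc p q) ((hcont.mono hsub).add (by fun_prop : ContinuousOn (fun t : ℝ => t*(D/p₀)) _))
      (fun t ht => (hder2 t ht).differentiableAt.differentiableWithinAt)
      (fun t ht => by rw [(hder2 t ht).deriv, one_mul]; exact hSD t ht)
    have := this (Set.left_mem_Icc.2 hpq) (Set.right_mem_Icc.2 hpq) hpq
    simp only at this
    linarith

end Perco

namespace Perco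
variable {d : ℕ}

/-! ### Comparison of the truncated distance with the regularized one -/
theorem noInf_prob (F : BernoulliFamily d) {p : ℝ} (hp0 : 0 ≤ p) (hp1 : p ≤ 1) (hUE : UE (F.P p)) {δ : ℝ} (hδ : 0 < δ) :
    ∃ M : ℕ, ∀ c : V d, (F.P p).real {ω : Config d | ¬ ∃ y ∈ box c M, Inf ω y} < δ := by
  have := F.prob p
  have hmeas : ∀ (c : V d) (n : ℕ), MeasurableSet {ω : Config d | ¬ ∃ y ∈ box c n, Inf ω y} := by
    intro c n
    refine (MeasurableSet.compl ?_)
    have : {ω : Config d | ∃ y ∈ box c n, Inf ω y} = ⋃ y ∈ box c n, {ω | Inf ω y} := by ext; simp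
    change MeasurableSet {ω : Config d | ∃ y ∈ box c n, Inf ω y}
    rw [this]
    exact Finset.measurableSet_biUnion _ fun y _ => measurableSet_inf y
  have hM0 : Tendsto (fun M0 : ℕ => (F.P p).real {ω : Config d | ¬ ∃ y ∈ box (0 : V d) M0, Inf ω y}) atTop (𝓝 0) := by
    refine ev_small _ (fun n => hmeas 0 n) ?_
    filter_upwards [hUE.2] with ω ⟨y, hy⟩
    filter_upwards [eventually_ge_atTop (dist1 0 y)] with n hn h
    exact h ⟨y, mem_box_of_dist1 hn, hy⟩
  obtain ⟨M, hM⟩ := (hM0.eventually (gt_mem_nhds hδ)).exists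
  refine ⟨M, fun c => ?_⟩
  have e : (F.P p).real {ω : Config d | ¬ ∃ y ∈ box c M, Inf ω y} = (F.P p).real {ω : Config d | ¬ ∃ y ∈ box (0 : V d) M, Inf ω y} := by
    rw [measureReal_def, measureReal_def, ← sh_prob F hp0 hp1 c (hmeas 0 M)]
    congr 2
    ext ω
    simp only [Set.mem_ofPred_eq, sh_inf, not_iff_not]
    constructor
    · rintro ⟨y, hy, h⟩
      refine ⟨y - c, ?_, by simpa using h⟩
      rw [← mem_box_add (z := c)]; simpa using hy
    · rintro ⟨y, hy, h⟩
      refine ⟨y + c, ?_, h⟩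
      rw [← mem_box_add (z := c)] at hy; simpa using hy
  rw [e]; exact hM

theorem first_hit {W : Type*} {G G' : SimpleGraph W} {S : Set W} (hG : ∀ a b, G.Adj a b → ¬ (a ∈ S ∧ b ∈ S) → G'.Adj a b) {a b : W} (w : G.Walk a b) (hb : b ∈ S) :
    ∃ c ∈ S, ∃ w' : G'.Walk a c, w'.length ≤ w.length := by
  induction w with
  | nil => exact ⟨_, hb, SimpleGraph.Walk.nil, le_rfl⟩
  | @cons u v w hadj q ih =>
    by_cases hu : u ∈ S
    · exact ⟨u, hu, SimpleGraph.Walk.nil, by simp⟩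
    · obtain ⟨c, hc, w', hw'⟩ := ih hb
      refine ⟨c, hc, SimpleGraph.Walk.cons (hG _ _ hadj fun h => hu h.1) w', ?_⟩
      simpa using hw'

theorem XX_lower {ω : Config d} {y : V d} {r B : ℕ} (hlt : XX y r B ω < B) :
    ∃ v ∈ box (0 : V d) r, ∃ v' ∈ box y r, Reach ω v v' ∧ (chemDist ω v v').toReal ≤ XX y r B ω := by
  set η := ω ⊔ aC y r with hη
  have h1 : chemDist η 0 y < B := by
    by_contra hc
    push Not at hc
    have : XX y r B ω = B := by rw [XX, ← hη, min_eq_right hc]; simp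
    linarith
  have hX : XX y r B ω = (chemDist η 0 y).toReal := by rw [XX, ← hη, min_eq_left h1.le]
  have hre : Reach η 0 y := connected_iff.1 (ne_top_of_lt h1)
  obtain ⟨w, hw⟩ := exists_walk_chemDist hre
  let G1 : SimpleGraph (V d) :=
    { Adj := fun a b => (gr η).Adj a b ∧ ¬ (a ∈ (box y r : Set (V d)) ∧ b ∈ (box y r : Set (V d)))
      symm := ⟨fun a b h => ⟨h.1.symm, fun h' => h.2 ⟨h'.2, h'.1⟩⟩⟩
      loopless := ⟨fun a h => h.1.ne rfl⟩ }
  obtain ⟨v', hv', w1, hw1⟩ := first_hit (G' := G1) (S := (box y r : Set (V d))) (fun a b h h' => ⟨h, h'⟩) w (by exact_mod_cast self_mem_box _ _)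
  obtain ⟨v, hv, w2, hw2⟩ := first_hit (G := G1) (G' := gr ω) (S := (box (0 : V d) r : Set (V d))) (fun a b h h' => by
    obtain ⟨h2, h3⟩ := h
    obtain ⟨hd, ho⟩ := adj_iff.1 h2
    refine adj_iff.2 ⟨hd, ?_⟩
    have e1 : mkE a b hd ∉ edgesIn (box (0 : V d) r) := by
      rw [mkE_mem_edgesIn]; exact fun h => h' (by exact_mod_cast h)
    have e2 : mkE a b hd ∉ edgesIn (box y r) := by
      rw [mkE_mem_edgesIn]; exact fun h => h3 (by exact_mod_cast h)
    have e3 : aC y r (mkE a b hd) = false := by simp [aC, e1, e2]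
    have e4 : η (mkE a b hd) = (ω (mkE a b hd) ⊔ aC y r (mkE a b hd)) := rfl
    rw [e4, e3] at ho
    simpa using ho) w1.reverse (by exact_mod_cast self_mem_box _ _)
  refine ⟨v, by exact_mod_cast hv, v', by exact_mod_cast hv', ⟨w2.reverse⟩, ?_⟩
  rw [hX, ← hw]
  have h3 := chemDist_le w2.reverse
  have h4 : chemDist ω v v' ≤ (w.length : ℝ≥0∞) := h3.trans (by
    simp only [SimpleGraph.Walk.length_reverse] at hw2 ⊢
    exact_mod_cast hw2.trans hw1)
  exact ENNReal.toReal_mono (ENNReal.natCast_ne_top _) h4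

theorem XX_upper {ω : Config d} {y y1 y2 : V d} {r B M : ℕ} (hM : M ≤ r) (h1 : y1 ∈ box (0 : V d) M) (h2 : y2 ∈ box y M) (hr : Reach ω y1 y2) :
    XX y r B ω ≤ (chemDist ω y1 y2).toReal + 2*(d*M) := by
  set η := ω ⊔ aC y r with hη
  have ho0 : ∀ e ∈ edgesIn (box (0 : V d) r), η e = true := fun e he => by
    have e4 : η e = (ω e ⊔ aC y r e) := rfl
    rw [e4]; simp [aC, he]
  have hoy : ∀ e ∈ edgesIn (box y r), η e = true := fun e he => by
    have e4 : η e = (ω e ⊔ aC y r e) := rfl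
    rw [e4]; simp [aC, he]
  obtain ⟨w1, hw1⟩ := box_walk ho0 _ 0 y1 rfl (self_mem_box _ _) (box_mono hM h1)
  obtain ⟨w2, hw2⟩ := box_walk hoy _ y2 y rfl (box_mono hM h2) (self_mem_box _ _)
  have c1 : chemDist η 0 y1 ≤ (d*M : ℕ) := (chemDist_anti (restr_le _ _) _ _).trans ((chemDist_le w1).trans (by
    rw [hw1]; exact_mod_cast dist1_of_mem_box h1))
  have c2 : chemDist η y2 y ≤ (d*M : ℕ) := (chemDist_anti (restr_le _ _) _ _).trans ((chemDist_le w2).trans (by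
    rw [hw2, dist1_comm]; exact_mod_cast dist1_of_mem_box h2))
  have c3 : chemDist η y1 y2 ≤ chemDist ω y1 y2 := chemDist_anti le_sup_left _ _
  have hne : chemDist ω y1 y2 ≠ ⊤ := connected_iff.2 hr
  have c4 : chemDist η 0 y ≤ (d*M : ℕ) + (chemDist ω y1 y2 + (d*M : ℕ)) :=
    (chemDist_triangle _ 0 y1 y).trans (add_le_add c1 ((chemDist_triangle _ y1 y2 y).trans (add_le_add c3 c2)))
  have hne2 : chemDist ω y1 y2 + (d*M : ℕ) ≠ ⊤ := ENNReal.add_ne_top.2 ⟨hne, ENNReal.natCast_ne_top _⟩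
  have c5 := ENNReal.toReal_mono (ENNReal.add_ne_top.2 ⟨ENNReal.natCast_ne_top _, hne2⟩) ((min_le_left (chemDist η 0 y) (B:ℝ≥0∞)).trans c4)
  rw [ENNReal.toReal_add (ENNReal.natCast_ne_top _) hne2, ENNReal.toReal_add hne (ENNReal.natCast_ne_top _), ENNReal.toReal_natCast] at c5
  have : XX y r B ω = (min (chemDist η 0 y) (B:ℝ≥0∞)).toReal := rfl
  push_cast at c5
  linarith

theorem XX_lower2 {ω : Config d} {y y1 y2 : V d} {r B M C m : ℕ}
    (hn : ∀ v ∈ box (0 : V d) r, ∀ v' ∈ box y r, v' ∉ box v (2*m))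
    (h1 : y1 ∈ box (0 : V d) M) (h2 : y2 ∈ box y M) (hi1 : Inf ω y1) (hi2 : Inf ω y2)
    (g1 : ∀ v ∈ box (0 : V d) r, ∀ z ∈ box (0 : V d) M, ¬ LUbad C m ω v z)
    (g2 : ∀ v ∈ box y r, ∀ z ∈ box y M, ¬ LUbad C m ω v z) (hlt : XX y r B ω < B) :
    (chemDist ω y1 y2).toReal ≤ XX y r B ω + 2 * ((2*(C*m)+1)^d : ℕ) := by
  obtain ⟨v, hv, v', hv', hre, hle⟩ := XX_lower hlt
  have f1 : Far ω v (2*m) := ⟨v', hre, hn v hv v' hv'⟩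
  have f2 : Far ω v' (2*m) := ⟨v, hre.symm, fun h => hn v hv v' hv' (mem_box_comm.1 h)⟩
  have r1 : Reach (restr (box v (C*m)) ω) v y1 := by
    by_contra hc; exact g1 v hv y1 h1 ⟨f1, inf_iff.1 hi1 _, hc⟩
  have r2 : Reach (restr (box v' (C*m)) ω) v' y2 := by
    by_contra hc; exact g2 v' hv' y2 h2 ⟨f2, inf_iff.1 hi2 _, hc⟩
  have d1 := chemDist_le_card r1 (self_mem_box _ _)
  have d2 := chemDist_le_card r2 (self_mem_box _ _)
  rw [card_box] at d1 d2
  have hne : chemDist ω v v' ≠ ⊤ := connected_iff.2 hre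
  have c4 : chemDist ω y1 y2 ≤ ((2*(C*m)+1)^d : ℕ) + (chemDist ω v v' + ((2*(C*m)+1)^d : ℕ)) :=
    (chemDist_triangle _ y1 v y2).trans (add_le_add (by rw [chemDist_comm]; exact d1) ((chemDist_triangle _ v v' y2).trans (add_le_add le_rfl d2)))
  have hne2 : chemDist ω v v' + ((2*(C*m)+1)^d : ℕ) ≠ ⊤ := ENNReal.add_ne_top.2 ⟨hne, ENNReal.natCast_ne_top _⟩
  have c5 := ENNReal.toReal_mono (ENNReal.add_ne_top.2 ⟨ENNReal.natCast_ne_top _, hne2⟩) c4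
  rw [ENNReal.toReal_add (ENNReal.natCast_ne_top _) hne2, ENNReal.toReal_add hne (ENNReal.natCast_ne_top _), ENNReal.toReal_natCast] at c5
  linarith

end Perco

namespace Perco
variable {d : ℕ}
variable {F : BernoulliFamily d} {p₀ : ℝ} {N ℓ C : ℕ} {A b : ℝ}

/-! ### Convergence of the truncated expectations -/
theorem LUP.LUunion (hd : 1 ≤ d) (h : LUP F p₀ N ℓ C A b) {p : ℝ} (hp0 : p₀ ≤ p) (hp1 : p ≤ 1) (c : V d) (j M : ℕ) (hM : M + 1 ≤ N*ℓ^j) :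
    (F.P p).real {ω | ∃ v ∈ box c (2*(N*ℓ^j)+1), ∃ z ∈ box c M, LUbad C (N*ℓ^(j+2)) ω v z} ≤
      ((7*N)^d*(2*M+1)^d*A) * (((ℓ:ℝ)^d)^j * b^(2^j)) := by
  have := F.prob p
  have hsub : {ω | ∃ v ∈ box c (2*(N*ℓ^j)+1), ∃ z ∈ box c M, LUbad C (N*ℓ^(j+2)) ω v z} ⊆
    ⋃ v ∈ box c (2*(N*ℓ^j)+1), ⋃ z ∈ box c M, {ω | LUbad C (N*ℓ^(j+2)) ω v z} := by
    rintro ω ⟨v, hv, z, hz, hb⟩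
    simp only [Set.mem_iUnion]
    exact ⟨v, hv, z, hz, hb⟩
  have hℓ := h.hℓ
  have hN := h.hN
  have hA := h.hA
  have hb := h.hb
  have hb1 := h.hb1
  have hbig : 4*(N*ℓ^j) ≤ N*ℓ^(j+2) := by
    have e : N*ℓ^(j+2) = (ℓ*ℓ)*(N*ℓ^j) := by ring
    rw [e]; exact Nat.mul_le_mul_right _ (by nlinarith)
  have each : ∀ v ∈ box c (2*(N*ℓ^j)+1), ∀ z ∈ box c M, (F.P p).real {ω | LUbad C (N*ℓ^(j+2)) ω v z} ≤ A * b^(2^j) := by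
    intro v hv z hz
    have hzv : z ∈ box v (N*ℓ^(j+2)) := by
      have := box_subset (mem_box_comm.1 hv) (show (2*(N*ℓ^j)+1) + M ≤ N*ℓ^(j+2) by omega)
      exact this hz
    refine (h.plain hd hp0 hp1 (j+2) hzv).trans (mul_le_mul_of_nonneg_left ?_ hA)
    exact pow_le_pow_of_le_one hb.le hb1.le (Nat.pow_le_pow_right (by norm_num) (by omega))
  refine (measureReal_mono hsub (measure_ne_top _ _)).trans ((measureReal_biUnion_finset_le _ _).trans ?_)
  refine (Finset.sum_le_card_nsmul _ _ _ fun v hv => (measureReal_biUnion_finset_le _ _).trans (Finset.sum_le_card_nsmul _ _ _ fun z hz => each v hv z hz)).trans ?_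
  rw [card_box, card_box, nsmul_eq_mul, nsmul_eq_mul]
  have h7 : ((2*(2*(N*ℓ^j)+1)+1)^d : ℕ) ≤ (7*N)^d * (ℓ^d)^j := by
    rw [← pow_mul, mul_comm d j, pow_mul, ← mul_pow]
    refine Nat.pow_le_pow_left ?_ d
    have := h.hm j
    have e : 7*N*ℓ^j = 7*(N*ℓ^j) := by ring
    rw [e]; omega
  have h7r : (((2*(2*(N*ℓ^j)+1)+1)^d : ℕ):ℝ) ≤ (7*N)^d * ((ℓ:ℝ)^d)^j := by exact_mod_cast h7
  calc _ ≤ (7*N)^d * ((ℓ:ℝ)^d)^j * ((((2*M+1)^d : ℕ):ℝ) * (A * b^(2^j))) := by gcongr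
    _ = _ := by push_cast; ring

theorem ev_pow {H l : ℕ} (hl : 1 ≤ l) (hH : 2*l ≤ H) (c : ℝ) : ∀ᶠ j : ℕ in atTop, c * (l:ℝ)^j ≤ (H:ℝ)^j := by
  have h1 : Tendsto (fun j : ℕ => (2:ℝ)^j) atTop atTop := tendsto_pow_atTop_atTop_of_one_lt (by norm_num)
  filter_upwards [h1.eventually_ge_atTop c] with j hj
  have h2 : ((2:ℝ)*l)^j ≤ (H:ℝ)^j := pow_le_pow_left₀ (by positivity) (by exact_mod_cast hH) j
  rw [mul_pow] at h2
  have : c * (l:ℝ)^j ≤ 2^j * (l:ℝ)^j := mul_le_mul_of_nonneg_right hj (by positivity)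
  linarith

theorem LUP.conv_prob (hd : 1 ≤ d) (h : LUP F p₀ N ℓ C A b) (hp₀ : 0 < p₀) {p : ℝ} (hp0 : p₀ ≤ p) (hp1 : p ≤ 1) (hUE : UE (F.P p))
    {μ : V d → ℝ} (hconv : ASTimeConstant (F.P p) μ) {H : ℕ} (hH : 2*ℓ^(2*d) ≤ H) (K : ℕ) {x : V d} (hx : x ≠ 0) {δ δ' : ℝ} (hδ : 0 < δ) (hδ' : 0 < δ') :
    ∀ᶠ j : ℕ in atTop, (F.P p).real {ω | 2*δ < |XX (H^j • x) (2*(N*ℓ^j)+1) (K*H^j) ω / (H:ℝ)^j - min (μ x) K|} ≤ 5 * δ' := by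
  have := F.prob p
  have hp : 0 ≤ p := hp₀.le.trans hp0
  have hℓ := h.hℓ
  have hN := h.hN
  have hA := h.hA
  have hb := h.hb
  have hb1 := h.hb1
  have hl1 : 1 ≤ ℓ^d := Nat.one_le_pow _ _ (by omega)
  have hHd : 2 * ℓ^d ≤ H := (Nat.mul_le_mul_left _ (Nat.pow_le_pow_right (by omega) (by omega))).trans hH
  have hHl : 2 * ℓ ≤ H := (Nat.mul_le_mul_left _ (by simpa using Nat.pow_le_pow_right (show ℓ > 0 by omega) hd)).trans hHd
  have hH1 : 2 ≤ H := by omega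
  obtain ⟨M, hM⟩ := noInf_prob F hp hp1 hUE hδ'
  have hHt : Tendsto (fun j : ℕ => H^j) atTop atTop := tendsto_pow_atTop_atTop_of_one_lt (by omega)
  have ev1 := ((H_lemma F hp hp1 hUE hconv x M hδ).comp hHt).eventually (gt_mem_nhds hδ')
  have ev2 : ∀ᶠ j : ℕ in atTop, ((7*N)^d*(2*M+1)^d*A) * (((ℓ:ℝ)^d)^j * b^(2^j)) < δ' := by
    have hℓr : (0:ℝ) < ℓ := by exact_mod_cast (by omega : 0 < ℓ)
    have h1 := ((summable_dexp hb hb1 (Λ := (ℓ:ℝ)^d) (by positivity)).tendsto_atTop_zero).const_mul ((7*N)^d*(2*M+1)^d*A : ℝ)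
    rw [mul_zero] at h1
    exact h1.eventually (gt_mem_nhds hδ')
  have ev3 := ev_pow (H := H) (l := 1) le_rfl (by omega) (2*(d*M)/δ)
  have ev4 := ev_pow hl1 hHd (2*((3*(C*(N*ℓ^2)))^d : ℕ)/δ)
  have ev5 := ev_pow (show 1 ≤ ℓ by omega) hHl ((6*N+2*(N*ℓ^2)+1 : ℕ):ℝ)
  filter_upwards [ev1, ev2, ev3, ev4, ev5, eventually_ge_atTop (M+1)] with j e1 e2 e3 e4 e5 hj
  have hMj : M + 1 ≤ N*ℓ^j := hj.trans (h.m_ge j)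
  obtain ⟨n, hn⟩ : ∃ n : ℕ, n = H^j := ⟨_, rfl⟩
  obtain ⟨r, hr⟩ : ∃ r : ℕ, r = 2*(N*ℓ^j)+1 := ⟨_, rfl⟩
  obtain ⟨m, hm⟩ : ∃ m : ℕ, m = N*ℓ^(j+2) := ⟨_, rfl⟩
  have hnr : (H:ℝ)^j = n := by rw [hn]; push_cast; rfl
  have hn1 : 1 ≤ n := by rw [hn]; exact Nat.one_le_pow _ _ (by omega)
  have hn1r : (0:ℝ) < n := by exact_mod_cast hn1
  have hℓj : 1 ≤ ℓ^j := Nat.one_le_pow _ _ (by omega)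
  rw [hnr] at e3 e4 e5 ⊢
  simp only [Function.comp, ← hn] at e1
  rw [← hn, ← hr]
  -- numeric facts
  have n3 : 2*((d:ℝ)*M) ≤ δ*n := by
    simp only [Nat.cast_one, one_pow, mul_one] at e3
    rw [div_le_iff₀ hδ] at e3; linarith
  have n4 : 2*(((2*(C*m)+1)^d : ℕ):ℝ) ≤ δ*n := by
    have q : (2*(C*m)+1)^d ≤ (3*(C*(N*ℓ^2)))^d * (ℓ^d)^j := by
      rw [← pow_mul, mul_comm d j, pow_mul, ← mul_pow]
      refine Nat.pow_le_pow_left ?_ d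
      have hCm : 1 ≤ C*m := Nat.mul_pos (by have := h.hC; omega) (by rw [hm]; exact h.hm _)
      have e : 3*(C*(N*ℓ^2))*ℓ^j = 3*(C*m) := by rw [hm]; ring
      rw [e]; omega
    have qr : (((2*(C*m)+1)^d : ℕ):ℝ) ≤ ((3*(C*(N*ℓ^2)))^d : ℕ) * ((ℓ^d : ℕ):ℝ)^j := by exact_mod_cast q
    rw [div_mul_eq_mul_div, div_le_iff₀ hδ] at e4
    linarith
  have n5 : 2*r + 2*m < n := by
    have e5' : (6*N+2*(N*ℓ^2)+1)*ℓ^j ≤ n := by exact_mod_cast e5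
    have : 2*r+2*m = 4*(N*ℓ^j) + 2*(N*ℓ^2)*ℓ^j + 2 := by rw [hr, hm]; ring
    have h3 : 1 ≤ N*ℓ^j := h.hm j
    nlinarith
  have hsep : ∀ v ∈ box (0 : V d) r, ∀ v' ∈ box (n • x) r, v' ∉ box v (2*m) := by
    intro v hv v' hv' hc
    obtain ⟨k, hk⟩ := Function.ne_iff.1 hx
    have a1 := abs_le.1 (mem_box.1 hv k)
    have a2 := abs_le.1 (mem_box.1 hv' k)
    have a3 := abs_le.1 (mem_box.1 hc k)
    have a4 : (n • x) k = n * x k := by simp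
    rw [a4] at a2
    have a5 : (0 : V d) k = 0 := rfl
    rw [a5] at a1 hk
    have n5' : 2*(r:ℤ)+2*m < n := by exact_mod_cast n5
    push_cast at a3
    rcases lt_or_gt_of_ne hk with hneg | hpos
    · have : (n:ℤ) * x k ≤ n * (-1) := mul_le_mul_of_nonneg_left (by omega) (by positivity)
      linarith [a1.1, a1.2, a2.1, a2.2, a3.1, a3.2]
    · have : (n:ℤ) * 1 ≤ n * x k := mul_le_mul_of_nonneg_left (by omega) (by positivity)
      linarith [a1.1, a1.2, a2.1, a2.2, a3.1, a3.2]
  set B1 : Set (Config d) := {ω : Config d | ¬ ∃ y ∈ box (0 : V d) M, Inf ω y} with hB1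
  set B2 : Set (Config d) := {ω : Config d | ¬ ∃ y ∈ box (n • x) M, Inf ω y} with hB2
  set B3 : Set (Config d) := {ω | ∃ y ∈ box (0 : V d) M, ∃ y' ∈ box (n • x) M, Inf ω y ∧ Inf ω y' ∧
      δ * n < |(chemDist ω y y').toReal - μ x * n|} with hB3
  set B4 : Set (Config d) := {ω | ∃ v ∈ box (0 : V d) r, ∃ z ∈ box (0 : V d) M, LUbad C m ω v z} with hB4
  set B5 : Set (Config d) := {ω | ∃ v ∈ box (n • x) r, ∃ z ∈ box (n • x) M, LUbad C m ω v z} with hB5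
  have p4 : (F.P p).real B4 ≤ δ' := by
    have := h.LUunion hd hp0 hp1 0 j M hMj
    rw [← hr, ← hm] at this; exact this.trans e2.le
  have p5 : (F.P p).real B5 ≤ δ' := by
    have := h.LUunion hd hp0 hp1 (n • x) j M hMj
    rw [← hr, ← hm] at this; exact this.trans e2.le
  have hsub : ∀ᵐ ω ∂(F.P p), ω ∈ {ω | 2*δ < |XX (n • x) r (K*n) ω / n - min (μ x) K|} → ω ∈ (B1 ∪ (B2 ∪ (B3 ∪ (B4 ∪ B5))) : Set (Config d)) := by
    filter_upwards [hUE.1] with ω hu hω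
    by_contra hnot
    replace hω : 2*δ < |XX (n • x) r (K*n) ω / n - min (μ x) K| := hω
    simp only [Set.mem_union, not_or] at hnot
    obtain ⟨b1, b2, b3, b4, b5⟩ := hnot
    replace b1 : ∃ y ∈ box (0 : V d) M, Inf ω y := by by_contra hc; exact b1 hc
    replace b2 : ∃ y ∈ box (n • x) M, Inf ω y := by by_contra hc; exact b2 hc
    obtain ⟨y1, hy1, i1⟩ := b1
    obtain ⟨y2, hy2, i2⟩ := b2
    replace b3 : |(chemDist ω y1 y2).toReal - μ x * n| ≤ δ * n := by
      by_contra hc; exact b3 ⟨y1, hy1, y2, hy2, i1, i2, not_le.1 hc⟩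
    replace b4 : ∀ v ∈ box (0 : V d) r, ∀ z ∈ box (0 : V d) M, ¬ LUbad C m ω v z := fun v hv z hz hc => b4 ⟨v, hv, z, hz, hc⟩
    replace b5 : ∀ v ∈ box (n • x) r, ∀ z ∈ box (n • x) M, ¬ LUbad C m ω v z := fun v hv z hz hc => b5 ⟨v, hv, z, hz, hc⟩
    have b3' := abs_le.1 b3
    have up := XX_upper (B := K*n) (show M ≤ r by omega) hy1 hy2 (hu _ _ i1 i2)
    have up2 := XX_le (n • x) r (K*n) ω
    push_cast at up2
    refine absurd hω (not_lt.2 (abs_le.2 ⟨?_, ?_⟩))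
    · by_cases hlt : XX (n • x) r (K*n) ω < (K*n : ℕ)
      · have lo := XX_lower2 hsep hy1 hy2 i1 i2 b4 b5 hlt
        have : μ x - 2*δ ≤ XX (n • x) r (K*n) ω / n := by
          rw [le_div_iff₀ hn1r]; nlinarith [b3'.1]
        have := min_le_left (μ x) (K:ℝ)
        linarith
      · push_cast at hlt
        have : (K:ℝ) ≤ XX (n • x) r (K*n) ω / n := by rw [le_div_iff₀ hn1r]; linarith
        have := min_le_right (μ x) (K:ℝ)
        linarith
    · have u1 : XX (n • x) r (K*n) ω / n ≤ μ x + 2*δ := by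
        rw [div_le_iff₀ hn1r]; nlinarith [b3'.2]
      have u2 : XX (n • x) r (K*n) ω / n ≤ K := by rw [div_le_iff₀ hn1r]; linarith
      rcases min_choice (μ x) (K:ℝ) with hh | hh <;> rw [hh] <;> linarith
  have hle : (F.P p).real {ω | 2*δ < |XX (n • x) r (K*n) ω / n - min (μ x) K|} ≤ (F.P p).real (B1 ∪ (B2 ∪ (B3 ∪ (B4 ∪ B5)))) :=
    ENNReal.toReal_mono (measure_ne_top _ _) (measure_mono_ae hsub)
  have q1 := measureReal_union_le (μ := F.P p) B1 (B2 ∪ (B3 ∪ (B4 ∪ B5)))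
  have q2 := measureReal_union_le (μ := F.P p) B2 (B3 ∪ (B4 ∪ B5))
  have q3 := measureReal_union_le (μ := F.P p) B3 (B4 ∪ B5)
  have q4 := measureReal_union_le (μ := F.P p) B4 B5
  have q5 := hM 0
  have q6 := hM (n • x)
  linarith

theorem LUP.conv (hd : 1 ≤ d) (h : LUP F p₀ N ℓ C A b) (hp₀ : 0 < p₀) {p : ℝ} (hp0 : p₀ ≤ p) (hp1 : p ≤ 1) (hUE : UE (F.P p))
    {μ : V d → ℝ} (hconv : ASTimeConstant (F.P p) μ) {H : ℕ} (hH : 2*ℓ^(2*d) ≤ H) (K : ℕ) {x : V d} (hx : x ≠ 0) :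
    Tendsto (fun j : ℕ => (∫ ω, XX (H^j • x) (2*(N*ℓ^j)+1) (K*H^j) ω ∂(F.P p)) / (H:ℝ)^j) atTop (𝓝 (min (μ x) K)) := by
  classical
  have := F.prob p
  have hH1 : 0 < H := by
    have : 1 ≤ ℓ^(2*d) := Nat.one_le_pow _ _ (by have := h.hℓ; omega)
    omega
  obtain ⟨L, hL⟩ : ∃ L, L = min (μ x) (K:ℝ) := ⟨_, rfl⟩
  rw [← hL, Metric.tendsto_atTop]
  intro ε hε
  obtain ⟨c, hc⟩ : ∃ c, c = (K:ℝ) + |L| + 1 := ⟨_, rfl⟩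
  have hc0 : 0 < c := by rw [hc]; positivity
  have ev := h.conv_prob hd hp₀ hp0 hp1 hUE hconv hH K hx (δ := ε/8) (δ' := ε/(20*c)) (by positivity) (by positivity)
  obtain ⟨j0, hj0⟩ := eventually_atTop.1 ev
  refine ⟨j0, fun j hj => ?_⟩
  have hb := hj0 j hj
  rw [← hL] at hb
  have hn : (0:ℝ) < (H:ℝ)^j := by positivity
  obtain ⟨X, hX⟩ : ∃ X : Config d → ℝ, X = XX (H^j • x) (2*(N*ℓ^j)+1) (K*H^j) := ⟨_, rfl⟩
  have hXdep : DependsOn X (edgesIn (box (0 : V d) (K*H^j)) : Set (Edge d)) := by rw [hX]; exact dependsOn_XX _ _ _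
  have hXm : Measurable X := measurable_of_local _ _ hXdep
  have hXi : Integrable X (F.P p) := integrable_of_local F p _ _ hXdep
  rw [← hX] at hb ⊢
  have hX0 : ∀ ω, 0 ≤ X ω := fun ω => by rw [hX]; exact XX_nonneg _ _ _ _
  have hXK : ∀ ω, X ω / (H:ℝ)^j ≤ K := fun ω => by
    rw [div_le_iff₀ hn, hX]
    have := XX_le (H^j • x) (2*(N*ℓ^j)+1) (K*H^j) ω
    push_cast at this; exact this
  have hS : MeasurableSet {ω | 2*(ε/8) < |X ω / (H:ℝ)^j - L|} :=
    measurableSet_lt measurable_const ((hXm.div_const _).sub_const _).abs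
  have hint : Integrable (fun ω => X ω / (H:ℝ)^j - L) (F.P p) := (hXi.div_const _).sub (integrable_const _)
  have e1 : (∫ ω, X ω ∂(F.P p)) / (H:ℝ)^j - L = ∫ ω, (X ω / (H:ℝ)^j - L) ∂(F.P p) := by
    rw [integral_sub (hXi.div_const _) (integrable_const _), integral_div]; simp
  rw [Real.dist_eq, e1]
  have e2 : |∫ ω, (X ω / (H:ℝ)^j - L) ∂(F.P p)| ≤ ∫ ω, |X ω / (H:ℝ)^j - L| ∂(F.P p) := by
    simpa [Real.norm_eq_abs] using norm_integral_le_integral_norm (μ := F.P p) (fun ω => X ω / (H:ℝ)^j - L)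
  have i1 : Integrable (fun ω => if 2*(ε/8) < |X ω / (H:ℝ)^j - L| then (1:ℝ) else 0) (F.P p) := by
    have := integrable_ite (F.P p) hS
    convert this
  have i2 : ∫ ω, (if 2*(ε/8) < |X ω / (H:ℝ)^j - L| then (1:ℝ) else 0) ∂(F.P p) = (F.P p).real {ω | 2*(ε/8) < |X ω / (H:ℝ)^j - L|} := by
    have := integral_ite (F.P p) hS
    convert this
  have e3 : ∫ ω, |X ω / (H:ℝ)^j - L| ∂(F.P p) ≤ ∫ ω, (2*(ε/8) + c * (if 2*(ε/8) < |X ω / (H:ℝ)^j - L| then (1:ℝ) else 0)) ∂(F.P p) := by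
    refine integral_mono hint.abs ((integrable_const _).add (i1.const_mul c)) fun ω => ?_
    simp only
    split_ifs with hh
    · have a1 : |X ω / (H:ℝ)^j - L| ≤ |X ω / (H:ℝ)^j| + |L| := abs_sub _ _
      rw [abs_of_nonneg (div_nonneg (hX0 ω) hn.le)] at a1
      have := hXK ω
      rw [hc]; linarith
    · linarith
  rw [integral_add (integrable_const _) (i1.const_mul c), integral_const_mul c, i2] at e3
  simp only [integral_const, probReal_univ, one_smul] at e3
  have e4 : c * (F.P p).real {ω | 2*(ε/8) < |X ω / (H:ℝ)^j - L|} ≤ ε/4 := by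
    refine (mul_le_mul_of_nonneg_left hb hc0.le).trans (le_of_eq ?_)
    field_simp; norm_num
  linarith

end Perco

namespace Perco
variable {d : ℕ}

/-! ### Subadditivity of the time constant -/
theorem mu_subadd (F : BernoulliFamily d) {p : ℝ} (hp0 : 0 ≤ p) (hp1 : p ≤ 1) (hUE : UE (F.P p)) {μ : V d → ℝ}
    (hconv : ASTimeConstant (F.P p) μ) (x y : V d) : μ (x + y) ≤ μ x + μ y := by
  have := F.prob p
  refine le_of_forall_pos_le_add fun ε hε => ?_
  obtain ⟨M, hM⟩ := noInf_prob F hp0 hp1 hUE (show (0:ℝ) < 1/10 by norm_num)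
  have hε3 : 0 < ε/3 := by positivity
  have h10 : (0:ℝ) < 1/10 := by norm_num
  have ev1 := (H_lemma F hp0 hp1 hUE hconv x M hε3).eventually (gt_mem_nhds h10)
  have ev2 := (H_lemma F hp0 hp1 hUE hconv y M hε3).eventually (gt_mem_nhds h10)
  have ev3 := (H_lemma F hp0 hp1 hUE hconv (x+y) M hε3).eventually (gt_mem_nhds h10)
  obtain ⟨n, e1, e2, e3, hn⟩ := (ev1.and (ev2.and (ev3.and (eventually_ge_atTop 1)))).exists
  have hn1r : (0:ℝ) < n := by exact_mod_cast hn
  obtain ⟨BH, hBH⟩ : ∃ BH : V d → Set (Config d), ∀ z, BH z = {ω | ∃ y ∈ box (0 : V d) M, ∃ y' ∈ box (n • z) M, Inf ω y ∧ Inf ω y' ∧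
      ε/3 * n < |(chemDist ω y y').toReal - μ z * n|} := ⟨_, fun _ => rfl⟩
  rw [← hBH] at e1 e2 e3
  have hmeas : MeasurableSet (BH y) := by
    have : BH y = ⋃ a ∈ box (0 : V d) M, ⋃ a' ∈ box (n • y) M, ({ω : Config d | Inf ω a} ∩ {ω | Inf ω a'} ∩
        {ω | ε/3 * n < |(chemDist ω a a').toReal - μ y * n|}) := by
      rw [hBH]
      ext ω; simp only [Set.mem_ofPred_eq, Set.mem_iUnion, Set.mem_inter_iff, exists_prop]
      simp only [and_assoc]
    rw [this]
    exact Finset.measurableSet_biUnion _ fun a _ => Finset.measurableSet_biUnion _ fun a' _ =>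
      ((measurableSet_inf a).inter (measurableSet_inf a')).inter
        (measurableSet_lt measurable_const (((measurable_chemDist a a').ennreal_toReal.sub_const _).abs))
  have e2' : (F.P p).real {ω | sh (n • x) ω ∈ BH y} < 1/10 := by
    rw [measureReal_def, sh_prob F hp0 hp1 _ hmeas]; exact e2
  set B1 : Set (Config d) := {ω : Config d | ¬ ∃ y ∈ box (0 : V d) M, Inf ω y} with hB1
  set B2 : Set (Config d) := {ω : Config d | ¬ ∃ y ∈ box (n • x) M, Inf ω y} with hB2
  set B3 : Set (Config d) := {ω : Config d | ¬ ∃ z ∈ box (n • (x + y)) M, Inf ω z} with hB3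
  set B4 : Set (Config d) := {ω | sh (n • x) ω ∈ BH y} with hB4
  have ex : ∃ ω, (∀ x y, Inf ω x → Inf ω y → Reach ω x y) ∧ ω ∉ (B1 ∪ (B2 ∪ (B3 ∪ (B4 ∪ (BH x ∪ BH (x+y))))) : Set (Config d)) := by
    by_contra hc
    push Not at hc
    have hae : ∀ᵐ ω ∂(F.P p), ω ∈ (Set.univ : Set (Config d)) → ω ∈ (B1 ∪ (B2 ∪ (B3 ∪ (B4 ∪ (BH x ∪ BH (x+y))))) : Set (Config d)) := by
      filter_upwards [hUE.1] with ω hω _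
      exact hc ω hω
    have hle : (F.P p).real Set.univ ≤ (F.P p).real (B1 ∪ (B2 ∪ (B3 ∪ (B4 ∪ (BH x ∪ BH (x+y)))))) :=
      ENNReal.toReal_mono (measure_ne_top _ _) (measure_mono_ae hae)
    rw [probReal_univ] at hle
    have q1 := measureReal_union_le (μ := F.P p) B1 (B2 ∪ (B3 ∪ (B4 ∪ (BH x ∪ BH (x+y)))))
    have q2 := measureReal_union_le (μ := F.P p) B2 (B3 ∪ (B4 ∪ (BH x ∪ BH (x+y))))
    have q3 := measureReal_union_le (μ := F.P p) B3 (B4 ∪ (BH x ∪ BH (x+y)))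
    have q4 := measureReal_union_le (μ := F.P p) B4 (BH x ∪ BH (x+y))
    have q5 := measureReal_union_le (μ := F.P p) (BH x) (BH (x+y))
    have := hM 0
    have := hM (n • x)
    have := hM (n • (x+y))
    linarith
  obtain ⟨ω, hu, hnot⟩ := ex
  simp only [Set.mem_union, not_or] at hnot
  obtain ⟨b1, b2, b3, b4, b5, b6⟩ := hnot
  replace b1 : ∃ y ∈ box (0 : V d) M, Inf ω y := by by_contra hc; exact b1 hc
  replace b2 : ∃ y ∈ box (n • x) M, Inf ω y := by by_contra hc; exact b2 hc
  replace b3 : ∃ z ∈ box (n • (x + y)) M, Inf ω z := by by_contra hc; exact b3 hc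
  obtain ⟨a, ha, ia⟩ := b1
  obtain ⟨b, hb, ib⟩ := b2
  obtain ⟨c, hc, ic⟩ := b3
  rw [hBH] at b5 b6
  have d1 : |(chemDist ω a b).toReal - μ x * n| ≤ ε/3 * n := by
    by_contra h; exact b5 ⟨a, ha, b, hb, ia, ib, not_le.1 h⟩
  have d3 : |(chemDist ω a c).toReal - μ (x+y) * n| ≤ ε/3 * n := by
    by_contra h; exact b6 ⟨a, ha, c, hc, ia, ic, not_le.1 h⟩
  have d2 : |(chemDist ω b c).toReal - μ y * n| ≤ ε/3 * n := by
    by_contra h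
    have hin : sh (n • x) ω ∈ BH y := by
      rw [hBH]
      refine ⟨b - n • x, ?_, c - n • x, ?_, ?_, ?_, ?_⟩
      · rw [← mem_box_add (z := n • x)]; simpa using hb
      · rw [← mem_box_add (z := n • x)]
        have e : n • y + n • x = n • (x + y) := by rw [smul_add, add_comm]
        rw [e]; simpa using hc
      · rw [sh_inf]; simpa using ib
      · rw [sh_inf]; simpa using ic
      · rw [sh_chemDist]; simpa using not_le.1 h
    exact b4 hin
  have tri := chemDist_triangle ω a b c
  have n1 : chemDist ω a b ≠ ⊤ := connected_iff.2 (hu _ _ ia ib)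
  have n2 : chemDist ω b c ≠ ⊤ := connected_iff.2 (hu _ _ ib ic)
  have tri' := ENNReal.toReal_mono (ENNReal.add_ne_top.2 ⟨n1, n2⟩) tri
  rw [ENNReal.toReal_add n1 n2] at tri'
  have d1' := abs_le.1 d1
  have d2' := abs_le.1 d2
  have d3' := abs_le.1 d3
  have : μ (x+y) * n ≤ (μ x + μ y + ε) * n := by linarith [d1'.2, d2'.2, d3'.1]
  exact le_of_mul_le_mul_right this hn1r

theorem mu_zero (F : BernoulliFamily d) {p : ℝ} {μ : V d → ℝ} (hconv : ASTimeConstant (F.P p) μ) : μ 0 = 0 := by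
  have := F.prob p
  obtain ⟨ω, hω⟩ := (hconv 0).exists
  refine tendsto_nhds_unique hω ?_
  refine (tendsto_const_nhds (x := (0:ℝ))).congr fun n => ?_
  simp [DReg, chemDist_self]

theorem mu_le (F : BernoulliFamily d) {p : ℝ} (hp0 : 0 ≤ p) (hp1 : p ≤ 1) (hUE : UE (F.P p)) {μ : V d → ℝ}
    (hconv : ASTimeConstant (F.P p) μ) : ∃ K₁ : ℝ, 0 ≤ K₁ ∧ ∀ x, μ x ≤ K₁ * norm1 x := by
  refine ⟨∑ v ∈ box (0 : V d) 1, |μ v|, Finset.sum_nonneg fun _ _ => abs_nonneg _, ?_⟩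
  have key : ∀ n : ℕ, ∀ x : V d, dist1 x 0 = n → μ x ≤ (∑ v ∈ box (0 : V d) 1, |μ v|) * n := by
    intro n
    induction n with
    | zero => intro x hx; obtain rfl := dist1_eq_zero hx; rw [mu_zero F hconv]; simp
    | succ n ih =>
      intro x hx
      obtain ⟨z, h1, h2⟩ : ∃ z : V d, dist1 x z = 1 ∧ dist1 z 0 = n := by
        have hne : x ≠ 0 := by rintro rfl; rw [dist1_self] at hx; omega
        obtain ⟨z, h1, h2, -⟩ := exists_step hne
        exact ⟨z, h1, by omega⟩
      have h3 := mu_subadd F hp0 hp1 hUE hconv z (x - z)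
      rw [add_sub_cancel] at h3
      have h4 : x - z ∈ box (0 : V d) 1 := by
        refine mem_box.2 fun k => ?_
        have := coord_le_dist1 x z k
        rw [h1] at this
        have := abs_le.1 this
        rw [abs_le]
        simp only [Pi.sub_apply, Pi.zero_apply]
        push_cast at *
        omega
      have h5 := Finset.single_le_sum (f := fun v => |μ v|) (fun _ _ => abs_nonneg _) h4
      have h6 := ih z h2
      have h7 := le_abs_self (μ (x - z))
      push_cast
      linarith
  intro x
  exact key _ x rfl

end Perco

namespace Perco
variable {d : ℕ}

/-! ### Passing to the limit -/
theorem mu_diff_min {F : BernoulliFamily d} {p₀ : ℝ} {N ℓ C : ℕ} {A b : ℝ} (hd : 1 ≤ d) (h : LUP F p₀ N ℓ C A b)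
    (hp₀ : 0 < p₀) {H : ℕ} (hH : 2 * ℓ^(2*d) ≤ H) {C₂ : ℝ} {K : ℕ} {εs : ℕ → ℝ} (hεs : Tendsto εs atTop (𝓝 0))
    (hb : ∀ j : ℕ, ∀ y : V d, ∀ t : ℝ, p₀ ≤ t → t ≤ 1 →
      t * ∑ e ∈ edgesIn (box (0 : V d) (K*H^j)), ∫ ω, (XX y (2*(N*ℓ^j)+1) (K*H^j) (cls e ω) - XX y (2*(N*ℓ^j)+1) (K*H^j) (opn e ω)) ∂(F.P t)
        ≤ ((K*H^j : ℕ) : ℝ) * (C₂ + εs j))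
    {p q : ℝ} (hp : p₀ ≤ p) (hpq : p ≤ q) (hq : q ≤ 1) (hUp : UE (F.P p)) (hUq : UE (F.P q)) {μp μq : V d → ℝ}
    (hcp : ASTimeConstant (F.P p) μp) (hcq : ASTimeConstant (F.P q) μq) {x : V d} (hx : x ≠ 0) :
    0 ≤ min (μp x) K - min (μq x) K ∧ min (μp x) K - min (μq x) K ≤ (q - p) * (K * C₂ / p₀) := by
  have hH1 : 0 < H := by
    have : 1 ≤ ℓ^(2*d) := Nat.one_le_pow _ _ (by have := h.hℓ; omega)
    omega
  have l1 := h.conv hd hp₀ hp (hpq.trans hq) hUp hcp hH K hx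
  have l2 := h.conv hd hp₀ (hp.trans hpq) hq hUq hcq hH K hx
  have l := l1.sub l2
  have hd' := fun j : ℕ => integral_XX_diff F (H^j • x) (2*(N*ℓ^j)+1) (K*H^j) hp₀ (hb j (H^j • x)) hp hpq hq
  constructor
  · refine ge_of_tendsto' l fun j => ?_
    rw [← sub_div]
    exact div_nonneg (hd' j).1 (by positivity)
  · have r : Tendsto (fun j => (q - p) * (K * (C₂ + εs j) / p₀)) atTop (𝓝 ((q - p) * (K * C₂ / p₀))) := by
      have := (((hεs.const_add C₂).const_mul (K:ℝ)).div_const p₀).const_mul (q - p)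
      simpa using this
    refine le_of_tendsto_of_tendsto' l r fun j => ?_
    have hpos : (0:ℝ) < (H:ℝ)^j := by positivity
    rw [← sub_div, div_le_iff₀ hpos]
    refine (hd' j).2.trans (le_of_eq ?_)
    push_cast
    ring

theorem main_bound (hd : 2 ≤ d) (F : BernoulliFamily d)
    (p₀ : ℝ) (hp₀ : pc F < p₀) (hp₀1 : p₀ < 1)
    (μ : ℝ → V d → ℝ)
    (hconv : ∀ p, pc F < p → p ≤ 1 → ASTimeConstant (F.P p) (μ p)) :
    ∃ M : ℝ, 0 ≤ M ∧ ∀ p q : ℝ, p₀ ≤ p → p ≤ q → q ≤ 1 → ∀ x : V d,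
        0 ≤ μ p x - μ q x ∧ μ p x - μ q x ≤ M * norm1 x * (q - p) := by
  have hd1 : 1 ≤ d := by omega
  have hpc := pc_nonneg F
  have hp0 : 0 < p₀ := by linarith
  obtain ⟨p₁, ha, hb, hz⟩ := exists_t_null F (a := pc F + (p₀ - pc F)/3) (b := pc F + 2*(p₀ - pc F)/3)
    (by linarith) (by linarith) (by linarith)
  have h1c : pc F < p₁ := by linarith
  have h1pos : 0 < p₁ := by linarith
  have h10 : p₁ < p₀ := by linarith
  have h11 : p₁ ≤ 1 := by linarith
  have hu := uniq_of_null F h1pos h11 hz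
  have hUE : UE (F.P p₁) := ⟨hu, exists_as hd1 F h1c h11 hu (hconv p₁ h1c h11)⟩
  obtain ⟨N, ℓ, C, A, b, q1, q2, q3, q4, q5, q6, q7⟩ := LU hd F h1pos.le h10 hp₀1 hUE (hconv p₁ h1c h11)
  have h : LUP F p₀ N ℓ C A b := ⟨q1, q2, q3, q4, q5, q6, q7⟩
  have hU : ∀ p, p₀ ≤ p → p ≤ 1 → UE (F.P p) := fun p hp hp1 => h.ue hd1 hp0.le h1pos.le h10.le hUE hp hp1
  have hc : ∀ p, p₀ ≤ p → p ≤ 1 → ASTimeConstant (F.P p) (μ p) := fun p hp hp1 => hconv p (hp₀.trans_le hp) hp1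
  obtain ⟨H, hH, C₂, hC₂, hbd⟩ := h.bound hd1 hp0
  obtain ⟨K₁, hK₁, hmu⟩ := mu_le F hp0.le hp₀1.le (hU p₀ le_rfl hp₀1.le) (hc p₀ le_rfl hp₀1.le)
  refine ⟨C₂ * (K₁ + 2) / p₀, by positivity, ?_⟩
  intro p q hp hpq hq x
  by_cases hx : x = 0
  · subst hx
    rw [mu_zero F (hc p hp (hpq.trans hq)), mu_zero F (hc q (hp.trans hpq) hq)]
    simp [norm1, dist1_self]
  have hn : (1:ℝ) ≤ norm1 x := by
    have : dist1 x 0 ≠ 0 := fun h0 => hx (dist1_eq_zero h0)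
    have : 1 ≤ dist1 x 0 := by omega
    unfold norm1; exact_mod_cast this
  obtain ⟨K, hK⟩ : ∃ K : ℕ, K = ⌈K₁ * norm1 x⌉₊ + 1 := ⟨_, rfl⟩
  have hnn : 0 ≤ K₁ * norm1 x := by positivity
  have hK1 : K₁ * norm1 x < K := by
    have := Nat.le_ceil (K₁ * norm1 x)
    rw [hK]; push_cast; linarith
  have hK2 : (K:ℝ) ≤ (K₁ + 2) * norm1 x := by
    have := Nat.ceil_lt_add_one hnn
    rw [hK]; push_cast; linarith
  obtain ⟨εs, hεs, hb'⟩ := hbd K (by omega)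
  have hlt : ∀ p, p₀ ≤ p → p ≤ 1 → min (μ p x) K = μ p x := by
    intro p hp hp1
    have h1 := (mu_diff_min hd1 h hp0 hH hεs hb' le_rfl hp hp1 (hU p₀ le_rfl hp₀1.le) (hU p hp hp1) (hc p₀ le_rfl hp₀1.le) (hc p hp hp1) hx).1
    have h2 := min_le_left (μ p₀ x) (K:ℝ)
    have h3 := hmu x
    refine min_eq_left ?_
    by_contra hcon
    rw [min_eq_right (not_le.1 hcon).le] at h1
    linarith
  have hfin := mu_diff_min hd1 h hp0 hH hεs hb' hp hpq hq (hU p hp (hpq.trans hq)) (hU q (hp.trans hpq) hq)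
    (hc p hp (hpq.trans hq)) (hc q (hp.trans hpq) hq) hx
  rw [hlt p hp (hpq.trans hq), hlt q (hp.trans hpq) hq] at hfin
  refine ⟨hfin.1, hfin.2.trans ?_⟩
  have hqp : 0 ≤ q - p := by linarith
  calc (q - p) * (K * C₂ / p₀) ≤ (q - p) * ((K₁ + 2) * norm1 x * C₂ / p₀) := by gcongr
    _ = C₂ * (K₁ + 2) / p₀ * norm1 x * (q - p) := by ring

/-- **Quantitative comparison of time constants.**
Let `p₀ > p_c(d)`. For every `ε ∈ (0, 1 - p₀)`, every `p₀ ≤ p ≤ q ≤ 1` and every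
`x ∈ ℤ^d`, `0 ≤ μ_p(x) - μ_q(x) ≤ η'_d(p₀) ‖x‖₁ (C₁ |log ε| (q-p) + ε)`. -/
theorem statement_17 (d : ℕ) (hd : 2 ≤ d) (F : BernoulliFamily d)
    (p₀ : ℝ) (hp₀ : pc F < p₀) (hp₀1 : p₀ ≤ 1)
    (μ : ℝ → V d → ℝ)
    (hconv : ∀ p, pc F < p → p ≤ 1 → ASTimeConstant (F.P p) (μ p)) :
    ∃ η C₁ : ℝ, 0 < η ∧ 0 < C₁ ∧
      ∀ ε : ℝ, 0 < ε → ε < 1 - p₀ →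
      ∀ p q : ℝ, p₀ ≤ p → p ≤ q → q ≤ 1 → ∀ x : V d,
        0 ≤ μ p x - μ q x ∧
        μ p x - μ q x ≤ η * norm1 x * (C₁ * |Real.log ε| * (q - p) + ε) := by
  rcases hp₀1.lt_or_eq with hlt | heq
  swap
  · refine ⟨1, 1, one_pos, one_pos, fun ε h1 h2 => ?_⟩
    exfalso; linarith
  obtain ⟨M, hM, hb⟩ := main_bound hd F p₀ hp₀ hlt μ hconv
  have hpc := pc_nonneg F
  have hlog : Real.log (1 - p₀) < 0 := Real.log_neg (by linarith) (by linarith)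
  refine ⟨M + 1, 1 / |Real.log (1 - p₀)|, by positivity, one_div_pos.2 (abs_pos.2 hlog.ne), ?_⟩
  intro ε h1 h2 p q hp hpq hq x
  refine ⟨(hb p q hp hpq hq x).1, (hb p q hp hpq hq x).2.trans ?_⟩
  have hl : Real.log ε < Real.log (1 - p₀) := Real.log_lt_log h1 h2
  have habs : |Real.log (1 - p₀)| ≤ |Real.log ε| := by
    rw [abs_of_neg hlog, abs_of_neg (hl.trans hlog)]; linarith
  have hone : 1 ≤ 1 / |Real.log (1 - p₀)| * |Real.log ε| := by
    rw [one_div, inv_mul_eq_div, one_le_div (abs_pos.2 hlog.ne)]; exact habs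
  have hn : 0 ≤ norm1 x := by unfold norm1; positivity
  have hqp : 0 ≤ q - p := by linarith
  have h3 : q - p ≤ 1 / |Real.log (1 - p₀)| * |Real.log ε| * (q - p) + ε := by nlinarith
  calc M * norm1 x * (q - p) ≤ (M + 1) * norm1 x * (q - p) := by gcongr; linarith
    _ ≤ _ := by gcongr

end Perco
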